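/- arXiv:1805.06535 — 2 statements merged into one kernel-verified Lean document; each statement's English description precedes it below -/
import Mathlib

section
/- Let c > 0 be a constant such that c·∫₀^∞|u|² ≤ ∫₀^∞|u'|² + ∫₀^∞ x^β|u|² for every continuously differentiable u : [0,∞) → ℂ with u, u' square-integrable. Then for every η ∈ ℂ with |η| < c there exists a twice continuously differentiable function F : [0,∞) → ℂ such that F, F', F'' and x^{β/2}F(x) are square-integrable on (0,∞), F'(0) = 1, and −F''(x) + i x^β F(x) − η F(x) = 0 for all x ≥ 0. -/
open MeasureTheory Set

/-! ### Exponential series solving `f'' - f' = e^{2s} (e^{βs} - μ) f` -/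

/-- Exponents of the series solution. -/
noncomputable def seriesExponent (β ε : ℝ) (n j : ℕ) : ℝ := ε + β * j + 2 * n

/-- Coefficients of the series solution. -/
noncomputable def seriesCoeff (β ε : ℝ) (μ : ℂ) : ℕ → ℕ → ℂ
  | 0, 0 => 1
  | 0, _ + 1 => 0
  | n + 1, 0 => (-μ * seriesCoeff β ε μ n 0) /
      (seriesExponent β ε (n + 1) 0 * (seriesExponent β ε (n + 1) 0 - 1) : ℝ)
  | n + 1, j + 1 => (seriesCoeff β ε μ n j - μ * seriesCoeff β ε μ n (j + 1)) /
      (seriesExponent β ε (n + 1) (j + 1) * (seriesExponent β ε (n + 1) (j + 1) - 1) : ℝ)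

/-- The `n`-th iterate of the series solution. -/
noncomputable def seriesTerm (β ε : ℝ) (μ : ℂ) (n : ℕ) (s : ℂ) : ℂ :=
  ∑ j ∈ Finset.range (n + 1),
    seriesCoeff β ε μ n j * Complex.exp ((seriesExponent β ε n j : ℝ) * s)

/-- Termwise absolute majorant of `seriesTerm`. -/
noncomputable def seriesMajorant (β ε : ℝ) (μ : ℂ) (n : ℕ) (r : ℝ) : ℝ :=
  ∑ j ∈ Finset.range (n + 1),
    ‖seriesCoeff β ε μ n j‖ * Real.exp (seriesExponent β ε n j * r)

lemma seriesCoeff_eq_zero (β ε : ℝ) (μ : ℂ) :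
    ∀ n j : ℕ, n < j → seriesCoeff β ε μ n j = 0
  | 0, 0, h => by omega
  | 0, j + 1, _ => by simp [seriesCoeff]
  | n + 1, 0, h => by omega
  | n + 1, j + 1, h => by
    simp [seriesCoeff, seriesCoeff_eq_zero β ε μ n j (by omega),
      seriesCoeff_eq_zero β ε μ n (j + 1) (by omega)]

lemma le_seriesExponent {β ε : ℝ} (hβ : 0 ≤ β) (hε : 0 ≤ ε) (n j : ℕ) :
    2 * (n : ℝ) ≤ seriesExponent β ε n j := by
  have : 0 ≤ β * j := by positivity
  unfold seriesExponent; linarith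

lemma succ_le_seriesExponent_mul {β ε : ℝ} (hβ : 0 ≤ β) (hε : 0 ≤ ε) (n j : ℕ) :
    (n : ℝ) + 1 ≤ seriesExponent β ε (n + 1) j * (seriesExponent β ε (n + 1) j - 1) := by
  have h := le_seriesExponent hβ hε (n + 1) j
  push_cast at h
  have hn : (0 : ℝ) ≤ n := n.cast_nonneg
  nlinarith

lemma hasDerivAt_seriesTerm (β ε : ℝ) (μ : ℂ) (n : ℕ) (s : ℂ) :
    HasDerivAt (seriesTerm β ε μ n)
      (∑ j ∈ Finset.range (n + 1), seriesCoeff β ε μ n j *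
        (Complex.exp ((seriesExponent β ε n j : ℝ) * s) * (seriesExponent β ε n j : ℝ))) s := by
  refine HasDerivAt.fun_sum fun j _ => HasDerivAt.const_mul _ ?_
  simpa using ((hasDerivAt_id s).const_mul ((seriesExponent β ε n j : ℝ) : ℂ)).cexp

lemma deriv_seriesTerm (β ε : ℝ) (μ : ℂ) (n : ℕ) :
    deriv (seriesTerm β ε μ n) = fun s => ∑ j ∈ Finset.range (n + 1), seriesCoeff β ε μ n j *
        (Complex.exp ((seriesExponent β ε n j : ℝ) * s) * (seriesExponent β ε n j : ℝ)) :=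
  funext fun s => (hasDerivAt_seriesTerm β ε μ n s).deriv

lemma deriv_deriv_seriesTerm (β ε : ℝ) (μ : ℂ) (n : ℕ) (s : ℂ) :
    deriv (deriv (seriesTerm β ε μ n)) s = ∑ j ∈ Finset.range (n + 1), seriesCoeff β ε μ n j *
        (Complex.exp ((seriesExponent β ε n j : ℝ) * s) * (seriesExponent β ε n j : ℝ) *
          (seriesExponent β ε n j : ℝ)) := by
  rw [deriv_seriesTerm]
  refine (HasDerivAt.fun_sum fun j _ => HasDerivAt.const_mul _ (HasDerivAt.mul_const ?_ _)).deriv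
  simpa using ((hasDerivAt_id s).const_mul ((seriesExponent β ε n j : ℝ) : ℂ)).cexp

lemma seriesExponent_succ_zero (β ε : ℝ) (n : ℕ) :
    seriesExponent β ε (n + 1) 0 = seriesExponent β ε n 0 + 2 := by
  simp only [seriesExponent]; push_cast; ring

lemma seriesExponent_succ_succ (β ε : ℝ) (n j : ℕ) :
    seriesExponent β ε (n + 1) (j + 1) = seriesExponent β ε n j + (β + 2) := by
  simp only [seriesExponent]; push_cast; ring

lemma seriesExponent_succ_succ' (β ε : ℝ) (n j : ℕ) :
    seriesExponent β ε (n + 1) (j + 1) = seriesExponent β ε n (j + 1) + 2 := by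
  simp only [seriesExponent]; push_cast; ring

lemma seriesTerm_succ {β ε : ℝ} (hβ : 0 ≤ β) (hε : 0 ≤ ε) (μ : ℂ) (n : ℕ) (s : ℂ) :
    deriv (deriv (seriesTerm β ε μ (n + 1))) s - deriv (seriesTerm β ε μ (n + 1)) s =
      Complex.exp (2 * s) * (Complex.exp (β * s) - μ) * seriesTerm β ε μ n s := by
  have hne : ∀ j, ((seriesExponent β ε (n + 1) j *
      (seriesExponent β ε (n + 1) j - 1) : ℝ) : ℂ) ≠ 0 := fun j => by
    have := succ_le_seriesExponent_mul hβ hε n j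
    have hn : (0 : ℝ) ≤ n := n.cast_nonneg
    exact_mod_cast (by linarith : (0 : ℝ) < _).ne'
  have hshift : ∀ t : ℝ, Complex.exp (((t + (β + 2) : ℝ) : ℂ) * s) =
      Complex.exp (2 * s) * Complex.exp (β * s) * Complex.exp (t * s) := fun t => by
    rw [← Complex.exp_add, ← Complex.exp_add]; congr 1; push_cast; ring
  have hshift' : ∀ t : ℝ, Complex.exp (((t + 2 : ℝ) : ℂ) * s) =
      Complex.exp (2 * s) * Complex.exp (t * s) := fun t => by
    rw [← Complex.exp_add]; congr 1; push_cast; ring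
  have key : ∀ j, seriesCoeff β ε μ (n + 1) j *
        (Complex.exp ((seriesExponent β ε (n + 1) j : ℝ) * s) * (seriesExponent β ε (n + 1) j : ℝ) *
          (seriesExponent β ε (n + 1) j : ℝ)) - seriesCoeff β ε μ (n + 1) j *
        (Complex.exp ((seriesExponent β ε (n + 1) j : ℝ) * s) * (seriesExponent β ε (n + 1) j : ℝ))
      = seriesCoeff β ε μ (n + 1) j * ((seriesExponent β ε (n + 1) j *
      (seriesExponent β ε (n + 1) j - 1) : ℝ) : ℂ) *
        Complex.exp ((seriesExponent β ε (n + 1) j : ℝ) * s) := fun j => by push_cast; ring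
  have key0 : seriesCoeff β ε μ (n + 1) 0 * ((seriesExponent β ε (n + 1) 0 *
      (seriesExponent β ε (n + 1) 0 - 1) : ℝ) : ℂ) *
        Complex.exp ((seriesExponent β ε (n + 1) 0 : ℝ) * s) =
      -μ * Complex.exp (2 * s) *
        (seriesCoeff β ε μ n 0 * Complex.exp ((seriesExponent β ε n 0 : ℝ) * s)) := by
    rw [seriesCoeff, div_mul_cancel₀ _ (hne 0), seriesExponent_succ_zero, hshift']; ring
  have key1 : ∀ j, seriesCoeff β ε μ (n + 1) (j + 1) * ((seriesExponent β ε (n + 1) (j + 1) *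
      (seriesExponent β ε (n + 1) (j + 1) - 1) : ℝ) : ℂ) *
        Complex.exp ((seriesExponent β ε (n + 1) (j + 1) : ℝ) * s) =
      Complex.exp (2 * s) * Complex.exp (β * s) *
        (seriesCoeff β ε μ n j * Complex.exp ((seriesExponent β ε n j : ℝ) * s)) +
      -μ * Complex.exp (2 * s) * (seriesCoeff β ε μ n (j + 1) *
        Complex.exp ((seriesExponent β ε n (j + 1) : ℝ) * s)) := fun j => by
    rw [seriesCoeff, div_mul_cancel₀ _ (hne (j + 1)), sub_mul]
    nth_rewrite 1 [seriesExponent_succ_succ]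
    rw [seriesExponent_succ_succ', hshift, hshift']; ring
  rw [deriv_deriv_seriesTerm, deriv_seriesTerm, ← Finset.sum_sub_distrib,
    Finset.sum_congr rfl fun j _ => key j, Finset.sum_range_succ', key0,
    Finset.sum_congr rfl fun j _ => key1 j, Finset.sum_add_distrib, ← Finset.mul_sum,
    ← Finset.mul_sum, add_assoc, ← mul_add,
    ← Finset.sum_range_succ' (fun j => seriesCoeff β ε μ n j *
      Complex.exp ((seriesExponent β ε n j : ℝ) * s)), Finset.sum_range_succ _ (n + 1),
    seriesCoeff_eq_zero β ε μ n (n + 1) (by omega)]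
  simp only [seriesTerm]
  ring

lemma seriesMajorant_succ {β ε : ℝ} (hβ : 0 ≤ β) (hε : 0 ≤ ε) (μ : ℂ) (n : ℕ) (r : ℝ) :
    ((n : ℝ) + 1) * seriesMajorant β ε μ (n + 1) r ≤
      Real.exp (2 * r) * (Real.exp (β * r) + ‖μ‖) * seriesMajorant β ε μ n r := by
  have hn : (0 : ℝ) ≤ n := n.cast_nonneg
  have hc : ∀ (j : ℕ) (w : ℂ), seriesCoeff β ε μ (n + 1) j = w / ((seriesExponent β ε (n + 1) j *
      (seriesExponent β ε (n + 1) j - 1) : ℝ) : ℂ) →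
      ((n : ℝ) + 1) * ‖seriesCoeff β ε μ (n + 1) j‖ ≤ ‖w‖ := fun j w hw => by
    have h := succ_le_seriesExponent_mul hβ hε n j
    rw [hw, norm_div, Complex.norm_real, Real.norm_of_nonneg (by linarith), mul_div_assoc',
      div_le_iff₀ (by linarith), mul_comm]
    exact mul_le_mul_of_nonneg_left h (norm_nonneg _)
  have hshift : ∀ t : ℝ, Real.exp ((t + (β + 2)) * r) =
      Real.exp (2 * r) * Real.exp (β * r) * Real.exp (t * r) := fun t => by
    rw [← Real.exp_add, ← Real.exp_add]; congr 1; ring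
  have hshift' : ∀ t : ℝ, Real.exp ((t + 2) * r) =
      Real.exp (2 * r) * Real.exp (t * r) := fun t => by
    rw [← Real.exp_add]; congr 1; ring
  have key0 : ((n : ℝ) + 1) * (‖seriesCoeff β ε μ (n + 1) 0‖ *
        Real.exp (seriesExponent β ε (n + 1) 0 * r)) ≤
      ‖μ‖ * Real.exp (2 * r) *
        (‖seriesCoeff β ε μ n 0‖ * Real.exp (seriesExponent β ε n 0 * r)) := by
    have h := hc 0 _ (by rw [seriesCoeff])
    rw [seriesExponent_succ_zero, hshift']
    rw [norm_mul, norm_neg] at h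
    calc _ = (((n : ℝ) + 1) * ‖seriesCoeff β ε μ (n + 1) 0‖) *
          (Real.exp (2 * r) * Real.exp (seriesExponent β ε n 0 * r)) := by ring
      _ ≤ (‖μ‖ * ‖seriesCoeff β ε μ n 0‖) *
          (Real.exp (2 * r) * Real.exp (seriesExponent β ε n 0 * r)) := by gcongr
      _ = _ := by ring
  have key1 : ∀ j, ((n : ℝ) + 1) * (‖seriesCoeff β ε μ (n + 1) (j + 1)‖ *
        Real.exp (seriesExponent β ε (n + 1) (j + 1) * r)) ≤
      Real.exp (2 * r) * Real.exp (β * r) *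
        (‖seriesCoeff β ε μ n j‖ * Real.exp (seriesExponent β ε n j * r)) +
      ‖μ‖ * Real.exp (2 * r) *
        (‖seriesCoeff β ε μ n (j + 1)‖ * Real.exp (seriesExponent β ε n (j + 1) * r)) :=
      fun j => by
    have h := (hc (j + 1) _ (by rw [seriesCoeff])).trans (norm_sub_le _ _)
    rw [norm_mul] at h
    calc _ = (((n : ℝ) + 1) * ‖seriesCoeff β ε μ (n + 1) (j + 1)‖) *
          Real.exp (seriesExponent β ε (n + 1) (j + 1) * r) := by ring
      _ ≤ (‖seriesCoeff β ε μ n j‖ + ‖μ‖ * ‖seriesCoeff β ε μ n (j + 1)‖) *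
          Real.exp (seriesExponent β ε (n + 1) (j + 1) * r) := by gcongr
      _ = _ := by
        rw [add_mul]
        nth_rewrite 1 [seriesExponent_succ_succ]
        rw [seriesExponent_succ_succ', hshift, hshift']; ring
  rw [seriesMajorant, Finset.mul_sum, Finset.sum_range_succ']
  refine (add_le_add (Finset.sum_le_sum fun j _ => key1 j) key0).trans ?_
  rw [Finset.sum_add_distrib, ← Finset.mul_sum, ← Finset.mul_sum, add_assoc, ← mul_add,
    ← Finset.sum_range_succ' (fun j => ‖seriesCoeff β ε μ n j‖ *
      Real.exp (seriesExponent β ε n j * r)), Finset.sum_range_succ _ (n + 1),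
    seriesCoeff_eq_zero β ε μ n (n + 1) (by omega)]
  simp only [seriesMajorant]
  refine le_of_eq ?_
  simp only [norm_zero, zero_mul, add_zero]
  ring

lemma seriesMajorant_le {β ε : ℝ} (hβ : 0 ≤ β) (hε : 0 ≤ ε) (μ : ℂ) (n : ℕ) (r : ℝ) :
    seriesMajorant β ε μ n r ≤
      (Real.exp (2 * r) * (Real.exp (β * r) + ‖μ‖)) ^ n / n.factorial * Real.exp (ε * r) := by
  induction n with
  | zero => simp [seriesMajorant, seriesCoeff, seriesExponent]
  | succ n ih =>
    have hn : (0 : ℝ) < n + 1 := by positivity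
    have h := (seriesMajorant_succ hβ hε μ n r).trans
      (mul_le_mul_of_nonneg_left ih (by positivity))
    rw [← le_div_iff₀' hn] at h
    refine h.trans (le_of_eq ?_)
    rw [Nat.factorial_succ, pow_succ]
    push_cast
    field_simp

lemma norm_seriesTerm_le {β ε : ℝ} (hβ : 0 ≤ β) (hε : 0 ≤ ε) (μ : ℂ) (n : ℕ) {s : ℂ} {r : ℝ}
    (hs : s.re ≤ r) :
    ‖seriesTerm β ε μ n s‖ ≤
      (Real.exp (2 * r) * (Real.exp (β * r) + ‖μ‖)) ^ n / n.factorial * Real.exp (ε * r) := by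
  refine le_trans ?_ (seriesMajorant_le hβ hε μ n r)
  refine (norm_sum_le _ _).trans (Finset.sum_le_sum fun j _ => ?_)
  rw [norm_mul, Complex.norm_exp, Complex.re_ofReal_mul]
  have := le_seriesExponent hβ hε n j
  have hn : (0 : ℝ) ≤ n := n.cast_nonneg
  gcongr
  linarith

lemma exists_norm_tsum_seriesTerm_sub_le {β ε : ℝ} (hβ : 0 ≤ β) (hε0 : 0 ≤ ε) (hε1 : ε ≤ 1)
    (μ : ℂ) : ∃ K : ℝ, 0 ≤ K ∧ ∀ s : ℂ, s.re ≤ 1 →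
      ‖(∑' n, seriesTerm β ε μ n s) - Complex.exp (ε * s)‖ ≤ K * Real.exp (2 * s.re) := by
  have hsum : ∀ r : ℝ, Summable fun n : ℕ =>
      (Real.exp (2 * r) * (Real.exp (β * r) + ‖μ‖)) ^ n / n.factorial * Real.exp (ε * r) :=
    fun r => (Real.summable_pow_div_factorial _).mul_right _
  have hterm0 : ∀ s, seriesTerm β ε μ 0 s = Complex.exp (ε * s) := fun s => by
    simp [seriesTerm, seriesCoeff, seriesExponent]
  let X : ℝ := Real.exp 2 * (Real.exp β + ‖μ‖)
  refine ⟨(Real.exp β + ‖μ‖) * (Real.exp X * Real.exp 1), by positivity, fun s hs => ?_⟩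
  let Y : ℝ := Real.exp (2 * s.re) * (Real.exp (β * s.re) + ‖μ‖)
  have hY0 : 0 ≤ Y := by positivity
  have hbr : Real.exp (β * s.re) ≤ Real.exp β := Real.exp_le_exp.mpr (by nlinarith)
  have hY1 : Y ≤ Real.exp (2 * s.re) * (Real.exp β + ‖μ‖) :=
    mul_le_mul_of_nonneg_left (by linarith) (Real.exp_pos _).le
  have hYX : Y ≤ X := by
    refine hY1.trans (mul_le_mul_of_nonneg_right (Real.exp_le_exp.mpr (by linarith))
      (by positivity))
  have hs1 : Summable fun n => seriesTerm β ε μ n s :=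
    Summable.of_norm_bounded (hsum s.re) fun n => norm_seriesTerm_le hβ hε0 μ n le_rfl
  have heq : (∑' n, seriesTerm β ε μ n s) - Complex.exp (ε * s) =
      ∑' n, seriesTerm β ε μ (n + 1) s := by
    rw [← hterm0, sub_eq_iff_eq_add']
    exact hs1.tsum_eq_zero_add
  have hle : ∀ n, ‖seriesTerm β ε μ (n + 1) s‖ ≤ Y ^ n / n.factorial * (Y * Real.exp 1) := by
    intro n
    refine (norm_seriesTerm_le hβ hε0 μ (n + 1) le_rfl).trans ?_
    have h1 : Real.exp (ε * s.re) ≤ Real.exp 1 := Real.exp_le_exp.mpr (by nlinarith)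
    have h2 : Y ^ (n + 1) / (n + 1).factorial ≤ Y ^ n / n.factorial * Y := by
      rw [pow_succ, div_mul_eq_mul_div]
      gcongr
      omega
    calc _ ≤ (Y ^ n / n.factorial * Y) * Real.exp 1 := by gcongr
      _ = _ := by ring
  have hsY : HasSum (fun n : ℕ => Y ^ n / n.factorial * (Y * Real.exp 1))
      (Real.exp Y * (Y * Real.exp 1)) := by
    have := NormedSpace.expSeries_div_hasSum_exp (𝔸 := ℝ) Y
    rw [← Real.exp_eq_exp_ℝ] at this
    exact this.mul_right _
  rw [heq]
  refine (tsum_of_norm_bounded hsY hle).trans ?_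
  calc Real.exp Y * (Y * Real.exp 1)
      ≤ Real.exp X * ((Real.exp (2 * s.re) * (Real.exp β + ‖μ‖)) * Real.exp 1) := by gcongr
    _ = _ := by ring

lemma tendsto_sum_deriv_of_summable_norm {u : ℕ → ℂ → ℂ} {b : ℕ → ℝ} {U : Set ℂ}
    (hb : Summable b) (hu : ∀ n, Differentiable ℂ (u n)) (hU : IsOpen U)
    (hle : ∀ n, ∀ w ∈ U, ‖u n w‖ ≤ b n) {s : ℂ} (hs : s ∈ U) :
    DifferentiableAt ℂ (fun w => ∑' n, u n w) s ∧
    Filter.Tendsto (fun N : ℕ => ∑ n ∈ Finset.range N, u n s) Filter.atTop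
      (nhds (∑' n, u n s)) ∧
    Filter.Tendsto (fun N : ℕ => ∑ n ∈ Finset.range N, deriv (u n) s) Filter.atTop
      (nhds (deriv (fun w => ∑' n, u n w) s)) ∧
    Filter.Tendsto (fun N : ℕ => ∑ n ∈ Finset.range N, deriv (deriv (u n)) s) Filter.atTop
      (nhds (deriv (deriv (fun w => ∑' n, u n w)) s)) := by
  have hpd : ∀ N : ℕ, Differentiable ℂ fun w => ∑ n ∈ Finset.range N, u n w :=
    fun N => Differentiable.fun_sum fun n _ => hu n
  have h0 := (tendstoUniformlyOn_tsum_nat hb hle).tendstoLocallyUniformlyOn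
  have h1 := h0.deriv (Filter.Eventually.of_forall fun N => (hpd N).differentiableOn) hU
  have h2 := h1.deriv (Filter.Eventually.of_forall fun N => (hpd N).deriv.differentiableOn) hU
  have hdsum : ∀ N : ℕ, deriv (fun w => ∑ n ∈ Finset.range N, u n w) =
      fun w => ∑ n ∈ Finset.range N, deriv (u n) w := fun N => funext fun w =>
    deriv_fun_sum fun n _ => (hu n) w
  have hddsum : ∀ N : ℕ, deriv (deriv (fun w => ∑ n ∈ Finset.range N, u n w)) s =
      ∑ n ∈ Finset.range N, deriv (deriv (u n)) s := fun N => by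
    rw [hdsum]; exact deriv_fun_sum fun n _ => (hu n).deriv s
  refine ⟨(Complex.differentiableOn_tsum_of_summable_norm hb
    (fun n => (hu n).differentiableOn) hU hle).differentiableAt (hU.mem_nhds hs),
    h0.tendsto_at hs, ?_, ?_⟩
  · exact (h1.tendsto_at hs).congr fun N => congrFun (hdsum N) s
  · exact (h2.tendsto_at hs).congr fun N => hddsum N

lemma exists_exp_series_solution {β ε : ℝ} (hβ : 0 ≤ β) (hε : ε = 0 ∨ ε = 1) (μ : ℂ) :
    ∃ f : ℂ → ℂ, Differentiable ℂ f ∧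
      (∀ s, deriv (deriv f) s - deriv f s =
        Complex.exp (2 * s) * (Complex.exp (β * s) - μ) * f s) ∧
      ∃ K : ℝ, ∀ s : ℂ, s.re ≤ 0 →
        ‖f s - Complex.exp (ε * s)‖ ≤ K * Real.exp (2 * s.re) ∧
        ‖deriv f s - ε * Complex.exp (ε * s)‖ ≤ K * Real.exp (2 * s.re) := by
  have hε0 : 0 ≤ ε := by rcases hε with h | h <;> simp [h]
  have hε1 : ε ≤ 1 := by rcases hε with h | h <;> simp [h]
  have hsum : ∀ r : ℝ, Summable fun n : ℕ =>
      (Real.exp (2 * r) * (Real.exp (β * r) + ‖μ‖)) ^ n / n.factorial * Real.exp (ε * r) :=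
    fun r => (Real.summable_pow_div_factorial _).mul_right _
  have hdiff : ∀ n, Differentiable ℂ (seriesTerm β ε μ n) := fun n s =>
    (hasDerivAt_seriesTerm β ε μ n s).differentiableAt
  have hlim := fun s : ℂ => tendsto_sum_deriv_of_summable_norm (hsum (s.re + 1)) hdiff
    (isOpen_lt Complex.continuous_re continuous_const : IsOpen {w : ℂ | w.re < s.re + 1})
    (fun n w hw => norm_seriesTerm_le hβ hε0 μ n (le_of_lt hw)) (s := s)
    (show s ∈ {w : ℂ | w.re < s.re + 1} by simp)
  obtain ⟨K, hK0, hK⟩ := exists_norm_tsum_seriesTerm_sub_le hβ hε0 hε1 μ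
  have hfd : Differentiable ℂ fun s => ∑' n, seriesTerm β ε μ n s := fun s => (hlim s).1
  obtain ⟨f, hf⟩ : ∃ f : ℂ → ℂ, f = fun s => ∑' n, seriesTerm β ε μ n s := ⟨_, rfl⟩
  have hfs : ∀ s, f s = ∑' n, seriesTerm β ε μ n s := fun s => by rw [hf]
  rw [← hf] at hfd
  simp only [← hfs] at hK
  simp only [← hfs] at hlim
  refine ⟨f, hfd, fun s => ?_, K * Real.exp 2, fun s hs => ⟨?_, ?_⟩⟩
  · obtain ⟨-, t0, t1, t2⟩ := hlim s
    have hfirst : deriv (deriv (seriesTerm β ε μ 0)) s - deriv (seriesTerm β ε μ 0) s = 0 := by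
      rw [deriv_deriv_seriesTerm, deriv_seriesTerm]
      rcases hε with h | h <;> simp [seriesCoeff, seriesExponent, h]
    refine tendsto_nhds_unique
      ((Filter.tendsto_add_atTop_iff_nat 1).mpr (t2.sub t1)) ?_
    convert! t0.const_mul (Complex.exp (2 * s) * (Complex.exp (β * s) - μ)) using 2 with N
    rw [← Finset.sum_sub_distrib, Finset.sum_range_succ', hfirst, add_zero,
      Finset.mul_sum]
    exact Finset.sum_congr rfl fun n _ => seriesTerm_succ hβ hε0 μ n s
  · refine (hK s (by linarith)).trans ?_
    have : 1 ≤ Real.exp 2 := Real.one_le_exp (by norm_num)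
    have : 0 ≤ Real.exp (2 * s.re) := (Real.exp_pos _).le
    nlinarith [mul_nonneg hK0 this]
  · have hg : Differentiable ℂ fun w => f w - Complex.exp (ε * w) := by fun_prop
    have hdg : deriv (fun w => f w - Complex.exp (ε * w)) s =
        deriv f s - ε * Complex.exp (ε * s) := by
      have h1 : HasDerivAt (fun w : ℂ => Complex.exp (ε * w)) (ε * Complex.exp (ε * s)) s := by
        simpa [mul_comm] using ((hasDerivAt_id s).const_mul (ε : ℂ)).cexp
      exact ((hfd s).hasDerivAt.sub h1).deriv
    rw [← hdg]
    have := Complex.norm_deriv_le_of_forall_mem_sphere_norm_le (c := s) (R := 1)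
      (C := K * Real.exp 2 * Real.exp (2 * s.re)) one_pos hg.diffContOnCl fun z hz => ?_
    · simpa using this
    · have hre : z.re ≤ s.re + 1 := by
        have h1 := Complex.abs_re_le_norm (z - s)
        rw [mem_sphere_iff_norm.mp hz, Complex.sub_re] at h1
        linarith [le_abs_self (z.re - s.re)]
      refine (hK z (by linarith)).trans ?_
      rw [mul_assoc, ← Real.exp_add]
      gcongr
      linarith

/-! ### Weyl-type estimates for `y'' = q y` with coercive `q` -/

/-- `y` solves `y'' = q y` on `[R, ∞)` with derivative `y'`. -/
def IsSolutionFrom (q : ℝ → ℂ) (R : ℝ) (y y' : ℝ → ℂ) : Prop :=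
  ∀ x, R ≤ x → HasDerivAt y (y' x) x ∧ HasDerivAt y' (q x * y x) x

/-- The rotated flux `Re (ω y' ȳ)`. -/
noncomputable def flux (ω : ℂ) (y y' : ℝ → ℂ) (x : ℝ) : ℝ :=
  (ω * (y' x * (starRingEnd ℂ) (y x))).re

/-- `q` is `δ`-coercive on `[R, ∞)` after rotation by `ω`. -/
structure IsCoerciveFrom (q : ℝ → ℂ) (R δ : ℝ) (ω : ℂ) : Prop where
  pos : 0 < δ
  norm_le : ‖ω‖ ≤ 1
  le_re : δ ≤ ω.re
  le_re_mul : ∀ x, R ≤ x → δ ≤ (ω * q x).re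

lemma le_of_hasDerivAt_nonneg {h h' : ℝ → ℝ} {a b : ℝ} (hab : a ≤ b)
    (hd : ∀ x ∈ Icc a b, HasDerivAt h (h' x) x) (hn : ∀ x ∈ Icc a b, 0 ≤ h' x) : h a ≤ h b := by
  refine monotoneOn_of_deriv_nonneg (convex_Icc a b)
    (fun x hx => (hd x hx).continuousAt.continuousWithinAt)
    (fun x hx => (hd x (interior_subset hx)).differentiableAt.differentiableWithinAt)
    (fun x hx => ?_) (left_mem_Icc.mpr hab) (right_mem_Icc.mpr hab) hab
  rw [(hd x (interior_subset hx)).deriv]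
  exact hn x (interior_subset hx)

lemma hasDerivAt_conj {y : ℝ → ℂ} {d : ℂ} {x : ℝ} (h : HasDerivAt y d x) :
    HasDerivAt (fun t => (starRingEnd ℂ) (y t)) ((starRingEnd ℂ) d) x := by
  simpa using h.star

lemma hasDerivAt_norm_sq {y : ℝ → ℂ} {d : ℂ} {x : ℝ} (h : HasDerivAt y d x) :
    HasDerivAt (fun t => ‖y t‖ ^ 2) (2 * (d * (starRingEnd ℂ) (y x)).re) x := by
  have h1 := Complex.reCLM.hasFDerivAt.comp_hasDerivAt x (h.mul (hasDerivAt_conj h))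
  convert! h1 using 1
  · funext t
    simp only [Function.comp_apply, Pi.mul_apply, Complex.mul_conj, Complex.normSq_eq_norm_sq,
      Complex.reCLM_apply, Complex.ofReal_re]
  · simp; ring

lemma abs_flux_le {ω : ℂ} (hω : ‖ω‖ ≤ 1) (y y' : ℝ → ℂ) (x : ℝ) :
    |flux ω y y' x| ≤ ‖y' x‖ * ‖y x‖ := by
  refine (Complex.abs_re_le_norm _).trans ?_
  rw [norm_mul, norm_mul, RCLike.norm_conj]
  exact mul_le_of_le_one_left (by positivity) hω

lemma hasDerivAt_mul_conj {q y y' : ℝ → ℂ} {R x : ℝ} (h : IsSolutionFrom q R y y') (hx : R ≤ x) :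
    HasDerivAt (fun t => y' t * (starRingEnd ℂ) (y t))
      ((‖y' x‖ ^ 2 : ℝ) + q x * (‖y x‖ ^ 2 : ℝ)) x := by
  convert! (h x hx).2.mul (hasDerivAt_conj (h x hx).1) using 1
  rw [mul_assoc, Complex.mul_conj, Complex.mul_conj, Complex.normSq_eq_norm_sq,
    Complex.normSq_eq_norm_sq, add_comm]

lemma hasDerivAt_flux {q y y' : ℝ → ℂ} {R x : ℝ} (ω : ℂ) (h : IsSolutionFrom q R y y')
    (hx : R ≤ x) :
    HasDerivAt (flux ω y y') (ω.re * ‖y' x‖ ^ 2 + (ω * q x).re * ‖y x‖ ^ 2) x := by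
  convert! Complex.reCLM.hasFDerivAt.comp_hasDerivAt x ((hasDerivAt_mul_conj h hx).const_mul ω)
    using 1
  simp only [Complex.reCLM_apply, mul_add, Complex.add_re, ← mul_assoc, Complex.re_mul_ofReal]

section Weyl

variable {q y y' z z' : ℝ → ℂ} {R δ N : ℝ} {ω : ℂ}

lemma IsCoerciveFrom.le_flux_deriv (hq : IsCoerciveFrom q R δ ω) {x : ℝ} (hx : R ≤ x)
    (y y' : ℝ → ℂ) :
    δ * (‖y' x‖ ^ 2 + ‖y x‖ ^ 2) ≤ ω.re * ‖y' x‖ ^ 2 + (ω * q x).re * ‖y x‖ ^ 2 := by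
  have h1 := hq.le_re
  have h2 := hq.le_re_mul x hx
  rw [mul_add]
  gcongr

lemma IsCoerciveFrom.flux_mono (hq : IsCoerciveFrom q R δ ω) (h : IsSolutionFrom q R y y')
    {a b : ℝ} (ha : R ≤ a) (hab : a ≤ b) : flux ω y y' a ≤ flux ω y y' b := by
  refine le_of_hasDerivAt_nonneg hab (fun x hx => hasDerivAt_flux ω h (ha.trans hx.1))
    fun x hx => le_trans ?_ (hq.le_flux_deriv (ha.trans hx.1) y y')
  have := hq.pos
  positivity

lemma IsCoerciveFrom.mono (hq : IsCoerciveFrom q R δ ω) {a : ℝ} (ha : R ≤ a) :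
    IsCoerciveFrom q a δ ω :=
  ⟨hq.pos, hq.norm_le, hq.le_re, fun x hx => hq.le_re_mul x (ha.trans hx)⟩

lemma IsSolutionFrom.mono (h : IsSolutionFrom q R y y') {a : ℝ} (ha : R ≤ a) :
    IsSolutionFrom q a y y' := fun x hx => h x (ha.trans hx)

lemma IsSolutionFrom.sub (h : IsSolutionFrom q R y y') (k : IsSolutionFrom q R z z') :
    IsSolutionFrom q R (fun x => y x - z x) (fun x => y' x - z' x) := fun x hx =>
  ⟨(h x hx).1.sub (k x hx).1, by
    convert! (h x hx).2.sub (k x hx).2 using 1; ring⟩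

lemma IsSolutionFrom.add (h : IsSolutionFrom q R y y') (k : IsSolutionFrom q R z z') :
    IsSolutionFrom q R (fun x => y x + z x) (fun x => y' x + z' x) := fun x hx =>
  ⟨(h x hx).1.add (k x hx).1, by
    convert! (h x hx).2.add (k x hx).2 using 1; ring⟩

lemma IsSolutionFrom.const_mul (h : IsSolutionFrom q R y y') (a : ℂ) :
    IsSolutionFrom q R (fun x => a * y x) (fun x => a * y' x) := fun x hx =>
  ⟨(h x hx).1.const_mul a, by
    convert! (h x hx).2.const_mul a using 1; ring⟩

lemma flux_const_mul (ω a : ℂ) (y y' : ℝ → ℂ) (x : ℝ) :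
    flux ω (fun x => a * y x) (fun x => a * y' x) x = ‖a‖ ^ 2 * flux ω y y' x := by
  have : ω * (a * y' x * (starRingEnd ℂ) (a * y x)) =
      ((‖a‖ ^ 2 : ℝ) : ℂ) * (ω * (y' x * (starRingEnd ℂ) (y x))) := by
    rw [← Complex.normSq_eq_norm_sq, ← Complex.mul_conj, map_mul]; ring
  rw [flux, this, Complex.re_ofReal_mul]; rfl

lemma IsCoerciveFrom.norm_sq_le (hq : IsCoerciveFrom q R δ ω) (h : IsSolutionFrom q R y y') :
    ‖y R‖ ^ 2 ≤ 2 / δ * (flux ω y y' (R + 1) - flux ω y y' R) := by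
  have hδ := hq.pos
  have key := le_of_hasDerivAt_nonneg (a := R) (b := R + 1)
    (h := fun x => ‖y x‖ ^ 2 * (R + 1 - x) + 2 / δ * flux ω y y' x)
    (h' := fun x => (2 * (y' x * (starRingEnd ℂ) (y x)).re * (R + 1 - x) + ‖y x‖ ^ 2 * (-1)) +
      2 / δ * (ω.re * ‖y' x‖ ^ 2 + (ω * q x).re * ‖y x‖ ^ 2)) (by linarith)
    (fun x hx => ((hasDerivAt_norm_sq (h x hx.1).1).mul ((hasDerivAt_id x).const_sub _)).add
      ((hasDerivAt_flux ω h hx.1).const_mul _)) fun x hx => by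
    have h1 := hq.le_flux_deriv hx.1 y y'
    have h2 : 2 * (‖y' x‖ ^ 2 + ‖y x‖ ^ 2) ≤
        2 / δ * (ω.re * ‖y' x‖ ^ 2 + (ω * q x).re * ‖y x‖ ^ 2) := by
      rw [div_mul_eq_mul_div, le_div_iff₀ hδ]; linarith
    have h3 : |(y' x * (starRingEnd ℂ) (y x)).re| ≤ ‖y' x‖ * ‖y x‖ := by
      simpa using Complex.abs_re_le_norm (y' x * (starRingEnd ℂ) (y x))
    have h4 : -(‖y' x‖ * ‖y x‖) ≤ (y' x * (starRingEnd ℂ) (y x)).re * (R + 1 - x) := by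
      have h5 : 0 ≤ R + 1 - x := by linarith [hx.2]
      have h6 : R + 1 - x ≤ 1 := by linarith [hx.1]
      have h7 : 0 ≤ ‖y' x‖ * ‖y x‖ := by positivity
      nlinarith [(abs_le.mp h3).1]
    nlinarith [sq_nonneg (‖y' x‖ - ‖y x‖), sq_nonneg ‖y' x‖]
  simp only [sub_self, mul_zero, zero_add, add_sub_cancel_left, mul_one] at key
  rw [mul_sub]
  linarith

lemma IsCoerciveFrom.norm_le_of_flux_nonpos (hq : IsCoerciveFrom q R δ ω)
    (h : IsSolutionFrom q R y y') (hN : R + 1 ≤ N) (hQ : flux ω y y' N ≤ 0) :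
    ‖y R‖ ≤ 2 / δ * ‖y' R‖ := by
  have hδ := hq.pos
  have h1 := hq.norm_sq_le h
  have h2 := (hq.flux_mono h (by linarith : R ≤ R + 1) hN).trans hQ
  have h3 := (abs_le.mp (abs_flux_le hq.norm_le y y' R)).1
  rcases (norm_nonneg (y R)).eq_or_lt with h0 | h0
  · rw [← h0]; positivity
  · have h4 : ‖y R‖ ^ 2 ≤ 2 / δ * (‖y' R‖ * ‖y R‖) :=
      h1.trans (mul_le_mul_of_nonneg_left (by linarith) (by positivity))
    rw [sq, ← mul_assoc] at h4
    exact le_of_mul_le_mul_right h4 h0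

lemma IsCoerciveFrom.neg_flux_le (hq : IsCoerciveFrom q R δ ω)
    (h : IsSolutionFrom q R y y') (hN : R + 1 ≤ N) (hQ : flux ω y y' N ≤ 0) :
    -flux ω y y' R ≤ 2 / δ * ‖y' R‖ ^ 2 := by
  have h1 := hq.norm_le_of_flux_nonpos h hN hQ
  have h3 := (abs_le.mp (abs_flux_le hq.norm_le y y' R)).1
  nlinarith [mul_le_mul_of_nonneg_left h1 (norm_nonneg (y' R))]

lemma IsCoerciveFrom.flux_ge_of_deriv_eq_zero (hq : IsCoerciveFrom q R δ ω)
    (h : IsSolutionFrom q R y y') (h0 : y' R = 0) {x : ℝ} (hx : R + 1 ≤ x) :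
    δ / 2 * ‖y R‖ ^ 2 ≤ flux ω y y' x := by
  have hδ := hq.pos
  have h1 := hq.norm_sq_le h
  have h2 : flux ω y y' R = 0 := by simp [flux, h0]
  rw [h2, sub_zero, div_mul_eq_mul_div, le_div_iff₀ hδ] at h1
  linarith [hq.flux_mono h (by linarith : R ≤ R + 1) hx]

lemma IsCoerciveFrom.norm_sub_sq_le (hq : IsCoerciveFrom q R δ ω)
    (h : IsSolutionFrom q R y y') (k : IsSolutionFrom q R z z') (hyz : y' R = z' R)
    (hN : R + 1 ≤ N) (hy : flux ω y y' N ≤ 0) (hz : flux ω z z' N ≤ 0) :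
    ‖y R - z R‖ ^ 2 * (N - R - 1) ≤ 8 / δ ^ 3 * ‖y' R‖ ^ 2 := by
  have hδ := hq.pos
  have hd := h.sub k
  have key := le_of_hasDerivAt_nonneg (a := R + 1) (b := N)
    (h := fun x => 2 / δ * (flux ω y y' x + flux ω z z' x) - δ * ‖y R - z R‖ ^ 2 * x)
    (h' := fun x => 2 / δ * ((ω.re * ‖y' x‖ ^ 2 + (ω * q x).re * ‖y x‖ ^ 2) +
      (ω.re * ‖z' x‖ ^ 2 + (ω * q x).re * ‖z x‖ ^ 2)) - δ * ‖y R - z R‖ ^ 2 * 1) hN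
    (fun x hx => (((hasDerivAt_flux ω h (by linarith [hx.1])).add
      (hasDerivAt_flux ω k (by linarith [hx.1]))).const_mul _).sub
        ((hasDerivAt_id x).const_mul _)) fun x hx => by
    have hx0 : R ≤ x := by linarith [hx.1]
    have h1 := hq.le_flux_deriv hx0 y y'
    have h2 := hq.le_flux_deriv hx0 z z'
    have h3 : 2 * ((‖y' x‖ ^ 2 + ‖y x‖ ^ 2) + (‖z' x‖ ^ 2 + ‖z x‖ ^ 2)) ≤
        2 / δ * ((ω.re * ‖y' x‖ ^ 2 + (ω * q x).re * ‖y x‖ ^ 2) +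
          (ω.re * ‖z' x‖ ^ 2 + (ω * q x).re * ‖z x‖ ^ 2)) := by
      rw [div_mul_eq_mul_div, le_div_iff₀ hδ]; linarith
    have h4 := hq.flux_ge_of_deriv_eq_zero hd (by simp [hyz]) hx.1
    have h5 := h4.trans (abs_le.mp (abs_flux_le hq.norm_le _ _ x)).2
    have h6 := norm_sub_le (y x) (z x)
    have h7 := norm_sub_le (y' x) (z' x)
    have h8 : ‖y x - z x‖ ^ 2 ≤ 2 * (‖y x‖ ^ 2 + ‖z x‖ ^ 2) := by
      nlinarith [sq_nonneg (‖y x‖ - ‖z x‖), norm_nonneg (y x - z x)]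
    have h9 : ‖y' x - z' x‖ ^ 2 ≤ 2 * (‖y' x‖ ^ 2 + ‖z' x‖ ^ 2) := by
      nlinarith [sq_nonneg (‖y' x‖ - ‖z' x‖), norm_nonneg (y' x - z' x)]
    nlinarith [sq_nonneg (‖y x - z x‖ - ‖y' x - z' x‖)]
  have e1 := hq.neg_flux_le h hN hy
  have e2 := hq.neg_flux_le k hN hz
  have e3 := hq.flux_mono h le_rfl (by linarith : R ≤ R + 1)
  have e4 := hq.flux_mono k le_rfl (by linarith : R ≤ R + 1)
  rw [← hyz] at e2
  have e5 : 2 / δ * (flux ω y y' N + flux ω z z' N) ≤ 0 :=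
    mul_nonpos_of_nonneg_of_nonpos (by positivity) (by linarith)
  have e6 : -(flux ω y y' (R + 1) + flux ω z z' (R + 1)) ≤ 4 / δ * ‖y' R‖ ^ 2 := by
    have : 4 / δ * ‖y' R‖ ^ 2 = 2 * (2 / δ * ‖y' R‖ ^ 2) := by ring
    linarith
  have e7 := mul_le_mul_of_nonneg_left e6 (by positivity : 0 ≤ 2 / δ)
  have e8 : δ * (‖y R - z R‖ ^ 2 * (N - R - 1)) ≤ 2 / δ * (4 / δ * ‖y' R‖ ^ 2) := by
    linarith
  rw [← le_div_iff₀' hδ] at e8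
  refine e8.trans (le_of_eq ?_)
  field_simp
  ring

lemma IsCoerciveFrom.eq_of_flux_nonpos (hq : IsCoerciveFrom q R δ ω)
    (h : IsSolutionFrom q R y y') (k : IsSolutionFrom q R z z') (hyz : y' R = z' R)
    (hy : ∀ x, R ≤ x → flux ω y y' x ≤ 0) (hz : ∀ x, R ≤ x → flux ω z z' x ≤ 0) :
    y R = z R := by
  by_contra hne
  have hpos : 0 < ‖y R - z R‖ ^ 2 := by
    have := norm_pos_iff.mpr (sub_ne_zero.mpr hne)
    positivity
  have hδ := hq.pos
  let C := 8 / δ ^ 3 * ‖y' R‖ ^ 2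
  have hC : 0 ≤ C := by positivity
  have hN : R + 1 ≤ R + 1 + (C + 1) / ‖y R - z R‖ ^ 2 := by
    have : 0 ≤ (C + 1) / ‖y R - z R‖ ^ 2 := by positivity
    linarith
  have key := hq.norm_sub_sq_le h k hyz hN (hy _ (by linarith)) (hz _ (by linarith))
  have : ‖y R - z R‖ ^ 2 * (R + 1 + (C + 1) / ‖y R - z R‖ ^ 2 - R - 1) = C + 1 := by
    rw [show ∀ t, R + 1 + t - R - 1 = t by intro t; ring, mul_div_cancel₀ _ hpos.ne']
  rw [this] at key
  linarith

lemma IsCoerciveFrom.neg_flux_le_exp (hq : IsCoerciveFrom q R δ ω)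
    (h : IsSolutionFrom q R y y') {x : ℝ} (hx : R ≤ x) :
    -flux ω y y' x ≤ -flux ω y y' R * Real.exp (2 * δ * R) * Real.exp (-(2 * δ) * x) := by
  have hδ := hq.pos
  have key := le_of_hasDerivAt_nonneg (a := R) (b := x)
    (h := fun t => flux ω y y' t * Real.exp (2 * δ * t))
    (h' := fun t => (ω.re * ‖y' t‖ ^ 2 + (ω * q t).re * ‖y t‖ ^ 2) * Real.exp (2 * δ * t) +
      flux ω y y' t * (Real.exp (2 * δ * t) * (2 * δ * 1))) hx
    (fun t ht => (hasDerivAt_flux ω h ht.1).mul ((hasDerivAt_id t).const_mul _).exp)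
    fun t ht => by
    have h1 := hq.le_flux_deriv ht.1 y y'
    have h2 := (abs_le.mp (abs_flux_le hq.norm_le y y' t)).1
    have h3 : 0 ≤ (ω.re * ‖y' t‖ ^ 2 + (ω * q t).re * ‖y t‖ ^ 2) + flux ω y y' t * (2 * δ) := by
      nlinarith [mul_nonneg hδ.le (sq_nonneg (‖y' t‖ - ‖y t‖))]
    nlinarith [mul_nonneg h3 (Real.exp_pos (2 * δ * t)).le]
  have h4 : Real.exp (2 * δ * x) * Real.exp (-(2 * δ) * x) = 1 := by
    rw [← Real.exp_add]; simp
  have h5 := mul_le_mul_of_nonneg_right key (Real.exp_pos (-(2 * δ) * x)).le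
  simp only [mul_assoc] at h5 h4 ⊢
  rw [h4] at h5
  linarith

lemma IsCoerciveFrom.integrableOn_of_flux_nonpos (hq : IsCoerciveFrom q R δ ω)
    (h : IsSolutionFrom q R y y') (hR : 0 ≤ R) (hc : ContinuousOn y (Ici 0))
    (hc' : ContinuousOn y' (Ici 0)) (hQ : ∀ x, R ≤ x → flux ω y y' x ≤ 0) :
    (∀ p : ℝ, 0 ≤ p → IntegrableOn (fun x => x ^ p * ‖y x‖ ^ 2) (Ioi 0)) ∧
      IntegrableOn (fun x => ‖y' x‖ ^ 2) (Ioi 0) := by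
  have hδ := hq.pos
  let C := -flux ω y y' R * Real.exp (2 * δ * R)
  have hC : 0 ≤ C := mul_nonneg (by linarith [hQ R le_rfl]) (Real.exp_pos _).le
  have hdecay : ∀ x, R ≤ x → -flux ω y y' x ≤ C * Real.exp (-(2 * δ) * x) := fun x hx =>
    hq.neg_flux_le_exp h hx
  constructor
  · intro p hp
    refine integrable_of_isBigO_exp_neg hδ
      ((continuousOn_id.rpow_const fun x _ => Or.inr hp).mul (hc.norm.pow 2)) ?_
    have h1 : (fun x => ‖y x‖ ^ 2) =O[Filter.atTop] fun x => Real.exp (-(2 * δ) * x) := by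
      refine Asymptotics.IsBigO.of_bound (2 / δ * C) ?_
      filter_upwards [Filter.eventually_ge_atTop R] with x hx
      have h2 := (hq.mono hx).norm_sq_le (h.mono hx)
      have h3 := hdecay x hx
      have h4 := hQ (x + 1) (by linarith)
      rw [Real.norm_of_nonneg (by positivity), Real.norm_of_nonneg (Real.exp_pos _).le, mul_assoc]
      exact h2.trans (mul_le_mul_of_nonneg_left (by linarith) (by positivity))
    have h5 : (fun x : ℝ => x ^ p) =O[Filter.atTop] fun x => Real.exp (δ * x) :=
      (isLittleO_rpow_exp_pos_mul_atTop p hδ).isBigO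
    refine (h5.mul h1).congr_right fun x => ?_
    rw [← Real.exp_add]; congr 1; ring
  · have htend : Filter.Tendsto (flux ω y y') Filter.atTop (nhds 0) := by
      have h1 : Filter.Tendsto (fun x => C * Real.exp (-(2 * δ) * x)) Filter.atTop (nhds 0) := by
        have h2 : Filter.Tendsto (fun x : ℝ => -(2 * δ) * x) Filter.atTop Filter.atBot :=
          Filter.tendsto_id.const_mul_atTop_of_neg (by linarith)
        simpa using (Real.tendsto_exp_atBot.comp h2).const_mul C
      have h3 : Filter.Tendsto (fun x => -flux ω y y' x) Filter.atTop (nhds 0) := by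
        refine tendsto_of_tendsto_of_tendsto_of_le_of_le' tendsto_const_nhds h1 ?_ ?_
        · filter_upwards [Filter.eventually_ge_atTop R] with x hx
          linarith [hQ x hx]
        · filter_upwards [Filter.eventually_ge_atTop R] with x hx using hdecay x hx
      simpa using h3.neg
    have hint := integrableOn_Ioi_deriv_of_nonneg' (a := R)
      (fun x hx => hasDerivAt_flux ω h hx)
      (fun x hx => le_trans (by positivity) (hq.le_flux_deriv (le_of_lt hx) y y')) htend
    have hcs : ContinuousOn (fun x => ‖y' x‖ ^ 2) (Ici 0) := hc'.norm.pow 2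
    rw [← Ioc_union_Ioi_eq_Ioi hR]
    refine IntegrableOn.union ?_ ?_
    · exact ((hcs.mono Icc_subset_Ici_self).integrableOn_Icc).mono_set Ioc_subset_Icc_self
    · refine Integrable.mono' (hint.const_mul (1 / δ))
        ((hcs.mono fun x hx => hR.trans (le_of_lt hx)).aestronglyMeasurable measurableSet_Ioi) ?_
      filter_upwards [ae_restrict_mem measurableSet_Ioi] with x hx
      have h1 := hq.le_flux_deriv (le_of_lt hx) y y'
      rw [Real.norm_of_nonneg (by positivity), div_mul_eq_mul_div, one_mul, le_div_iff₀ hδ]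
      nlinarith [mul_nonneg hδ.le (sq_nonneg ‖y x‖)]

end Weyl

section WeylFamily

open Filter Topology

variable {Ω : Set ℂ} {q : ℂ → ℝ → ℂ} {R δ : ℝ} {ω : ℂ}

lemma exists_differentiableOn_weyl_coeff_of_normalized (hΩ : IsOpen Ω)
    (hq : ∀ s ∈ Ω, IsCoerciveFrom (q s) R δ ω) {ψ ψ' φ φ' : ℂ → ℝ → ℂ}
    (hψ : ∀ s ∈ Ω, IsSolutionFrom (q s) R (ψ s) (ψ' s))
    (hφ : ∀ s ∈ Ω, IsSolutionFrom (q s) R (φ s) (φ' s))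
    (hψR : ∀ s ∈ Ω, ψ s R = 1 ∧ ψ' s R = 0) (hφR : ∀ s ∈ Ω, φ s R = 0 ∧ φ' s R = 1)
    (hψd : ∀ x, R ≤ x → DifferentiableOn ℂ (fun s => ψ s x) Ω)
    (hφd : ∀ x, R ≤ x → DifferentiableOn ℂ (fun s => φ s x) Ω) :
    ∃ m : ℂ → ℂ, DifferentiableOn ℂ m Ω ∧ ∀ s ∈ Ω, ∀ x, R ≤ x →
      flux ω (fun x => φ s x + m s * ψ s x) (fun x => φ' s x + m s * ψ' s x) x ≤ 0 := by
  have hψ0 : ∀ s ∈ Ω, ∀ x, R + 1 ≤ x → ψ s x ≠ 0 := by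
    intro s hs x hx h0
    have h1 := (hq s hs).flux_ge_of_deriv_eq_zero (hψ s hs) (hψR s hs).2 hx
    have hδ := (hq s hs).pos
    simp only [flux, h0, (hψR s hs).1, map_zero, mul_zero, Complex.zero_re, norm_one] at h1
    linarith
  let M : ℕ → ℂ → ℂ := fun n s => -φ s (R + 1 + n) / ψ s (R + 1 + n)
  have hle : ∀ n : ℕ, R + 1 ≤ R + 1 + n := fun n => le_add_of_nonneg_right n.cast_nonneg
  have hMd : ∀ n, DifferentiableOn ℂ (M n) Ω := fun n =>
    (hφd _ (by linarith [hle n])).neg.div (hψd _ (by linarith [hle n]))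
      fun s hs => hψ0 s hs _ (hle n)
  have hsol : ∀ a : ℂ, ∀ s ∈ Ω, IsSolutionFrom (q s) R (fun x => φ s x + a * ψ s x)
      (fun x => φ' s x + a * ψ' s x) := fun a s hs => (hφ s hs).add ((hψ s hs).const_mul a)
  have hflux : ∀ n : ℕ, ∀ s ∈ Ω, ∀ x, R ≤ x → x ≤ R + 1 + n →
      flux ω (fun x => φ s x + M n s * ψ s x) (fun x => φ' s x + M n s * ψ' s x) x ≤ 0 := by
    intro n s hs x hx hxn
    refine ((hq s hs).flux_mono (hsol _ s hs) hx hxn).trans (le_of_eq ?_)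
    have : φ s (R + 1 + n) + M n s * ψ s (R + 1 + n) = 0 := by
      simp only [M, div_mul_cancel₀ _ (hψ0 s hs _ (hle n)), add_neg_cancel]
    simp [flux, this]
  have hdist : ∀ n k : ℕ, n ≤ k → ∀ s ∈ Ω, ‖M n s - M k s‖ ^ 2 * n ≤ 8 / δ ^ 3 := by
    intro n k hnk s hs
    have hnk' : (n : ℝ) ≤ k := by exact_mod_cast hnk
    have h1 := (hq s hs).norm_sub_sq_le (hsol (M n s) s hs) (hsol (M k s) s hs)
      (by simp [(hψR s hs).2]) (hle n) (hflux n s hs _ (by linarith [hle n]) le_rfl)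
      (hflux k s hs _ (by linarith [hle n]) (by linarith))
    simpa [(hψR s hs).1, (hψR s hs).2, (hφR s hs).1, (hφR s hs).2, add_sub_right_comm] using h1
  have hcauchy : UniformCauchySeqOn M atTop Ω := by
    rw [Metric.uniformCauchySeqOn_iff]
    intro ε hε
    obtain ⟨N, hN⟩ := exists_nat_gt (8 / δ ^ 3 / ε ^ 2)
    have key : ∀ n k : ℕ, N ≤ n → n ≤ k → ∀ s ∈ Ω, dist (M n s) (M k s) < ε := by
      intro n k hn hnk s hs
      have h1 := hdist n k hnk s hs
      have hn' : (N : ℝ) ≤ n := by exact_mod_cast hn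
      rw [div_lt_iff₀ (by positivity)] at hN
      rw [dist_eq_norm]
      by_contra! hcon
      have h2 : ε ^ 2 ≤ ‖M n s - M k s‖ ^ 2 := by gcongr
      have h3 : (N : ℝ) * ε ^ 2 ≤ ‖M n s - M k s‖ ^ 2 * n := by
        rw [mul_comm]; gcongr
      linarith
    refine ⟨N, fun n hn k hk s hs => ?_⟩
    rcases le_total n k with h | h
    · exact key n k hn h s hs
    · rw [dist_comm]; exact key k n hk h s hs
  have hlim : ∀ s : ℂ, ∃ a : ℂ, s ∈ Ω → Tendsto (fun n => M n s) atTop (𝓝 a) := by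
    intro s
    by_cases hs : s ∈ Ω
    · obtain ⟨a, ha⟩ := cauchySeq_tendsto_of_complete (hcauchy.cauchySeq hs)
      exact ⟨a, fun _ => ha⟩
    · exact ⟨0, fun h => absurd h hs⟩
  choose m hm using hlim
  have hunif := hcauchy.tendstoUniformlyOn_of_tendsto hm
  refine ⟨m, hunif.tendstoLocallyUniformlyOn.differentiableOn
    (Eventually.of_forall hMd) hΩ, fun s hs x hx => ?_⟩
  have hcont : Continuous fun a : ℂ =>
      flux ω (fun x => φ s x + a * ψ s x) (fun x => φ' s x + a * ψ' s x) x := by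
    unfold flux
    exact Complex.continuous_re.comp (continuous_const.mul ((by fun_prop : Continuous
      fun a : ℂ => φ' s x + a * ψ' s x).mul (Complex.continuous_conj.comp (by fun_prop))))
  refine le_of_tendsto ((hcont.tendsto _).comp (hm s hs)) ?_
  obtain ⟨N, hN⟩ := exists_nat_gt (x - R - 1)
  filter_upwards [eventually_ge_atTop N] with n hn
  have hn' : (N : ℝ) ≤ n := by exact_mod_cast hn
  exact hflux n s hs x hx (by linarith)

lemma exists_differentiableOn_weyl_coeff (hΩ : IsOpen Ω)
    (hq : ∀ s ∈ Ω, IsCoerciveFrom (q s) R δ ω) {U U' V V' : ℂ → ℝ → ℂ}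
    (hU : ∀ s ∈ Ω, IsSolutionFrom (q s) R (U s) (U' s))
    (hV : ∀ s ∈ Ω, IsSolutionFrom (q s) R (V s) (V' s))
    (hw : ∀ s ∈ Ω, U s R * V' s R - U' s R * V s R ≠ 0)
    (hUd : ∀ x, R ≤ x → DifferentiableOn ℂ (fun s => U s x) Ω)
    (hVd : ∀ x, R ≤ x → DifferentiableOn ℂ (fun s => V s x) Ω)
    (hUd' : DifferentiableOn ℂ (fun s => U' s R) Ω)
    (hVd' : DifferentiableOn ℂ (fun s => V' s R) Ω) :
    ∃ A B : ℂ → ℂ, DifferentiableOn ℂ A Ω ∧ DifferentiableOn ℂ B Ω ∧ ∀ s ∈ Ω,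
      A s * U' s R + B s * V' s R = 1 ∧ ∀ x, R ≤ x →
        flux ω (fun x => A s * U s x + B s * V s x) (fun x => A s * U' s x + B s * V' s x) x
          ≤ 0 := by
  obtain ⟨w, hw_def⟩ : ∃ w : ℂ → ℂ, ∀ s, w s = U s R * V' s R - U' s R * V s R := ⟨_, fun _ => rfl⟩
  have hwd : DifferentiableOn ℂ w Ω :=
    (((hUd R le_rfl).mul hVd').sub (hUd'.mul (hVd R le_rfl))).congr fun s _ => hw_def s
  replace hw : ∀ s ∈ Ω, w s ≠ 0 := fun s hs => hw_def s ▸ hw s hs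
  have hw_self : ∀ s ∈ Ω, (U s R * V' s R - U' s R * V s R) / w s = 1 := fun s hs => by
    rw [← hw_def, div_self (hw s hs)]
  obtain ⟨m, hmd, hm⟩ := exists_differentiableOn_weyl_coeff_of_normalized hΩ hq
    (ψ := fun s x => V' s R / w s * U s x + -U' s R / w s * V s x)
    (ψ' := fun s x => V' s R / w s * U' s x + -U' s R / w s * V' s x)
    (φ := fun s x => -V s R / w s * U s x + U s R / w s * V s x)
    (φ' := fun s x => -V s R / w s * U' s x + U s R / w s * V' s x)
    (fun s hs => ((hU s hs).const_mul _).add ((hV s hs).const_mul _))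
    (fun s hs => ((hU s hs).const_mul _).add ((hV s hs).const_mul _))
    (fun s hs => by
      constructor
      · linear_combination hw_self s hs
      · ring)
    (fun s hs => by
      constructor
      · ring
      · linear_combination hw_self s hs)
    (fun x hx => ((hVd'.div hwd hw).mul (hUd x hx)).add ((hUd'.neg.div hwd hw).mul (hVd x hx)))
    (fun x hx => (((hVd R le_rfl).neg.div hwd hw).mul (hUd x hx)).add
      (((hUd R le_rfl).div hwd hw).mul (hVd x hx)))
  refine ⟨fun s => -V s R / w s + m s * (V' s R / w s),
    fun s => U s R / w s + m s * (-U' s R / w s),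
    ((hVd R le_rfl).neg.div hwd hw).add (hmd.mul (hVd'.div hwd hw)),
    ((hUd R le_rfl).div hwd hw).add (hmd.mul (hUd'.neg.div hwd hw)), fun s hs => ⟨?_, ?_⟩⟩
  · linear_combination hw_self s hs
  · intro x hx
    refine le_of_eq_of_le ?_ (hm s hs x hx)
    congr 1 <;> funext x <;> ring

lemma flux_nonpos_of_frequently_flux_nonpos (hΩ : IsOpen Ω) (hpre : IsPreconnected Ω)
    (hq : ∀ s ∈ Ω, IsCoerciveFrom (q s) R δ ω) {U U' V V' : ℂ → ℝ → ℂ}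
    (hU : ∀ s ∈ Ω, IsSolutionFrom (q s) R (U s) (U' s))
    (hV : ∀ s ∈ Ω, IsSolutionFrom (q s) R (V s) (V' s))
    (hw : ∀ s ∈ Ω, U s R * V' s R - U' s R * V s R ≠ 0)
    (hUd : ∀ x, R ≤ x → DifferentiableOn ℂ (fun s => U s x) Ω)
    (hVd : ∀ x, R ≤ x → DifferentiableOn ℂ (fun s => V s x) Ω)
    (hUd' : DifferentiableOn ℂ (fun s => U' s R) Ω)
    (hVd' : DifferentiableOn ℂ (fun s => V' s R) Ω) {a b s₀ : ℂ} (hs₀ : s₀ ∈ Ω)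
    (hfreq : ∃ᶠ s in 𝓝[≠] s₀, ∀ x, R ≤ x →
      flux ω (fun x => a * U s x + b * V s x) (fun x => a * U' s x + b * V' s x) x ≤ 0)
    {s : ℂ} (hs : s ∈ Ω) {x : ℝ} (hx : R ≤ x) :
    flux ω (fun x => a * U s x + b * V s x) (fun x => a * U' s x + b * V' s x) x ≤ 0 := by
  obtain ⟨A, B, hA, hB, hAB⟩ :=
    exists_differentiableOn_weyl_coeff hΩ hq hU hV hw hUd hVd hUd' hVd'
  have hscale : ∀ t, ∀ k : ℂ, ∀ y, flux ω (fun x => k * A t * U t x + k * B t * V t x)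
      (fun x => k * A t * U' t x + k * B t * V' t x) y = ‖k‖ ^ 2 *
      flux ω (fun x => A t * U t x + B t * V t x) (fun x => A t * U' t x + B t * V' t x) y := by
    intro t k y
    rw [← flux_const_mul]
    congr 1 <;> funext x <;> ring
  have heq : EqOn (fun t => a * U t R + b * V t R)
      (fun t => (a * U' t R + b * V' t R) * (A t * U t R + B t * V t R)) Ω := by
    have h1 : DifferentiableOn ℂ (fun t => a * U t R + b * V t R) Ω :=
      ((hUd R le_rfl).const_mul a).add ((hVd R le_rfl).const_mul b)
    have h2 : DifferentiableOn ℂ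
        (fun t => (a * U' t R + b * V' t R) * (A t * U t R + B t * V t R)) Ω :=
      ((hUd'.const_mul a).add (hVd'.const_mul b)).mul
        ((hA.mul (hUd R le_rfl)).add (hB.mul (hVd R le_rfl)))
    refine (h1.analyticOnNhd hΩ).eqOn_of_preconnected_of_frequently_eq (h2.analyticOnNhd hΩ)
      hpre hs₀ ?_
    refine (hfreq.and_eventually (mem_nhdsWithin_of_mem_nhds (hΩ.mem_nhds hs₀))).mono ?_
    rintro t ⟨ht, htΩ⟩
    let k := a * U' t R + b * V' t R
    have h3 := (hq t htΩ).eq_of_flux_nonpos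
      (((hU t htΩ).const_mul a).add ((hV t htΩ).const_mul b))
      (((hU t htΩ).const_mul (k * A t)).add ((hV t htΩ).const_mul (k * B t)))
      (by linear_combination -k * (hAB t htΩ).1) ht fun y hy => by
        rw [hscale]
        exact mul_nonpos_of_nonneg_of_nonpos (by positivity) ((hAB t htΩ).2 y hy)
    exact h3.trans (by ring)
  let k := a * U' s R + b * V' s R
  have e1 : a * U s R + b * V s R = k * (A s * U s R + B s * V s R) := heq hs
  have e2 : k = a * U' s R + b * V' s R := rfl
  have e3 := (hAB s hs).1
  have ha : a = k * A s := by
    refine mul_right_cancel₀ (hw s hs) ?_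
    linear_combination V' s R * e1 + V s R * e2 + k * V s R * e3
  have hb : b = k * B s := by
    refine mul_right_cancel₀ (hw s hs) ?_
    linear_combination -U' s R * e1 - U s R * e2 - k * U s R * e3
  rw [ha, hb, hscale]
  exact mul_nonpos_of_nonneg_of_nonpos (by positivity) ((hAB s hs).2 x hx)

end WeylFamily

section ExpVariable

open Filter Topology

variable {β : ℝ} {μ : ℂ} {f f₀ f₁ : ℂ → ℂ}

lemma hasDerivAt_comp_add_log {g : ℂ → ℂ} (hg : Differentiable ℂ g) (s : ℂ) {x : ℝ} (hx : 0 < x) :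
    HasDerivAt (fun x : ℝ => g (s + (Real.log x : ℂ))) (deriv g (s + (Real.log x : ℂ)) / x) x := by
  have h1 : HasDerivAt (fun x : ℝ => s + (Real.log x : ℂ)) ((x⁻¹ : ℝ) : ℂ) x :=
    (Real.hasDerivAt_log hx.ne').ofReal_comp.const_add s
  have h2 := (hg _).hasDerivAt.comp x h1
  rw [Complex.ofReal_inv, ← div_eq_mul_inv] at h2
  exact h2

/-- In the variable `s + log x` the equation `f'' - f' = e^{2s} (e^{βs} - μ) f` becomes
a Schrödinger equation. -/
lemma isSolutionFrom_comp_add_log (hf : Differentiable ℂ f)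
    (hode : ∀ s, deriv (deriv f) s - deriv f s =
      Complex.exp (2 * s) * (Complex.exp (β * s) - μ) * f s) (s : ℂ) {R : ℝ} (hR : 0 < R) :
    IsSolutionFrom (fun x => Complex.exp (2 * s) * (Complex.exp (β * s) * (x ^ β : ℝ) - μ)) R
      (fun x => f (s + (Real.log x : ℂ))) (fun x => deriv f (s + (Real.log x : ℂ)) / x) := by
  intro x hx
  have hx0 : 0 < x := hR.trans_le hx
  have hxc : (x : ℂ) ≠ 0 := by exact_mod_cast hx0.ne'
  refine ⟨hasDerivAt_comp_add_log hf s hx0, ?_⟩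
  have h1 := (hasDerivAt_comp_add_log hf.deriv s hx0).div
    (hasDerivAt_id x).ofReal_comp hxc
  convert! h1 using 1
  have h2 := hode (s + (Real.log x : ℂ))
  have h3 : Complex.exp (2 * (s + (Real.log x : ℂ))) = Complex.exp (2 * s) * x ^ 2 := by
    rw [mul_add, Complex.exp_add]
    congr 1
    rw [two_mul, Complex.exp_add, ← Complex.ofReal_exp, Real.exp_log hx0, sq]
  have h4 : Complex.exp (β * (s + (Real.log x : ℂ))) = Complex.exp (β * s) * (x ^ β : ℝ) := by
    rw [mul_add, Complex.exp_add, Real.rpow_def_of_pos hx0, Complex.ofReal_exp]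
    congr 2
    push_cast
    ring
  rw [h3, h4] at h2
  simp only [id, Complex.ofReal_one]
  generalize Complex.exp (β * s) = E at h2 ⊢
  field_simp
  linear_combination -h2

lemma differentiable_comp_add (hf : Differentiable ℂ f) (a : ℂ) :
    Differentiable ℂ fun s => f (s + a) := hf.comp (differentiable_id.add_const a)

lemma wronskian_eq_exp (hf₀ : Differentiable ℂ f₀) (hf₁ : Differentiable ℂ f₁)
    (hode₀ : ∀ s, deriv (deriv f₀) s - deriv f₀ s =
      Complex.exp (2 * s) * (Complex.exp (β * s) - μ) * f₀ s)
    (hode₁ : ∀ s, deriv (deriv f₁) s - deriv f₁ s =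
      Complex.exp (2 * s) * (Complex.exp (β * s) - μ) * f₁ s) {K₀ K₁ : ℝ}
    (hK₀ : ∀ s : ℂ, s.re ≤ 0 → ‖f₀ s - 1‖ ≤ K₀ * Real.exp (2 * s.re) ∧
      ‖deriv f₀ s‖ ≤ K₀ * Real.exp (2 * s.re))
    (hK₁ : ∀ s : ℂ, s.re ≤ 0 → ‖f₁ s - Complex.exp s‖ ≤ K₁ * Real.exp (2 * s.re) ∧
      ‖deriv f₁ s - Complex.exp s‖ ≤ K₁ * Real.exp (2 * s.re)) (s : ℂ) :
    f₀ s * deriv f₁ s - deriv f₀ s * f₁ s = Complex.exp s := by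
  let G : ℂ → ℂ := fun s => (f₀ s * deriv f₁ s - deriv f₀ s * f₁ s) * Complex.exp (-s)
  have hG : ∀ s, HasDerivAt G 0 s := by
    intro s
    have h1 := (((hf₀ s).hasDerivAt.mul (hf₁.deriv s).hasDerivAt).sub
      ((hf₀.deriv s).hasDerivAt.mul (hf₁ s).hasDerivAt)).mul (hasDerivAt_neg s).cexp
    convert! h1 using 1
    simp only [Pi.sub_apply, Pi.mul_apply]
    linear_combination Complex.exp (-s) * (f₁ s * hode₀ s - f₀ s * hode₁ s)
  have hconst : ∀ t, G t = G s := fun t =>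
    is_const_of_deriv_eq_zero (fun s => (hG s).differentiableAt) (fun s => (hG s).deriv) t s
  have hexp : Tendsto Real.exp atBot (𝓝 0) := Real.tendsto_exp_atBot
  have hexp2 : Tendsto (fun t : ℝ => Real.exp (2 * t)) atBot (𝓝 0) :=
    hexp.comp (tendsto_id.const_mul_atBot (by norm_num))
  have e₀ : Tendsto (fun t : ℝ => f₀ t) atBot (𝓝 1) := by
    rw [tendsto_iff_norm_sub_tendsto_zero]
    refine squeeze_zero' (.of_forall fun _ => norm_nonneg _) ?_
      (by simpa using hexp2.const_mul K₀)
    filter_upwards [eventually_le_atBot (0 : ℝ)] with t ht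
    simpa using (hK₀ t (by simpa using ht)).1
  have e₀' : Tendsto (fun t : ℝ => deriv f₀ t) atBot (𝓝 0) := by
    rw [tendsto_zero_iff_norm_tendsto_zero]
    refine squeeze_zero' (.of_forall fun _ => norm_nonneg _) ?_
      (by simpa using hexp2.const_mul K₀)
    filter_upwards [eventually_le_atBot (0 : ℝ)] with t ht
    simpa using (hK₀ t (by simpa using ht)).2
  have hscale : ∀ (g : ℂ → ℂ), (∀ t : ℝ, t ≤ 0 → ‖g t - Complex.exp t‖ ≤ K₁ * Real.exp (2 * t)) →
      Tendsto (fun t : ℝ => g t * Complex.exp (-t)) atBot (𝓝 1) := by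
    intro g hg
    rw [tendsto_iff_norm_sub_tendsto_zero]
    refine squeeze_zero' (.of_forall fun _ => norm_nonneg _) ?_
      (by simpa using hexp.const_mul K₁)
    filter_upwards [eventually_le_atBot (0 : ℝ)] with t ht
    have h1 : g t * Complex.exp (-t) - 1 = (g t - Complex.exp t) * Complex.exp (-t) := by
      rw [sub_mul, ← Complex.exp_add, add_neg_cancel, Complex.exp_zero]
    rw [h1, norm_mul, Complex.norm_exp, Complex.neg_re, Complex.ofReal_re]
    refine (mul_le_mul_of_nonneg_right (hg t ht) (Real.exp_pos _).le).trans (le_of_eq ?_)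
    rw [mul_assoc, ← Real.exp_add]
    congr 2
    ring
  have e₁ := hscale f₁ fun t ht => by simpa using (hK₁ t (by simpa using ht)).1
  have e₁' := hscale (deriv f₁) fun t ht => by simpa using (hK₁ t (by simpa using ht)).2
  have hlim : Tendsto (fun t : ℝ => G t) atBot (𝓝 1) := by
    have h := (e₀.mul e₁').sub (e₀'.mul e₁)
    simp only [mul_one, sub_zero] at h
    refine h.congr fun t => ?_
    simp only [G]
    ring
  have h1 : G s = 1 :=
    tendsto_nhds_unique (tendsto_const_nhds.congr fun t : ℝ => (hconst t).symm) hlim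
  have h2 : Complex.exp (-s) * Complex.exp s = 1 := by
    rw [← Complex.exp_add, neg_add_cancel, Complex.exp_zero]
  have h3 : G s * Complex.exp s = Complex.exp s := by rw [h1, one_mul]
  rw [← h3]
  simp only [G]
  rw [mul_assoc, h2, mul_one]

/-- `y` solves `y'' = q y` on the closed half-line `[0, ∞)`, with derivative `y'`. -/
def IsHalfLineSolution (q : ℝ → ℂ) (y y' : ℝ → ℂ) : Prop :=
  ∀ x ∈ Ici (0 : ℝ), HasDerivWithinAt y (y' x) (Ici 0) x ∧
    HasDerivWithinAt y' (q x * y x) (Ici 0) x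

lemma isHalfLineSolution_of_tendsto {q y y' : ℝ → ℂ} (hq : ContinuousOn q (Ici 0))
    (hsol : ∀ x, 0 < x → HasDerivAt y (y' x) x ∧ HasDerivAt y' (q x * y x) x)
    (hy : Tendsto y (𝓝[>] 0) (𝓝 (y 0))) (hy' : Tendsto y' (𝓝[>] 0) (𝓝 (y' 0))) :
    IsHalfLineSolution q y y' := by
  intro x hx
  rcases (mem_Ici.mp hx).eq_or_lt with rfl | h
  · have hd : DifferentiableOn ℝ y (Ioi 0) := fun t ht =>
      (hsol t ht).1.differentiableAt.differentiableWithinAt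
    have hd' : DifferentiableOn ℝ y' (Ioi 0) := fun t ht =>
      (hsol t ht).2.differentiableAt.differentiableWithinAt
    refine ⟨hasDerivWithinAt_Ici_of_tendsto_deriv hd hy self_mem_nhdsWithin (hy'.congr' ?_),
      hasDerivWithinAt_Ici_of_tendsto_deriv hd' hy' self_mem_nhdsWithin
        ((((hq 0 hx).mono Ioi_subset_Ici_self).tendsto.mul hy).congr' ?_)⟩
    · filter_upwards [self_mem_nhdsWithin] with t ht using (hsol t ht).1.deriv.symm
    · filter_upwards [self_mem_nhdsWithin] with t ht using (hsol t ht).2.deriv.symm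
  · exact ⟨(hsol x h).1.hasDerivWithinAt, (hsol x h).2.hasDerivWithinAt⟩

lemma tendsto_of_norm_sub_exp_le {g : ℂ → ℂ} {a : ℂ} {K : ℝ}
    (hg : ∀ s : ℂ, s.re ≤ 0 → ‖g s - a * Complex.exp s‖ ≤ K * Real.exp (2 * s.re)) (s : ℂ) :
    Tendsto (fun x : ℝ => g (s + (Real.log x : ℂ)) / x) (𝓝[>] 0) (𝓝 (a * Complex.exp s)) := by
  have hlim : Tendsto (fun x : ℝ => K * Real.exp (2 * s.re) * x) (𝓝[>] 0) (𝓝 0) := by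
    have : Tendsto (fun x : ℝ => K * Real.exp (2 * s.re) * x) (𝓝 0)
        (𝓝 (K * Real.exp (2 * s.re) * 0)) :=
      tendsto_id.const_mul _
    rw [mul_zero] at this
    exact this.mono_left nhdsWithin_le_nhds
  rw [tendsto_iff_norm_sub_tendsto_zero]
  refine squeeze_zero' (.of_forall fun _ => norm_nonneg _) ?_ hlim
  have hlog := Real.tendsto_log_nhdsGT_zero.eventually (eventually_le_atBot (-s.re))
  filter_upwards [self_mem_nhdsWithin, hlog] with x (hx : 0 < x) hlog
  have hxc : (x : ℂ) ≠ 0 := by exact_mod_cast hx.ne'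
  have h1 := hg (s + (Real.log x : ℂ)) (by simp only [Complex.add_re, Complex.ofReal_re]; linarith)
  rw [Complex.exp_add, ← Complex.ofReal_exp, Real.exp_log hx, Complex.add_re, Complex.ofReal_re,
    mul_add, Real.exp_add, two_mul (Real.log x), Real.exp_add, Real.exp_log hx] at h1
  have h2 : g (s + (Real.log x : ℂ)) / x - a * Complex.exp s =
      (g (s + (Real.log x : ℂ)) - a * (Complex.exp s * x)) / x := by
    field_simp
  rw [h2, norm_div, Complex.norm_real, Real.norm_of_nonneg hx.le, div_le_iff₀ hx]
  linarith

end ExpVariable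

section Rotation

open Filter Topology

lemma exists_forall_isCoerciveFrom {β : ℝ} (hβ : 0 < β) (μ : ℂ) :
    ∃ R, 0 < R ∧ ∃ δ ω, ∀ s : ℂ, -1 < s.re → s.re < 1 → -(Real.pi / 8) < (β + 2) * s.im →
      (β + 2) * s.im < 5 * Real.pi / 8 → IsCoerciveFrom
        (fun x => Complex.exp (2 * s) * (Complex.exp (β * s) * (x ^ β : ℝ) - μ)) R δ ω := by
  have hpi := Real.pi_pos
  let k := Real.exp (-(β + 2)) * Real.cos (3 * Real.pi / 8)
  have hk : 0 < k := mul_pos (Real.exp_pos _) (Real.cos_pos_of_mem_Ioo ⟨by linarith, by linarith⟩)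
  have hlim : Tendsto (fun x : ℝ => k * x ^ β) atTop atTop :=
    (tendsto_rpow_atTop hβ).const_mul_atTop hk
  obtain ⟨R, hR⟩ := eventually_atTop.mp
    (hlim.eventually (eventually_ge_atTop (1 / 2 + Real.exp 2 * ‖μ‖)))
  have hω : Complex.exp (((-(Real.pi / 4) : ℝ) : ℂ) * Complex.I) =
      (Real.cos (Real.pi / 4) : ℂ) - Real.sin (Real.pi / 4) * Complex.I := by
    rw [Complex.exp_mul_I, ← Complex.ofReal_cos, ← Complex.ofReal_sin, Real.cos_neg, Real.sin_neg]
    push_cast; ring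
  refine ⟨max R 1, by positivity, 1 / 2, Complex.exp (((-(Real.pi / 4) : ℝ) : ℂ) * Complex.I),
    fun s h1 h2 h3 h4 => ⟨by norm_num, (Complex.norm_exp_ofReal_mul_I _).le, ?_, fun x hx => ?_⟩⟩
  · rw [Complex.exp_ofReal_mul_I_re, Real.cos_neg, Real.cos_pi_div_four]
    have : (1 : ℝ) ≤ √2 := Real.one_le_sqrt.mpr (by norm_num)
    linarith
  · have hx0 : 0 < x := by linarith [le_max_right R 1]
    have hxβ : 0 ≤ x ^ β := by positivity
    have h5 := hR x ((le_max_left R 1).trans hx)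
    have h6 : Complex.exp (((-(Real.pi / 4) : ℝ) : ℂ) * Complex.I) *
        (Complex.exp (2 * s) * (Complex.exp (β * s) * (x ^ β : ℝ) - μ)) =
        Complex.exp (((-(Real.pi / 4) : ℝ) : ℂ) * Complex.I + (β + 2) * s) * (x ^ β : ℝ) -
        Complex.exp (((-(Real.pi / 4) : ℝ) : ℂ) * Complex.I) * Complex.exp (2 * s) * μ := by
      rw [Complex.exp_add, add_mul, Complex.exp_add]; ring
    have h7 : (Complex.exp (((-(Real.pi / 4) : ℝ) : ℂ) * Complex.I + (β + 2) * s)).re =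
        Real.exp ((β + 2) * s.re) * Real.cos (-(Real.pi / 4) + (β + 2) * s.im) := by
      rw [Complex.exp_re]
      congr 2 <;> simp
    have h8 : k ≤ (Complex.exp (((-(Real.pi / 4) : ℝ) : ℂ) * Complex.I + (β + 2) * s)).re := by
      rw [h7]
      refine mul_le_mul (Real.exp_le_exp.mpr (by nlinarith)) ?_
        (Real.cos_pos_of_mem_Ioo ⟨by linarith, by linarith⟩).le (Real.exp_pos _).le
      rw [← Real.cos_abs (-(Real.pi / 4) + (β + 2) * s.im)]
      refine Real.cos_le_cos_of_nonneg_of_le_pi (abs_nonneg _) (by linarith) (abs_le.mpr ⟨?_, ?_⟩)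
        <;> linarith
    have h9 : (Complex.exp (((-(Real.pi / 4) : ℝ) : ℂ) * Complex.I) * Complex.exp (2 * s) * μ).re ≤
        Real.exp 2 * ‖μ‖ := by
      refine (Complex.re_le_norm _).trans ?_
      rw [norm_mul, norm_mul, Complex.norm_exp_ofReal_mul_I, one_mul, Complex.norm_exp]
      gcongr
      simp; linarith
    rw [h6, Complex.sub_re, Complex.re_mul_ofReal]
    have h10 := mul_le_mul_of_nonneg_right h8 hxβ
    linarith

/-- Complex scaling: the equations `y'' = (x^β - μ) y` and `y'' = (i x^β - η) y` have
square-integrable solutions with proportional derivatives at the origin, for a suitable rotation `μ`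
of `η`. -/
lemma exists_rotated_halfLineSolution {β : ℝ} (hβ : 0 < β) (η : ℂ) :
    ∃ (μ k : ℂ) (W W' F F' : ℝ → ℂ), ‖μ‖ = ‖η‖ ∧ k ≠ 0 ∧
      IsHalfLineSolution (fun x => (x ^ β : ℝ) - μ) W W' ∧
      IsHalfLineSolution (fun x => Complex.I * (x ^ β : ℝ) - η) F F' ∧
      (∀ p : ℝ, 0 ≤ p → IntegrableOn (fun x => x ^ p * ‖W x‖ ^ 2) (Ioi 0)) ∧
      IntegrableOn (fun x => ‖W' x‖ ^ 2) (Ioi 0) ∧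
      (∀ p : ℝ, 0 ≤ p → IntegrableOn (fun x => x ^ p * ‖F x‖ ^ 2) (Ioi 0)) ∧
      IntegrableOn (fun x => ‖F' x‖ ^ 2) (Ioi 0) ∧
      F' 0 = k * W' 0 ∧ ∃ x, 0 < x ∧ W' x ≠ 0 := by
  have hpi := Real.pi_pos
  have hβc : (β : ℂ) + 2 ≠ 0 := by exact_mod_cast (by positivity : β + 2 ≠ 0)
  let σ : ℂ := ((Real.pi / (2 * (β + 2)) : ℝ) : ℂ) * Complex.I
  have hσre : σ.re = 0 := by simp only [σ, Complex.re_ofReal_mul, Complex.I_re, mul_zero]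
  have hσim : (β + 2) * σ.im = Real.pi / 2 := by
    simp only [σ, Complex.im_ofReal_mul, Complex.I_im]
    field_simp
  let μ : ℂ := Complex.exp (-2 * σ) * η
  have hμ : ‖μ‖ = ‖η‖ := by
    simp only [μ, norm_mul, Complex.norm_exp]
    simp [hσre]
  obtain ⟨f₀, hf₀, hode₀, K₀, hK₀⟩ :=
    exists_exp_series_solution hβ.le (Or.inl rfl : (0:ℝ) = 0 ∨ _) μ
  obtain ⟨f₁, hf₁, hode₁, K₁, hK₁⟩ :=
    exists_exp_series_solution hβ.le (Or.inr rfl : (1:ℝ) = 0 ∨ _) μ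
  simp only [Complex.ofReal_zero, zero_mul, Complex.exp_zero, sub_zero] at hK₀
  simp only [Complex.ofReal_one, one_mul] at hK₁
  obtain ⟨R, hR, δ, ω, hcoer⟩ := exists_forall_isCoerciveFrom hβ μ
  let Ω : Set ℂ := {s | -1 < s.re} ∩ {s | s.re < 1} ∩ {s | -(Real.pi / 8) / (β + 2) < s.im} ∩
    {s | s.im < 5 * Real.pi / 8 / (β + 2)}
  have hΩo : IsOpen Ω := by
    refine ((IsOpen.inter ?_ ?_).inter ?_).inter ?_
    · exact isOpen_lt continuous_const Complex.continuous_re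
    · exact isOpen_lt Complex.continuous_re continuous_const
    · exact isOpen_lt continuous_const Complex.continuous_im
    · exact isOpen_lt Complex.continuous_im continuous_const
  have hΩc : Convex ℝ Ω := (((convex_halfSpace_re_gt _).inter (convex_halfSpace_re_lt _)).inter
    (convex_halfSpace_im_gt _)).inter (convex_halfSpace_im_lt _)
  have hb2 : 0 < β + 2 := by positivity
  have hΩmem : ∀ s : ℂ, s ∈ Ω ↔ ((-1 < s.re ∧ s.re < 1) ∧ -(Real.pi / 8) < (β + 2) * s.im) ∧
      (β + 2) * s.im < 5 * Real.pi / 8 := fun s => by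
    simp only [Ω, mem_inter_iff, mem_ofPred_eq, div_lt_iff₀' hb2, lt_div_iff₀' hb2]
  have hcoer' : ∀ s ∈ Ω, IsCoerciveFrom
      (fun x => Complex.exp (2 * s) * (Complex.exp (β * s) * (x ^ β : ℝ) - μ)) R δ ω := by
    intro s hs
    obtain ⟨⟨⟨h1, h2⟩, h3⟩, h4⟩ := (hΩmem s).mp hs
    exact hcoer s h1 h2 h3 h4
  have hΩ0 : (0 : ℂ) ∈ Ω := by
    rw [hΩmem]
    refine ⟨⟨⟨?_, ?_⟩, ?_⟩, ?_⟩ <;> simp [hpi]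
  have hΩσ : σ ∈ Ω := by
    rw [hΩmem, hσre, hσim]
    refine ⟨⟨⟨?_, ?_⟩, ?_⟩, ?_⟩ <;> linarith
  have hU := fun s (_ : s ∈ Ω) => isSolutionFrom_comp_add_log hf₀ hode₀ s hR
  have hV := fun s (_ : s ∈ Ω) => isSolutionFrom_comp_add_log hf₁ hode₁ s hR
  have hRc : (R : ℂ) ≠ 0 := by exact_mod_cast hR.ne'
  have hw : ∀ s ∈ Ω, f₀ (s + (Real.log R : ℂ)) * (deriv f₁ (s + (Real.log R : ℂ)) / R) -
      deriv f₀ (s + (Real.log R : ℂ)) / R * f₁ (s + (Real.log R : ℂ)) ≠ 0 := by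
    intro s _
    have h1 := wronskian_eq_exp hf₀ hf₁ hode₀ hode₁ hK₀ hK₁ (s + (Real.log R : ℂ))
    rw [mul_div_assoc', div_mul_eq_mul_div, ← sub_div, h1]
    exact div_ne_zero (Complex.exp_ne_zero _) hRc
  have hUd : ∀ x, R ≤ x → DifferentiableOn ℂ (fun s => f₀ (s + (Real.log x : ℂ))) Ω :=
    fun x _ => (differentiable_comp_add hf₀ _).differentiableOn
  have hVd : ∀ x, R ≤ x → DifferentiableOn ℂ (fun s => f₁ (s + (Real.log x : ℂ))) Ω :=
    fun x _ => (differentiable_comp_add hf₁ _).differentiableOn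
  have hUd' : DifferentiableOn ℂ (fun s => deriv f₀ (s + (Real.log R : ℂ)) / R) Ω :=
    ((differentiable_comp_add hf₀.deriv _).div_const _).differentiableOn
  have hVd' : DifferentiableOn ℂ (fun s => deriv f₁ (s + (Real.log R : ℂ)) / R) Ω :=
    ((differentiable_comp_add hf₁.deriv _).div_const _).differentiableOn
  obtain ⟨A, B, -, -, hAB⟩ :=
    exists_differentiableOn_weyl_coeff hΩo hcoer' hU hV hw hUd hVd hUd' hVd'
  obtain ⟨hAB1, hABflux⟩ := hAB 0 hΩ0
  generalize A 0 = a at hAB1 hABflux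
  generalize B 0 = b at hAB1 hABflux
  let Y : ℂ → ℝ → ℂ := fun s x => if x ≤ 0 then a else
    a * f₀ (s + (Real.log x : ℂ)) + b * f₁ (s + (Real.log x : ℂ))
  let Y' : ℂ → ℝ → ℂ := fun s x => if x ≤ 0 then b * Complex.exp s else
    a * (deriv f₀ (s + (Real.log x : ℂ)) / x) + b * (deriv f₁ (s + (Real.log x : ℂ)) / x)
  have hYpos : ∀ s x, 0 < x → Y s x =
      a * f₀ (s + (Real.log x : ℂ)) + b * f₁ (s + (Real.log x : ℂ)) := fun s x hx => by
    simp [Y, hx.not_ge]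
  have hYpos' : ∀ s x, 0 < x → Y' s x = a * (deriv f₀ (s + (Real.log x : ℂ)) / x) +
      b * (deriv f₁ (s + (Real.log x : ℂ)) / x) := fun s x hx => by
    simp [Y', hx.not_ge]
  have hYflux : ∀ s x, 0 < x → flux ω (Y s) (Y' s) x =
      flux ω (fun x => a * f₀ (s + (Real.log x : ℂ)) + b * f₁ (s + (Real.log x : ℂ)))
      (fun x => a * (deriv f₀ (s + (Real.log x : ℂ)) / x) +
      b * (deriv f₁ (s + (Real.log x : ℂ)) / x)) x := fun s x hx => by
    simp only [flux, hYpos s x hx, hYpos' s x hx]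
  have hscale : ∀ (t x : ℝ), 0 < x →
      flux ω (Y t) (Y' t) x = Real.exp t * flux ω (Y 0) (Y' 0) (Real.exp t * x) := by
    intro t x hx
    have h1 : 0 < Real.exp t * x := by positivity
    have h2 : (t : ℂ) + (Real.log x : ℂ) = 0 + ((Real.log (Real.exp t * x) : ℝ) : ℂ) := by
      rw [Real.log_mul (Real.exp_pos t).ne' hx.ne', Real.log_exp]; push_cast; ring
    have h3 : Y' t x = (Real.exp t : ℂ) * Y' 0 (Real.exp t * x) := by
      have : (Real.exp t : ℂ) ≠ 0 := by exact_mod_cast (Real.exp_pos t).ne'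
      have hxc : (x : ℂ) ≠ 0 := by exact_mod_cast hx.ne'
      rw [hYpos' _ _ hx, hYpos' _ _ h1, h2, Complex.ofReal_mul]
      field_simp
    have h4 : Y t x = Y 0 (Real.exp t * x) := by
      rw [hYpos _ _ hx, hYpos _ _ h1, h2]
    rw [flux, flux, h3, h4, ← Complex.re_ofReal_mul]
    congr 1; ring
  have hY0 : ∀ x, R ≤ x → flux ω (Y 0) (Y' 0) x ≤ 0 := fun x hx => by
    rw [hYflux _ _ (hR.trans_le hx)]; exact hABflux x hx
  have hfreq : ∃ᶠ s in 𝓝[≠] (0 : ℂ), ∀ x, R ≤ x →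
      flux ω (fun x => a * f₀ (s + (Real.log x : ℂ)) + b * f₁ (s + (Real.log x : ℂ)))
      (fun x => a * (deriv f₀ (s + (Real.log x : ℂ)) / x) +
      b * (deriv f₁ (s + (Real.log x : ℂ)) / x)) x ≤ 0 := by
    have htend : Tendsto (fun t : ℝ => (t : ℂ)) (𝓝[>] 0) (𝓝[≠] (0 : ℂ)) := by
      refine tendsto_nhdsWithin_iff.mpr ⟨?_, ?_⟩
      · exact (Complex.continuous_ofReal.tendsto' 0 0 Complex.ofReal_zero).mono_left
          nhdsWithin_le_nhds
      · filter_upwards [self_mem_nhdsWithin] with t (ht : 0 < t)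
        simpa using ht.ne'
    refine htend.frequently (Eventually.frequently ?_)
    filter_upwards [self_mem_nhdsWithin] with t (ht : 0 < t) x hx
    have hx0 := hR.trans_le hx
    rw [← hYflux _ _ hx0, hscale t x hx0]
    refine mul_nonpos_of_nonneg_of_nonpos (Real.exp_pos t).le (hY0 _ (hx.trans ?_))
    exact le_mul_of_one_le_left hx0.le (Real.one_le_exp ht.le)
  have hYσ : ∀ x, R ≤ x → flux ω (Y σ) (Y' σ) x ≤ 0 := fun x hx => by
    rw [hYflux _ _ (hR.trans_le hx)]
    exact flux_nonpos_of_frequently_flux_nonpos hΩo hΩc.isPreconnected hcoer' hU hV hw hUd hVd hUd'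
      hVd' hΩ0 hfreq hΩσ hx
  have hsol : ∀ s, IsHalfLineSolution
      (fun x => Complex.exp (2 * s) * (Complex.exp (β * s) * (x ^ β : ℝ) - μ)) (Y s) (Y' s) := by
    intro s
    refine isHalfLineSolution_of_tendsto ?_ (fun x hx => ?_) ?_ ?_
    · have h1 : ContinuousOn (fun x : ℝ => ((x ^ β : ℝ) : ℂ)) (Ici 0) :=
        Complex.continuous_ofReal.comp_continuousOn
          (continuousOn_id.rpow_const fun x _ => Or.inr hβ.le)
      fun_prop
    · have h0 := ((isSolutionFrom_comp_add_log hf₀ hode₀ s hx).const_mul a).add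
        ((isSolutionFrom_comp_add_log hf₁ hode₁ s hx).const_mul b) x le_rfl
      rw [hYpos' s x hx, hYpos s x hx]
      refine ⟨h0.1.congr_of_eventuallyEq ?_, h0.2.congr_of_eventuallyEq ?_⟩
      · filter_upwards [lt_mem_nhds hx] with t ht using hYpos s t ht
      · filter_upwards [lt_mem_nhds hx] with t ht using hYpos' s t ht
    · refine Tendsto.congr' (f₁ := fun x : ℝ => a * (1 + (f₀ (s + (Real.log x : ℂ)) - 1) / x * x) +
        b * (f₁ (s + (Real.log x : ℂ)) / x * x)) ?_ ?_
      · filter_upwards [self_mem_nhdsWithin] with x (hx : 0 < x)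
        have hxc : (x : ℂ) ≠ 0 := by exact_mod_cast hx.ne'
        rw [hYpos s x hx, div_mul_cancel₀ _ hxc, div_mul_cancel₀ _ hxc, add_sub_cancel]
      · have hid : Tendsto (fun x : ℝ => (x : ℂ)) (𝓝[>] 0) (𝓝 0) :=
          (Complex.continuous_ofReal.tendsto' 0 0 Complex.ofReal_zero).mono_left nhdsWithin_le_nhds
        have h := ((((tendsto_of_norm_sub_exp_le (g := fun s => f₀ s - 1) (a := 0)
          (fun s hs => by simpa using (hK₀ s hs).1) s).mul hid).const_add 1).const_mul a).add
          (((tendsto_of_norm_sub_exp_le (a := 1)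
          (fun s hs => by simpa using (hK₁ s hs).1) s).mul hid).const_mul b)
        simpa [Y] using h
    · refine Tendsto.congr' (f₁ := fun x : ℝ => a * (deriv f₀ (s + (Real.log x : ℂ)) / x) +
        b * (deriv f₁ (s + (Real.log x : ℂ)) / x)) ?_ ?_
      · filter_upwards [self_mem_nhdsWithin] with x (hx : 0 < x) using (hYpos' s x hx).symm
      · have h := ((tendsto_of_norm_sub_exp_le (a := 0)
          (fun s hs => by simpa using (hK₀ s hs).2) s).const_mul a).add
          ((tendsto_of_norm_sub_exp_le (a := 1)
          (fun s hs => by simpa using (hK₁ s hs).2) s).const_mul b)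
        simpa [Y'] using h
  have hq0 : (fun x : ℝ => Complex.exp (2 * 0) * (Complex.exp (β * 0) * (x ^ β : ℝ) - μ)) =
      fun x => ((x ^ β : ℝ) : ℂ) - μ := by
    simp
  have hqσ : (fun x : ℝ => Complex.exp (2 * σ) * (Complex.exp (β * σ) * (x ^ β : ℝ) - μ)) =
      fun x => Complex.I * (x ^ β : ℝ) - η := by
    funext x
    have h1 : Complex.exp (2 * σ) * Complex.exp (β * σ) = Complex.I := by
      rw [← Complex.exp_add, ← Complex.exp_pi_div_two_mul_I]
      congr 1
      simp only [σ]
      push_cast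
      field_simp
      ring
    have h2 : Complex.exp (2 * σ) * Complex.exp (-2 * σ) = 1 := by
      rw [← Complex.exp_add]; simp
    linear_combination (x ^ β : ℝ) * h1 - η * h2
  have hint : ∀ s ∈ Ω, (∀ x, R ≤ x → flux ω (Y s) (Y' s) x ≤ 0) →
      (∀ p : ℝ, 0 ≤ p → IntegrableOn (fun x => x ^ p * ‖Y s x‖ ^ 2) (Ioi 0)) ∧
      IntegrableOn (fun x => ‖Y' s x‖ ^ 2) (Ioi 0) := by
    intro s hs hflux
    refine (hcoer' s hs).integrableOn_of_flux_nonpos (fun x hx => ?_) hR.le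
      (fun x hx => (hsol s x hx).1.continuousWithinAt)
      (fun x hx => (hsol s x hx).2.continuousWithinAt) hflux
    have hx0 : 0 < x := hR.trans_le hx
    have := hsol s x hx0.le
    exact ⟨this.1.hasDerivAt (Ici_mem_nhds hx0), this.2.hasDerivAt (Ici_mem_nhds hx0)⟩
  refine ⟨μ, Complex.exp σ, Y 0, Y' 0, Y σ, Y' σ, hμ, Complex.exp_ne_zero _, hq0 ▸ hsol 0,
    hqσ ▸ hsol σ, (hint 0 hΩ0 hY0).1, (hint 0 hΩ0 hY0).2, (hint σ hΩσ hYσ).1,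
    (hint σ hΩσ hYσ).2, ?_, R, hR, ?_⟩
  · simp [Y', mul_comm]
  · rw [hYpos' _ _ hR, hAB1]
    exact one_ne_zero

end Rotation

section Spectral

open Filter Topology

lemma IsHalfLineSolution.continuousOn {q y y' : ℝ → ℂ} (h : IsHalfLineSolution q y y') :
    ContinuousOn y (Ici 0) := fun x hx => (h x hx).1.continuousWithinAt

lemma IsHalfLineSolution.continuousOn_deriv {q y y' : ℝ → ℂ} (h : IsHalfLineSolution q y y') :
    ContinuousOn y' (Ici 0) := fun x hx => (h x hx).2.continuousWithinAt

lemma IsHalfLineSolution.isSolutionFrom {q y y' : ℝ → ℂ} (h : IsHalfLineSolution q y y') {R : ℝ}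
    (hR : 0 < R) : IsSolutionFrom q R y y' := fun x hx =>
  have hx0 : 0 < x := hR.trans_le hx
  ⟨(h x hx0.le).1.hasDerivAt (Ici_mem_nhds hx0), (h x hx0.le).2.hasDerivAt (Ici_mem_nhds hx0)⟩

/-- A square-integrable Neumann solution of `W'' = (x^β - μ) W` with `|μ|` below the spectral
constant vanishes. -/
lemma deriv_zero_ne_zero_of_halfLineSolution {β c : ℝ}
    (hspec : ∀ u u' : ℝ → ℂ,
        (∀ x ∈ Ici (0:ℝ), HasDerivWithinAt u (u' x) (Ici 0) x) →
        ContinuousOn u' (Ici 0) →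
        IntegrableOn (fun x => ‖u x‖ ^ 2) (Ioi 0) →
        IntegrableOn (fun x => ‖u' x‖ ^ 2) (Ioi 0) →
        ENNReal.ofReal c * (∫⁻ x in Ioi (0:ℝ), ENNReal.ofReal (‖u x‖ ^ 2)) ≤
          (∫⁻ x in Ioi (0:ℝ), ENNReal.ofReal (‖u' x‖ ^ 2)) +
            ∫⁻ x in Ioi (0:ℝ), ENNReal.ofReal (x ^ β * ‖u x‖ ^ 2))
    {μ : ℂ} (hμ : ‖μ‖ < c) {W W' : ℝ → ℂ}
    (hW : IsHalfLineSolution (fun x => (x ^ β : ℝ) - μ) W W')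
    (hint : IntegrableOn (fun x => ‖W x‖ ^ 2) (Ioi 0))
    (hint' : IntegrableOn (fun x => ‖W' x‖ ^ 2) (Ioi 0))
    (hintβ : IntegrableOn (fun x => x ^ β * ‖W x‖ ^ 2) (Ioi 0))
    {x₀ : ℝ} (hx₀ : 0 < x₀) (hne : W' x₀ ≠ 0) : W' 0 ≠ 0 := by
  intro h0
  have hc : 0 < c := (norm_nonneg _).trans_lt hμ
  have hJcont : ContinuousOn (fun x => W' x * (starRingEnd ℂ) (W x)) (Ici 0) :=
    hW.continuousOn_deriv.mul (Complex.continuous_conj.comp_continuousOn hW.continuousOn)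
  have hJint : IntegrableOn (fun x => W' x * (starRingEnd ℂ) (W x)) (Ioi 0) := by
    refine Integrable.mono' (hint.add hint')
      ((hJcont.mono Ioi_subset_Ici_self).aestronglyMeasurable measurableSet_Ioi)
      (.of_forall fun x => ?_)
    rw [norm_mul, RCLike.norm_conj, Pi.add_apply]
    nlinarith [sq_nonneg (‖W x‖ - ‖W' x‖), sq_nonneg (‖W x‖ + ‖W' x‖)]
  have hI : Integrable (fun x => ((‖W x‖ ^ 2 : ℝ) : ℂ)) (volume.restrict (Ioi 0)) := hint.ofReal
  have hI' : Integrable (fun x => ((‖W' x‖ ^ 2 : ℝ) : ℂ)) (volume.restrict (Ioi 0)) := hint'.ofReal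
  have hIβ : Integrable (fun x => ((x ^ β * ‖W x‖ ^ 2 : ℝ) : ℂ)) (volume.restrict (Ioi 0)) :=
    hintβ.ofReal
  have hderiv : ∀ x ∈ Ioi (0 : ℝ), HasDerivAt (fun x => W' x * (starRingEnd ℂ) (W x))
      (((‖W' x‖ ^ 2 : ℝ) : ℂ) + ((x ^ β * ‖W x‖ ^ 2 : ℝ) : ℂ) - μ * ((‖W x‖ ^ 2 : ℝ) : ℂ)) x := by
    intro x hx
    convert! hasDerivAt_mul_conj (hW.isSolutionFrom hx) le_rfl using 1
    push_cast
    ring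
  have hJ'int := (hI'.add hIβ).sub (hI.const_mul μ)
  have htend := tendsto_zero_of_hasDerivAt_of_integrableOn_Ioi hderiv hJ'int hJint
  have hzero := integral_Ioi_of_hasDerivAt_of_tendsto
    ((hJcont 0 self_mem_Ici)) hderiv hJ'int htend
  have hsplit : (∫ x in Ioi (0 : ℝ), (((‖W' x‖ ^ 2 : ℝ) : ℂ) + ((x ^ β * ‖W x‖ ^ 2 : ℝ) : ℂ) -
      μ * ((‖W x‖ ^ 2 : ℝ) : ℂ))) = ((∫ x in Ioi (0 : ℝ), ‖W' x‖ ^ 2 : ℝ) : ℂ) +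
      ((∫ x in Ioi (0 : ℝ), x ^ β * ‖W x‖ ^ 2 : ℝ) : ℂ) -
      μ * ((∫ x in Ioi (0 : ℝ), ‖W x‖ ^ 2 : ℝ) : ℂ) := by
    rw [← integral_complex_ofReal, ← integral_complex_ofReal, ← integral_complex_ofReal,
      ← MeasureTheory.integral_const_mul, ← integral_add hI' hIβ]
    exact integral_sub (hI'.add hIβ) (hI.const_mul μ)
  rw [hsplit, h0, zero_mul, sub_zero] at hzero
  have hs := hspec W W' (fun x hx => (hW x hx).1) hW.continuousOn_deriv hint hint'
  have hnonneg : ∀ᵐ x ∂(volume.restrict (Ioi (0 : ℝ))), 0 ≤ x ^ β * ‖W x‖ ^ 2 := by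
    filter_upwards [ae_restrict_mem measurableSet_Ioi] with x (hx : 0 < x)
    positivity
  rw [← ofReal_integral_eq_lintegral_ofReal hint (.of_forall fun x => sq_nonneg _),
    ← ofReal_integral_eq_lintegral_ofReal hint' (.of_forall fun x => sq_nonneg _),
    ← ofReal_integral_eq_lintegral_ofReal hintβ hnonneg, ← ENNReal.ofReal_mul hc.le,
    ← ENNReal.ofReal_add (integral_nonneg fun x => sq_nonneg _) (integral_nonneg_of_ae hnonneg),
    ENNReal.ofReal_le_ofReal_iff (add_nonneg (integral_nonneg fun x => sq_nonneg _)
      (integral_nonneg_of_ae hnonneg))] at hs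
  have hC : 0 ≤ ∫ x in Ioi (0 : ℝ), ‖W x‖ ^ 2 := integral_nonneg fun x => sq_nonneg _
  have hle : (∫ x in Ioi (0 : ℝ), ‖W' x‖ ^ 2) + ∫ x in Ioi (0 : ℝ), x ^ β * ‖W x‖ ^ 2 ≤
      ‖μ‖ * ∫ x in Ioi (0 : ℝ), ‖W x‖ ^ 2 := by
    have h1 := congrArg Complex.re (sub_eq_zero.mp hzero)
    rw [← Complex.ofReal_add, Complex.ofReal_re, Complex.re_mul_ofReal] at h1
    rw [h1]
    exact mul_le_mul_of_nonneg_right (Complex.re_le_norm μ) hC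
  have hC0 : ∫ x in Ioi (0 : ℝ), ‖W x‖ ^ 2 = 0 := by nlinarith
  have hae : W =ᵐ[volume.restrict (Ioi 0)] fun _ => 0 := by
    filter_upwards [(integral_eq_zero_iff_of_nonneg (fun x => sq_nonneg _) hint).mp hC0] with x hx
    simpa using hx
  have heq : EqOn W (fun _ => 0) (Ioi 0) :=
    Measure.eqOn_open_of_ae_eq hae isOpen_Ioi (hW.continuousOn.mono Ioi_subset_Ici_self)
      continuousOn_const
  have hd : HasDerivAt W 0 x₀ := (hasDerivAt_const x₀ (0 : ℂ)).congr_of_eventuallyEq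
    (heq.eventuallyEq_of_mem (Ioi_mem_nhds hx₀))
  exact hne ((hW.isSolutionFrom hx₀ x₀ le_rfl).1.unique hd)

lemma integrableOn_exp_neg_mul {a : ℝ} (ha : 0 < a) :
    IntegrableOn (fun x => Real.exp (-a * x)) (Ioi 0) := by
  simpa using exp_neg_integrableOn_Ioi 0 ha

lemma lintegral_exp_neg_mul {a : ℝ} (ha : 0 < a) :
    ∫⁻ x in Ioi (0 : ℝ), ENNReal.ofReal (Real.exp (-a * x)) = ENNReal.ofReal (1 / a) := by
  rw [← ofReal_integral_eq_lintegral_ofReal (integrableOn_exp_neg_mul ha)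
    (.of_forall fun x => (Real.exp_pos _).le), integral_exp_mul_Ioi (by linarith) 0]
  congr 1
  simp

/-- For `β = 0` the spectral constant is at most `1`. -/
lemma le_one_of_spectral_inequality {c : ℝ}
    (hspec : ∀ u u' : ℝ → ℂ,
        (∀ x ∈ Ici (0:ℝ), HasDerivWithinAt u (u' x) (Ici 0) x) →
        ContinuousOn u' (Ici 0) →
        IntegrableOn (fun x => ‖u x‖ ^ 2) (Ioi 0) →
        IntegrableOn (fun x => ‖u' x‖ ^ 2) (Ioi 0) →
        ENNReal.ofReal c * (∫⁻ x in Ioi (0:ℝ), ENNReal.ofReal (‖u x‖ ^ 2)) ≤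
          (∫⁻ x in Ioi (0:ℝ), ENNReal.ofReal (‖u' x‖ ^ 2)) +
            ∫⁻ x in Ioi (0:ℝ), ENNReal.ofReal (‖u x‖ ^ 2)) : c ≤ 1 := by
  by_contra! hc
  let a := √((c - 1) / 2)
  have ha : 0 < a := Real.sqrt_pos.mpr (by linarith)
  have ha2 : a ^ 2 = (c - 1) / 2 := Real.sq_sqrt (by linarith)
  have hd : ∀ x : ℝ, HasDerivAt (fun x : ℝ => ((Real.exp (-a * x) : ℝ) : ℂ))
      ((Real.exp (-a * x) * -a : ℝ) : ℂ) x := fun x => by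
    have := ((hasDerivAt_id x).const_mul (-a)).exp.ofReal_comp
    simpa using this
  have hn : ∀ x : ℝ, ‖((Real.exp (-a * x) : ℝ) : ℂ)‖ ^ 2 = Real.exp (-(2 * a) * x) := fun x => by
    rw [Complex.norm_real, Real.norm_of_nonneg (Real.exp_pos _).le, ← Real.exp_nat_mul]
    congr 1; push_cast; ring
  have hn' : ∀ x : ℝ, ‖((Real.exp (-a * x) * -a : ℝ) : ℂ)‖ ^ 2 =
      a ^ 2 * Real.exp (-(2 * a) * x) := fun x => by
    rw [Complex.ofReal_mul, norm_mul, mul_pow, hn, Complex.norm_real, norm_neg,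
      Real.norm_of_nonneg ha.le, mul_comm]
  have hi := integrableOn_exp_neg_mul (a := 2 * a) (by positivity)
  have key := hspec _ _ (fun x _ => (hd x).hasDerivWithinAt)
    (by fun_prop) (by simpa only [hn] using hi) (by simp only [hn']; exact hi.const_mul _)
  simp only [hn, hn', ENNReal.ofReal_mul (sq_nonneg a)] at key
  rw [lintegral_const_mul _ (by fun_prop), lintegral_exp_neg_mul (by positivity),
    ← ENNReal.ofReal_mul (by linarith), ← ENNReal.ofReal_mul (by positivity),
    ← ENNReal.ofReal_add (by positivity) (by positivity),
    ENNReal.ofReal_le_ofReal_iff (by positivity)] at key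
  have h1 : c ≤ a ^ 2 + 1 := by
    refine le_of_mul_le_mul_right ?_ (by positivity : 0 < 1 / (2 * a))
    linarith
  linarith

lemma exists_sq_eq_re_pos {z : ℂ} (hz : z ∈ Complex.slitPlane) : ∃ κ : ℂ, κ ^ 2 = z ∧ 0 < κ.re := by
  have hz0 := Complex.slitPlane_ne_zero hz
  refine ⟨Complex.exp (Complex.log z / 2), ?_, ?_⟩
  · rw [← Complex.exp_nat_mul]
    push_cast
    rw [mul_div_cancel₀ _ (two_ne_zero), Complex.exp_log hz0]
  · rw [Complex.exp_re]
    refine mul_pos (Real.exp_pos _) (Real.cos_pos_of_mem_Ioo ?_)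
    have h1 : (Complex.log z / 2).im = Complex.arg z / 2 := by
      simp [Complex.log_im]
    have h2 := Complex.neg_pi_lt_arg z
    have h3 := (Complex.arg_le_pi z).lt_of_ne (Complex.mem_slitPlane_iff_arg.mp hz).1
    rw [h1]
    constructor <;> linarith

end Spectral

section Assembly

lemma exists_normalized_of_halfLineSolution {β : ℝ} (hβ : 0 ≤ β) {η : ℂ} {Y Y' : ℝ → ℂ}
    (hY : IsHalfLineSolution (fun x => Complex.I * (x ^ β : ℝ) - η) Y Y')
    (hint : ∀ p : ℝ, 0 ≤ p → IntegrableOn (fun x => x ^ p * ‖Y x‖ ^ 2) (Ioi 0))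
    (hint' : IntegrableOn (fun x => ‖Y' x‖ ^ 2) (Ioi 0)) (h0 : Y' 0 ≠ 0) :
    ∃ F F' F'' : ℝ → ℂ,
      (∀ x ∈ Ici (0:ℝ), HasDerivWithinAt F (F' x) (Ici 0) x) ∧
      (∀ x ∈ Ici (0:ℝ), HasDerivWithinAt F' (F'' x) (Ici 0) x) ∧
      ContinuousOn F'' (Ici 0) ∧
      IntegrableOn (fun x => ‖F x‖ ^ 2) (Ioi 0) ∧
      IntegrableOn (fun x => ‖F' x‖ ^ 2) (Ioi 0) ∧
      IntegrableOn (fun x => ‖F'' x‖ ^ 2) (Ioi 0) ∧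
      IntegrableOn (fun x => x ^ β * ‖F x‖ ^ 2) (Ioi 0) ∧
      F' 0 = 1 ∧
      ∀ x : ℝ, 0 ≤ x →
        -F'' x + Complex.I * ((x ^ β : ℝ) : ℂ) * F x - η * F x = 0 := by
  have hint0 := hint 0 le_rfl
  simp only [Real.rpow_zero, one_mul] at hint0
  have hqc : ContinuousOn (fun x : ℝ => (Complex.I * (x ^ β : ℝ) - η) * Y x) (Ici 0) := by
    have h1 : ContinuousOn (fun x : ℝ => ((x ^ β : ℝ) : ℂ)) (Ici 0) :=
      Complex.continuous_ofReal.comp_continuousOn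
        (continuousOn_id.rpow_const fun x _ => Or.inr hβ)
    have h2 := hY.continuousOn
    fun_prop
  have hint2 : IntegrableOn (fun x => ‖(Complex.I * (x ^ β : ℝ) - η) * Y x‖ ^ 2) (Ioi 0) := by
    refine Integrable.mono' (((hint (2 * β) (by positivity)).const_mul 2).add
      (hint0.const_mul (2 * ‖η‖ ^ 2)))
      (((hqc.mono Ioi_subset_Ici_self).norm.pow 2).aestronglyMeasurable measurableSet_Ioi) ?_
    filter_upwards [ae_restrict_mem measurableSet_Ioi] with x (hx : 0 < x)
    have h1 : ‖Complex.I * (x ^ β : ℝ) - η‖ ≤ x ^ β + ‖η‖ := by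
      refine (norm_sub_le _ _).trans (le_of_eq ?_)
      rw [norm_mul, Complex.norm_I, one_mul, Complex.norm_real, Real.norm_of_nonneg (by positivity)]
    have h2 : ‖Complex.I * (x ^ β : ℝ) - η‖ ^ 2 ≤ 2 * (x ^ β) ^ 2 + 2 * ‖η‖ ^ 2 := by
      nlinarith [norm_nonneg (Complex.I * (x ^ β : ℝ) - η), sq_nonneg (x ^ β - ‖η‖)]
    have h3 : x ^ (2 * β) = (x ^ β) ^ 2 := by
      rw [mul_comm, Real.rpow_mul hx.le, Real.rpow_two]
    rw [Real.norm_of_nonneg (by positivity), norm_mul, mul_pow, Pi.add_apply, h3]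
    nlinarith [mul_le_mul_of_nonneg_right h2 (sq_nonneg ‖Y x‖)]
  have hscale : ∀ (g : ℝ → ℂ) (x : ℝ), ‖(Y' 0)⁻¹ * g x‖ ^ 2 = ‖(Y' 0)⁻¹‖ ^ 2 * ‖g x‖ ^ 2 :=
    fun g x => by rw [norm_mul, mul_pow]
  refine ⟨fun x => (Y' 0)⁻¹ * Y x, fun x => (Y' 0)⁻¹ * Y' x,
    fun x => (Y' 0)⁻¹ * ((Complex.I * (x ^ β : ℝ) - η) * Y x),
    fun x hx => (hY x hx).1.const_mul _, fun x hx => (hY x hx).2.const_mul _,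
    hqc.const_mul _, ?_, ?_, ?_, ?_, inv_mul_cancel₀ h0, fun x _ => by ring⟩
  · simp only [hscale]
    exact hint0.const_mul _
  · simp only [hscale]
    exact hint'.const_mul _
  · simp only [hscale fun x => (Complex.I * (x ^ β : ℝ) - η) * Y x]
    exact hint2.const_mul _
  · simp only [hscale, mul_left_comm _ (‖(Y' 0)⁻¹‖ ^ 2)]
    exact (hint β hβ).const_mul _

lemma exists_exponential_solution {η : ℂ} (hη : ‖η‖ < 1) :
    ∃ F F' F'' : ℝ → ℂ,
      (∀ x ∈ Ici (0:ℝ), HasDerivWithinAt F (F' x) (Ici 0) x) ∧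
      (∀ x ∈ Ici (0:ℝ), HasDerivWithinAt F' (F'' x) (Ici 0) x) ∧
      ContinuousOn F'' (Ici 0) ∧
      IntegrableOn (fun x => ‖F x‖ ^ 2) (Ioi 0) ∧
      IntegrableOn (fun x => ‖F' x‖ ^ 2) (Ioi 0) ∧
      IntegrableOn (fun x => ‖F'' x‖ ^ 2) (Ioi 0) ∧
      IntegrableOn (fun x => x ^ (0:ℝ) * ‖F x‖ ^ 2) (Ioi 0) ∧
      F' 0 = 1 ∧
      ∀ x : ℝ, 0 ≤ x →
        -F'' x + Complex.I * ((x ^ (0:ℝ) : ℝ) : ℂ) * F x - η * F x = 0 := by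
  have hz : Complex.I - η ∈ Complex.slitPlane := by
    refine Or.inr fun h => ?_
    have h1 := (Complex.abs_im_le_norm η).trans_lt hη
    have h2 : η.im = 1 := by
      simp only [Complex.sub_im, Complex.I_im] at h
      linarith
    rw [h2, abs_one] at h1
    exact lt_irrefl _ h1
  obtain ⟨κ, hκ, hκre⟩ := exists_sq_eq_re_pos hz
  have hκ0 : κ ≠ 0 := fun h => by simp [h] at hκre
  have hd : ∀ (a : ℂ) (x : ℝ), HasDerivWithinAt (fun x : ℝ => a * Complex.exp (-κ * x))
      (a * -κ * Complex.exp (-κ * x)) (Ici 0) x := fun a x => by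
    have h := ((((hasDerivAt_id x).ofReal_comp).const_mul (-κ)).cexp.const_mul a).hasDerivWithinAt
      (s := Ici 0)
    convert! h using 1
    simp only [id, Complex.ofReal_one]
    ring
  have hint : ∀ a : ℂ, IntegrableOn (fun x : ℝ => ‖a * Complex.exp (-κ * x)‖ ^ 2) (Ioi 0) := by
    intro a
    have h1 : ∀ x : ℝ, ‖a * Complex.exp (-κ * x)‖ ^ 2 =
        ‖a‖ ^ 2 * Real.exp (-(2 * κ.re) * x) := fun x => by
      rw [norm_mul, mul_pow, Complex.norm_exp, ← Real.exp_nat_mul]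
      congr 2
      simp
      ring
    simp only [h1]
    exact (integrableOn_exp_neg_mul (by positivity)).const_mul _
  refine ⟨fun x => -κ⁻¹ * Complex.exp (-κ * x), fun x => 1 * Complex.exp (-κ * x),
    fun x => 1 * -κ * Complex.exp (-κ * x), fun x _ => ?_, fun x _ => hd 1 x, by fun_prop,
    hint _, hint _, hint _, ?_, by simp, fun x _ => ?_⟩
  · have h := hd (-κ⁻¹) x
    rwa [neg_mul_neg, inv_mul_cancel₀ hκ0] at h
  · simpa only [Real.rpow_zero, one_mul] using hint (-κ⁻¹)
  · rw [Real.rpow_zero, Complex.ofReal_one]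
    field_simp
    linear_combination Complex.exp (-(κ * x)) * hκ

end Assembly

/-- Existence of an `L²` (together with its derivatives and the weighted term) solution of
`-F'' + i x^β F - η F = 0` on `[0,∞)` with `F'(0) = 1`, for `|η| < c`, where `c > 0` is a
constant for which the spectral inequality
`c ∫₀^∞|u|² ≤ ∫₀^∞|u'|² + ∫₀^∞ x^β|u|²` holds. -/
theorem stmt_1 (β : ℝ) (hβ : 0 ≤ β) (c : ℝ) (hc : 0 < c)
    (hspec : ∀ u u' : ℝ → ℂ,
        (∀ x ∈ Ici (0:ℝ), HasDerivWithinAt u (u' x) (Ici 0) x) →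
        ContinuousOn u' (Ici 0) →
        IntegrableOn (fun x => ‖u x‖ ^ 2) (Ioi 0) →
        IntegrableOn (fun x => ‖u' x‖ ^ 2) (Ioi 0) →
        ENNReal.ofReal c * (∫⁻ x in Ioi (0:ℝ), ENNReal.ofReal (‖u x‖ ^ 2)) ≤
          (∫⁻ x in Ioi (0:ℝ), ENNReal.ofReal (‖u' x‖ ^ 2)) +
            ∫⁻ x in Ioi (0:ℝ), ENNReal.ofReal (x ^ β * ‖u x‖ ^ 2))
    (η : ℂ) (hη : ‖η‖ < c) :
    ∃ F F' F'' : ℝ → ℂ,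
      (∀ x ∈ Ici (0:ℝ), HasDerivWithinAt F (F' x) (Ici 0) x) ∧
      (∀ x ∈ Ici (0:ℝ), HasDerivWithinAt F' (F'' x) (Ici 0) x) ∧
      ContinuousOn F'' (Ici 0) ∧
      IntegrableOn (fun x => ‖F x‖ ^ 2) (Ioi 0) ∧
      IntegrableOn (fun x => ‖F' x‖ ^ 2) (Ioi 0) ∧
      IntegrableOn (fun x => ‖F'' x‖ ^ 2) (Ioi 0) ∧
      IntegrableOn (fun x => x ^ β * ‖F x‖ ^ 2) (Ioi 0) ∧
      F' 0 = 1 ∧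
      ∀ x : ℝ, 0 ≤ x →
        -F'' x + Complex.I * ((x ^ β : ℝ) : ℂ) * F x - η * F x = 0 := by
  rcases hβ.eq_or_lt with rfl | hβ
  · simp only [Real.rpow_zero, one_mul] at hspec
    exact exists_exponential_solution (hη.trans_le (le_one_of_spectral_inequality hspec))
  obtain ⟨μ, k, W, W', F, F', hμ, hk, hW, hF, hWint, hWint', hFint, hFint', hF0, x₀, hx₀, hne⟩ :=
    exists_rotated_halfLineSolution hβ η
  have hWint0 := hWint 0 le_rfl
  simp only [Real.rpow_zero, one_mul] at hWint0
  have hW0 := deriv_zero_ne_zero_of_halfLineSolution hspec (hμ.trans_lt hη) hW hWint0 hWint'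
    (hWint β hβ.le) hx₀ hne
  exact exists_normalized_of_halfLineSolution hβ.le hF hFint hFint' (hF0 ▸ mul_ne_zero hk hW0)
end

section
/- Let c > 0 be a constant such that c·∫₀^∞|u|² ≤ ∫₀^∞|u'|² + ∫₀^∞ x^β|u|² for every continuously differentiable u : [0,∞) → ℂ with u, u' square-integrable. If η ∈ ℂ with |η| < c and F : [0,∞) → ℂ is twice continuously differentiable with F, F', F'' square-integrable on (0,∞), F'(0) = 0, and −F''(x) + i x^β F(x) − η F(x) = 0 for all x ≥ 0, then F is identically zero. (Consequently the solution normalized by F'(0) = 1 is unique.) -/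
open MeasureTheory Set

/-- Coefficients of the generalized power series of the Neumann solution. -/
noncomputable def neumannCoeff (γ : ℝ) (η : ℂ) : ℕ → ℕ → ℂ
  | 0, 0 => 1
  | 0, k + 1 =>
    (Complex.I * neumannCoeff γ η 0 k) / (((γ * (k + 1)) * (γ * (k + 1) - 1) : ℝ) : ℂ)
  | j + 1, 0 =>
    (-η * neumannCoeff γ η j 0) / (((2 * (j + 1)) * (2 * (j + 1) - 1) : ℝ) : ℂ)
  | j + 1, k + 1 =>
    (Complex.I * neumannCoeff γ η (j + 1) k - η * neumannCoeff γ η j (k + 1)) /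
      (((2 * (j + 1) + γ * (k + 1)) * (2 * (j + 1) + γ * (k + 1) - 1) : ℝ) : ℂ)
  termination_by j k => j + k

/-- The exponent attached to the index pair `p`. -/
def expo (γ : ℝ) (p : ℕ × ℕ) : ℝ := 2 * p.1 + γ * p.2

/-- `neumannCoeff` shifted by one in the second index. -/
noncomputable def shiftSnd (γ : ℝ) (η : ℂ) : ℕ × ℕ → ℂ
  | (_, 0) => 0
  | (j, k + 1) => neumannCoeff γ η j k

/-- `neumannCoeff` shifted by one in the first index. -/
noncomputable def shiftFst (γ : ℝ) (η : ℂ) : ℕ × ℕ → ℂ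
  | (0, _) => 0
  | (j + 1, k) => neumannCoeff γ η j k

lemma two_mul_add_le_expo {γ : ℝ} (hγ : 2 ≤ γ) (j k : ℕ) :
    2 * ((j + k : ℕ) : ℝ) ≤ expo γ (j, k) := by
  have : (0 : ℝ) ≤ k := Nat.cast_nonneg k
  simp only [expo]
  push_cast
  nlinarith

lemma expo_mul_coeff {γ : ℝ} (hγ : 2 ≤ γ) (η : ℂ) (p : ℕ × ℕ) :
    (expo γ p * (expo γ p - 1)) * neumannCoeff γ η p.1 p.2 =
      Complex.I * shiftSnd γ η p - η * shiftFst γ η p := by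
  obtain ⟨j, k⟩ := p
  have hne : 1 ≤ j + k → ((expo γ (j, k) : ℂ) * (expo γ (j, k) - 1)) ≠ 0 := by
    intro h
    have h1 := two_mul_add_le_expo hγ j k
    have h2 : (1 : ℝ) ≤ ((j + k : ℕ) : ℝ) := by exact_mod_cast h
    have : expo γ (j, k) * (expo γ (j, k) - 1) ≠ 0 :=
      (mul_pos (by linarith) (by linarith)).ne'
    exact_mod_cast this
  rcases j with _ | j <;> rcases k with _ | k
  · simp [expo, shiftFst, shiftSnd]
  all_goals
    have h := hne (by omega)
    simp only [neumannCoeff, shiftFst, shiftSnd]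
    simp only [expo] at h ⊢
    push_cast at h ⊢
    try simp only [mul_zero, add_zero, zero_add] at h ⊢
    rw [mul_div_cancel₀ _ h]
    try ring

lemma norm_neumannCoeff_le {γ : ℝ} (hγ : 2 ≤ γ) (η : ℂ) (n : ℕ) :
    ∀ j k : ℕ, j + k = n →
      ‖neumannCoeff γ η j k‖ ≤ (1 + ‖η‖) ^ n / ((2 * n).factorial : ℝ) := by
  induction n with
  | zero =>
    intro j k h
    obtain ⟨rfl, rfl⟩ : j = 0 ∧ k = 0 := by omega
    simp [neumannCoeff]
  | succ n ih =>
    intro j k h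
    have hrec := congrArg norm (expo_mul_coeff hγ η (j, k))
    have hx := two_mul_add_le_expo hγ j k
    rw [h] at hx
    set x := expo γ (j, k)
    set B := (1 + ‖η‖) ^ n / ((2 * n).factorial : ℝ) with hB
    have hB0 : 0 ≤ B := by positivity
    have h1 : ‖shiftSnd γ η (j, k)‖ ≤ B := by
      rcases k with _ | k
      · simpa [shiftSnd] using hB0
      · exact ih j k (by omega)
    have h2 : ‖shiftFst γ η (j, k)‖ ≤ B := by
      rcases j with _ | j
      · simpa [shiftFst] using hB0
      · exact ih j k (by omega)
    have hn : (0 : ℝ) ≤ n := Nat.cast_nonneg n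
    push_cast at hx
    have hx2 : (2 * (n : ℝ) + 2) * (2 * n + 1) ≤ x * (x - 1) := by nlinarith
    have hnx : ‖(x : ℂ) * (x - 1)‖ = x * (x - 1) := by
      rw [← Complex.ofReal_one, ← Complex.ofReal_sub, ← Complex.ofReal_mul, Complex.norm_real,
        Real.norm_of_nonneg (by nlinarith)]
    have hle : x * (x - 1) * ‖neumannCoeff γ η j k‖ ≤ (1 + ‖η‖) * B := by
      rw [norm_mul, hnx] at hrec
      rw [hrec]
      calc _ ≤ ‖Complex.I * shiftSnd γ η (j, k)‖ + ‖η * shiftFst γ η (j, k)‖ := norm_sub_le _ _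
        _ ≤ B + ‖η‖ * B := by
          rw [norm_mul, norm_mul, Complex.norm_I, one_mul]
          gcongr
        _ = _ := by ring
    have hfac : ((2 * (n + 1)).factorial : ℝ) =
        (2 * (n : ℝ) + 2) * (2 * n + 1) * (2 * n).factorial := by
      rw [show 2 * (n + 1) = 2 * n + 1 + 1 by ring, Nat.factorial_succ, Nat.factorial_succ]
      push_cast
      ring
    rw [hfac, le_div_iff₀ (by positivity)]
    have hBf : B * (2 * n).factorial = (1 + ‖η‖) ^ n := by
      rw [hB]; field_simp
    calc _ = ((2 * (n : ℝ) + 2) * (2 * n + 1) * ‖neumannCoeff γ η j k‖) * (2 * n).factorial := by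
          ring
      _ ≤ (x * (x - 1) * ‖neumannCoeff γ η j k‖) * (2 * n).factorial := by gcongr
      _ ≤ ((1 + ‖η‖) * B) * (2 * n).factorial := by gcongr
      _ = _ := by rw [mul_assoc, hBf]; ring

/-- Dominating sequence for the series, on the half-plane `re s ≤ X`. -/
noncomputable def majorant (γ : ℝ) (η : ℂ) (X : ℝ) (p : ℕ × ℕ) : ℝ :=
  (√(1 + ‖η‖) * Real.exp X) ^ (2 * p.1) / ((2 * p.1).factorial : ℝ) *
    ((√(1 + ‖η‖) * Real.exp (γ / 2 * X)) ^ (2 * p.2) / ((2 * p.2).factorial : ℝ))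

lemma hasSum_majorant (γ : ℝ) (η : ℂ) (X : ℝ) :
    HasSum (majorant γ η X) (Real.cosh (√(1 + ‖η‖) * Real.exp X) *
      Real.cosh (√(1 + ‖η‖) * Real.exp (γ / 2 * X))) := by
  have h1 := Real.hasSum_cosh (√(1 + ‖η‖) * Real.exp X)
  have h2 := Real.hasSum_cosh (√(1 + ‖η‖) * Real.exp (γ / 2 * X))
  exact h1.mul h2 (h1.summable.mul_of_nonneg h2.summable
    (fun n => by positivity) (fun n => by positivity))

lemma norm_coeff_mul_exp_le {γ : ℝ} (hγ : 2 ≤ γ) (η : ℂ) (X : ℝ) (p : ℕ × ℕ) :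
    ‖neumannCoeff γ η p.1 p.2‖ * Real.exp (expo γ p * X) ≤ majorant γ η X p := by
  obtain ⟨j, k⟩ := p
  have h := norm_neumannCoeff_le hγ η (j + k) j k rfl
  have hfac : ((2 * j).factorial : ℝ) * (2 * k).factorial ≤ (2 * (j + k)).factorial := by
    have := Nat.le_of_dvd (Nat.factorial_pos _)
      (Nat.factorial_mul_factorial_dvd_factorial_add (2 * j) (2 * k))
    rw [← mul_add] at this
    exact_mod_cast this
  have hexp : Real.exp (expo γ (j, k) * X) =
      Real.exp X ^ (2 * j) * Real.exp (γ / 2 * X) ^ (2 * k) := by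
    rw [← Real.exp_nat_mul, ← Real.exp_nat_mul, ← Real.exp_add]
    congr 1
    simp only [expo]
    push_cast
    ring
  have hsq : √(1 + ‖η‖) ^ 2 = 1 + ‖η‖ := Real.sq_sqrt (by positivity)
  simp only [majorant]
  rw [mul_pow, mul_pow, pow_mul √(1 + ‖η‖), pow_mul √(1 + ‖η‖), hsq, hexp]
  calc _ ≤ (1 + ‖η‖) ^ (j + k) / ((2 * j).factorial * (2 * k).factorial : ℝ) *
        (Real.exp X ^ (2 * j) * Real.exp (γ / 2 * X) ^ (2 * k)) := by
        gcongr
        exact h.trans (by gcongr)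
    _ = _ := by
        rw [pow_add]
        field_simp

/-- The Neumann solution in the logarithmic variable. -/
noncomputable def neumannSol (γ : ℝ) (η : ℂ) (s : ℂ) : ℂ :=
  ∑' p : ℕ × ℕ, neumannCoeff γ η p.1 p.2 * Complex.exp (expo γ p * s)

lemma norm_exp_ofReal_mul (x : ℝ) (s : ℂ) : ‖Complex.exp (x * s)‖ = Real.exp (x * s.re) := by
  rw [Complex.norm_exp, Complex.re_ofReal_mul]

lemma expo_nonneg {γ : ℝ} (hγ : 2 ≤ γ) (p : ℕ × ℕ) : 0 ≤ expo γ p :=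
  le_trans (by positivity) (two_mul_add_le_expo hγ p.1 p.2)

lemma norm_term_le {γ : ℝ} (hγ : 2 ≤ γ) (η : ℂ) {X : ℝ} {s : ℂ} (hs : s.re ≤ X) (p : ℕ × ℕ) :
    ‖neumannCoeff γ η p.1 p.2 * Complex.exp (expo γ p * s)‖ ≤ majorant γ η X p := by
  rw [norm_mul, norm_exp_ofReal_mul]
  refine le_trans ?_ (norm_coeff_mul_exp_le hγ η X p)
  have := expo_nonneg hγ p
  gcongr

lemma norm_expo_term_le {γ : ℝ} (hγ : 2 ≤ γ) (η : ℂ) {X : ℝ} {s : ℂ} (hs : s.re ≤ X) (p : ℕ × ℕ) :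
    ‖neumannCoeff γ η p.1 p.2 * expo γ p * Complex.exp (expo γ p * s)‖ ≤
      majorant γ η (X + 1) p := by
  rw [norm_mul, norm_mul, norm_exp_ofReal_mul, Complex.norm_real]
  refine le_trans ?_ (norm_coeff_mul_exp_le hγ η (X + 1) p)
  have h0 := expo_nonneg hγ p
  rw [Real.norm_of_nonneg h0, mul_add, Real.exp_add, mul_assoc, mul_comm (expo γ p)]
  have : expo γ p ≤ Real.exp (expo γ p * 1) := by
    rw [mul_one]; linarith [Real.add_one_le_exp (expo γ p)]
  gcongr

lemma isOpen_re_lt (X : ℝ) : IsOpen {s : ℂ | s.re < X} :=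
  isOpen_lt Complex.continuous_re continuous_const

/-- The derivative of `neumannSol`. -/
noncomputable def neumannSolDeriv (γ : ℝ) (η : ℂ) (s : ℂ) : ℂ :=
  ∑' p : ℕ × ℕ, neumannCoeff γ η p.1 p.2 * expo γ p * Complex.exp (expo γ p * s)

lemma hasDerivAt_tsum_exp {ι : Type*} {a : ι → ℂ} {x : ι → ℝ} {b : ℝ → ι → ℝ}
    (hb : ∀ X, Summable (b X))
    (hab : ∀ X (s : ℂ), s.re ≤ X → ∀ i, ‖a i * Complex.exp (x i * s)‖ ≤ b X i) (s : ℂ) :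
    HasDerivAt (fun s => ∑' i, a i * Complex.exp (x i * s))
      (∑' i, a i * x i * Complex.exp (x i * s)) s := by
  have hd : ∀ i, Differentiable ℂ (fun s : ℂ => a i * Complex.exp (x i * s)) := by
    intro i; fun_prop
  have hmem : s ∈ {w : ℂ | w.re < s.re + 1} := by simp
  have h1 := Complex.differentiableOn_tsum_of_summable_norm (hb (s.re + 1))
    (fun i => (hd i).differentiableOn) (isOpen_re_lt (s.re + 1))
    (fun i w hw => hab _ w (le_of_lt hw) i)
  have h2 := Complex.hasSum_deriv_of_summable_norm (hb (s.re + 1))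
    (fun i => (hd i).differentiableOn) (isOpen_re_lt (s.re + 1))
    (fun i w hw => hab _ w (le_of_lt hw) i) hmem
  have h3 := (h1.differentiableAt ((isOpen_re_lt _).mem_nhds hmem)).hasDerivAt
  rw [← h2.tsum_eq] at h3
  refine h3.congr_deriv (tsum_congr fun i => ?_)
  have : HasDerivAt (fun s : ℂ => a i * Complex.exp (x i * s))
      (a i * (Complex.exp (x i * s) * (x i * 1))) s :=
    (((hasDerivAt_id s).const_mul (x i : ℂ)).cexp).const_mul (a i)
  rw [this.deriv]
  ring

lemma hasDerivAt_neumannSol {γ : ℝ} (hγ : 2 ≤ γ) (η : ℂ) (s : ℂ) :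
    HasDerivAt (neumannSol γ η) (neumannSolDeriv γ η s) s :=
  hasDerivAt_tsum_exp (fun X => (hasSum_majorant γ η X).summable)
    (fun _ _ hs p => norm_term_le hγ η hs p) s

lemma hasSum_neumannSol {γ : ℝ} (hγ : 2 ≤ γ) (η : ℂ) (s : ℂ) :
    HasSum (fun p : ℕ × ℕ => neumannCoeff γ η p.1 p.2 * Complex.exp (expo γ p * s))
      (neumannSol γ η s) :=
  (Summable.of_norm_bounded (hasSum_majorant γ η s.re).summable
    (fun p => norm_term_le hγ η le_rfl p)).hasSum

lemma hasDerivAt_neumannSolDeriv {γ : ℝ} (hγ : 2 ≤ γ) (η : ℂ) (s : ℂ) :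
    HasDerivAt (neumannSolDeriv γ η) (neumannSolDeriv γ η s +
      (Complex.I * Complex.exp (γ * s) - η * Complex.exp (2 * s)) * neumannSol γ η s) s := by
  have h := hasDerivAt_tsum_exp (x := expo γ)
    (a := fun p : ℕ × ℕ => neumannCoeff γ η p.1 p.2 * expo γ p)
    (fun X => (hasSum_majorant γ η (X + 1)).summable)
    (fun _ _ hs p => norm_expo_term_le hγ η hs p) s
  refine h.congr_deriv ?_
  have hD : HasSum (fun p : ℕ × ℕ => neumannCoeff γ η p.1 p.2 * expo γ p *
      Complex.exp (expo γ p * s)) (neumannSolDeriv γ η s) :=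
    (Summable.of_norm_bounded (hasSum_majorant γ η (s.re + 1)).summable
      (fun p => norm_expo_term_le hγ η le_rfl p)).hasSum
  have hS := hasSum_neumannSol hγ η s
  have h1 : HasSum (fun p => shiftSnd γ η p * Complex.exp (expo γ p * s))
      (Complex.exp (γ * s) * neumannSol γ η s) := by
    have hinj : Function.Injective (fun p : ℕ × ℕ => (p.1, p.2 + 1)) := by
      rintro ⟨a, b⟩ ⟨c, d⟩ h
      simpa using h
    refine (hinj.hasSum_iff ?_).1 ?_
    · rintro ⟨j, k⟩ hk
      rcases k with _ | k
      · simp [shiftSnd]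
      · exact absurd ⟨(j, k), rfl⟩ hk
    · refine (hS.mul_left (Complex.exp (γ * s))).congr_fun ?_
      rintro ⟨j, k⟩
      simp only [Function.comp, shiftSnd]
      rw [mul_left_comm, ← Complex.exp_add]
      congr 2
      simp only [expo]
      push_cast
      ring
  have h2 : HasSum (fun p => shiftFst γ η p * Complex.exp (expo γ p * s))
      (Complex.exp (2 * s) * neumannSol γ η s) := by
    have hinj : Function.Injective (fun p : ℕ × ℕ => (p.1 + 1, p.2)) := by
      rintro ⟨a, b⟩ ⟨c, d⟩ h
      simpa using h
    refine (hinj.hasSum_iff ?_).1 ?_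
    · rintro ⟨j, k⟩ hk
      rcases j with _ | j
      · simp [shiftFst]
      · exact absurd ⟨(j, k), rfl⟩ hk
    · refine (hS.mul_left (Complex.exp (2 * s))).congr_fun ?_
      rintro ⟨j, k⟩
      simp only [Function.comp, shiftFst]
      rw [mul_left_comm, ← Complex.exp_add]
      congr 2
      simp only [expo]
      push_cast
      ring
  have h3 := hD.add ((h1.mul_left Complex.I).sub (h2.mul_left η))
  refine Eq.trans (Eq.trans (tsum_congr fun p => ?_) h3.tsum_eq) ?_
  · linear_combination (Complex.exp (expo γ p * s)) * expo_mul_coeff hγ η p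
  · ring

lemma norm_neumannSol_le {γ : ℝ} (hγ : 2 ≤ γ) (η : ℂ) (s : ℂ) :
    ‖neumannSol γ η s‖ ≤
      Real.exp (2 * √(1 + ‖η‖) * (1 + Real.exp (γ / 2 * s.re))) := by
  have hcosh : ∀ y : ℝ, 0 ≤ y → Real.cosh y ≤ Real.exp y := by
    intro y hy
    rw [Real.cosh_eq]
    have : Real.exp (-y) ≤ Real.exp y := Real.exp_le_exp.2 (by linarith)
    linarith
  have h1 : ‖neumannSol γ η s‖ ≤ _ := tsum_of_norm_bounded (hasSum_majorant γ η s.re)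
    (fun p => norm_term_le hγ η le_rfl p)
  refine h1.trans ((mul_le_mul (hcosh _ (by positivity)) (hcosh _ (by positivity))
    (Real.cosh_pos _).le (Real.exp_pos _).le).trans ?_)
  rw [← Real.exp_add]
  refine Real.exp_le_exp.2 ?_
  have hX : Real.exp s.re ≤ 1 + Real.exp (γ / 2 * s.re) := by
    rcases le_total s.re 0 with h | h
    · have := Real.exp_le_one_iff.2 h
      have := Real.exp_pos (γ / 2 * s.re)
      linarith
    · have : Real.exp s.re ≤ Real.exp (γ / 2 * s.re) := Real.exp_le_exp.2 (by nlinarith)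
      linarith
  have hK := Real.sqrt_nonneg (1 + ‖η‖)
  nlinarith

/-- The rotated momentum `Re ((1 - i) G' conj G)`. -/
noncomputable def rotMomentum (G G' : ℝ → ℂ) (r : ℝ) : ℝ :=
  ((1 - Complex.I) * (G' r * (starRingEnd ℂ) (G r))).re

lemma abs_rotMomentum_le (G G' : ℝ → ℂ) (r : ℝ) :
    |rotMomentum G G' r| ≤ 2 * (‖G' r‖ * ‖G r‖) := by
  have h : ‖(1 - Complex.I : ℂ)‖ ≤ 2 := by
    refine (norm_sub_le _ _).trans ?_
    simp
    norm_num
  refine (Complex.abs_re_le_norm _).trans ?_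
  rw [norm_mul, norm_mul, Complex.norm_conj]
  gcongr

lemma hasDerivAt_rotMomentum {G G' : ℝ → ℂ} {q : ℂ} {r : ℝ} (h1 : HasDerivAt G (G' r) r)
    (h2 : HasDerivAt G' (q * G r) r) :
    HasDerivAt (rotMomentum G G')
      (‖G' r‖ ^ 2 + ((1 - Complex.I) * q).re * ‖G r‖ ^ 2) r := by
  have h3 : HasDerivAt (fun r => (starRingEnd ℂ) (G r)) ((starRingEnd ℂ) (G' r)) r := by
    simpa using h1.star
  have h4 := (h2.mul h3).const_mul (1 - Complex.I)
  have h5 := Complex.reCLM.hasFDerivAt.comp_hasDerivAt r h4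
  refine h5.congr_deriv ?_
  rw [← Complex.normSq_eq_norm_sq, ← Complex.normSq_eq_norm_sq, Complex.normSq_apply,
    Complex.normSq_apply]
  simp
  ring

lemma monotoneOn_Ici_of_hasDerivAt {g g' : ℝ → ℝ} {R : ℝ}
    (h : ∀ r, R ≤ r → HasDerivAt g (g' r) r) (h0 : ∀ r, R ≤ r → 0 ≤ g' r) :
    MonotoneOn g (Ici R) := by
  refine monotoneOn_of_deriv_nonneg (convex_Ici R)
    (fun r hr => (h r hr).continuousAt.continuousWithinAt)
    (fun r hr => (h r (interior_subset hr)).differentiableAt.differentiableWithinAt)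
    (fun r hr => ?_)
  rw [(h r (interior_subset hr)).deriv]
  exact h0 r (interior_subset hr)

/-- A solution of `G'' = q G` on `[R, ∞)`, where `q` has the size of `r ^ β` in the direction
dual to `1 - i`. -/
structure RaySolution (β R : ℝ) (G G' : ℝ → ℂ) (q : ℝ → ℂ) : Prop where
  one_le : 1 ≤ R
  exponent_nonneg : 0 ≤ β
  hasDerivAt : ∀ r, R ≤ r → HasDerivAt G (G' r) r
  hasDerivAt_deriv : ∀ r, R ≤ r → HasDerivAt G' (q r * G r) r
  le_re : ∀ r, R ≤ r → r ^ β / 2 ≤ ((1 - Complex.I) * q r).re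

namespace RaySolution

variable {β R : ℝ} {G G' : ℝ → ℂ} {q : ℝ → ℂ}

lemma deriv_ge (h : RaySolution β R G G' q) {r : ℝ} (hr : R ≤ r) :
    (‖G' r‖ ^ 2 + r ^ β * ‖G r‖ ^ 2) / 2 ≤
      ‖G' r‖ ^ 2 + ((1 - Complex.I) * q r).re * ‖G r‖ ^ 2 := by
  have h1 := mul_le_mul_of_nonneg_right (h.le_re r hr) (sq_nonneg ‖G r‖)
  nlinarith [sq_nonneg ‖G' r‖]

lemma one_le_rpow (h : RaySolution β R G G' q) {r : ℝ} (hr : R ≤ r) : 1 ≤ r ^ β :=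
  Real.one_le_rpow (h.one_le.trans hr) h.exponent_nonneg

lemma half_normSq_le (h : RaySolution β R G G' q) {r : ℝ} (hr : R ≤ r) :
    (‖G' r‖ ^ 2 + ‖G r‖ ^ 2) / 2 ≤
      ‖G' r‖ ^ 2 + ((1 - Complex.I) * q r).re * ‖G r‖ ^ 2 := by
  refine le_trans ?_ (h.deriv_ge hr)
  nlinarith [h.one_le_rpow hr, sq_nonneg ‖G r‖]

lemma hasDerivAt_momentum (h : RaySolution β R G G' q) {r : ℝ} (hr : R ≤ r) :
    HasDerivAt (rotMomentum G G')
      (‖G' r‖ ^ 2 + ((1 - Complex.I) * q r).re * ‖G r‖ ^ 2) r :=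
  hasDerivAt_rotMomentum (h.hasDerivAt r hr) (h.hasDerivAt_deriv r hr)

lemma monotoneOn_momentum (h : RaySolution β R G G' q) :
    MonotoneOn (rotMomentum G G') (Ici R) :=
  monotoneOn_Ici_of_hasDerivAt (fun _ hr => h.hasDerivAt_momentum hr)
    (fun _ hr => le_trans (by positivity) (h.half_normSq_le hr))

lemma momentum_nonpos (h : RaySolution β R G G' q) {C : ℝ}
    (hC : ∀ r, R ≤ r → ‖G r‖ ≤ C) {r : ℝ} (hr : R ≤ r) : rotMomentum G G' r ≤ 0 := by
  by_contra! hpos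
  have hC0 : 0 ≤ C := (norm_nonneg _).trans (hC r hr)
  set D := C + 1
  have hD : 0 < D := by positivity
  have hP : ∀ x, r ≤ x → 0 < rotMomentum G G' x := fun x hx =>
    hpos.trans_le (h.monotoneOn_momentum hr (hr.trans hx) hx)
  have hmono : MonotoneOn (fun x => -(rotMomentum G G' x)⁻¹ - x / (8 * D ^ 2)) (Ici r) := by
    refine monotoneOn_Ici_of_hasDerivAt (fun x hx =>
      ((h.hasDerivAt_momentum (hr.trans hx)).inv (hP x hx).ne').neg.sub
        ((hasDerivAt_id x).div_const _)) (fun x hx => ?_)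
    have h1 := h.half_normSq_le (hr.trans hx)
    have h2 := (le_abs_self _).trans (abs_rotMomentum_le G G' x)
    have h3 : ‖G x‖ ≤ D := (hC x (hr.trans hx)).trans (by simp [D])
    have h4 : rotMomentum G G' x ≤ 2 * D * ‖G' x‖ := by
      nlinarith [norm_nonneg (G' x)]
    have h5 : rotMomentum G G' x ^ 2 ≤ (2 * D * ‖G' x‖) ^ 2 :=
      pow_le_pow_left₀ (hP x hx).le h4 2
    rw [neg_div, neg_neg, sub_nonneg, div_le_div_iff₀ (by positivity) (pow_pos (hP x hx) 2)]
    have h6 : 4 * D ^ 2 * ‖G' x‖ ^ 2 ≤ 8 * D ^ 2 * (‖G' x‖ ^ 2 +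
        ((1 - Complex.I) * q x).re * ‖G x‖ ^ 2) := by
      nlinarith [sq_nonneg ‖G x‖, sq_nonneg D]
    nlinarith
  set y := r + 8 * D ^ 2 * (rotMomentum G G' r)⁻¹ with hy
  have hinv : 0 < (rotMomentum G G' r)⁻¹ := inv_pos.2 hpos
  have hry : r ≤ y := by
    have : 0 ≤ 8 * D ^ 2 * (rotMomentum G G' r)⁻¹ := by positivity
    linarith
  have h1 := hmono (mem_Ici.2 le_rfl) hry hry
  have h2 : y / (8 * D ^ 2) = r / (8 * D ^ 2) + (rotMomentum G G' r)⁻¹ := by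
    rw [hy]; field_simp
  have h3 := inv_pos.2 (hP y hry)
  simp only at h1
  linarith

lemma norm_sq_le (h : RaySolution β R G G' q)
    (hP : ∀ r, R ≤ r → rotMomentum G G' r ≤ 0) {r : ℝ} (hr : R ≤ r) :
    ‖G r‖ ^ 2 ≤ -(2 * rotMomentum G G' r) := by
  by_contra! hpos
  have hsq : ∀ x, R ≤ x → HasDerivAt (fun x => ‖G x‖ ^ 2)
      (2 * inner ℝ (G x) (G' x)) x := fun x hx => (h.hasDerivAt x hx).norm_sq
  have hmono : MonotoneOn (fun x => ‖G x‖ ^ 2 + 2 * rotMomentum G G' x) (Ici R) := by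
    refine monotoneOn_Ici_of_hasDerivAt (fun x hx =>
      (hsq x hx).add ((h.hasDerivAt_momentum hx).const_mul 2)) (fun x hx => ?_)
    have h1 := h.half_normSq_le hx
    have h2 := (abs_le.1 (abs_real_inner_le_norm (G x) (G' x))).1
    nlinarith [sq_nonneg (‖G x‖ - ‖G' x‖)]
  set δ := ‖G r‖ ^ 2 + 2 * rotMomentum G G' r with hδ
  have hδ0 : 0 < δ := by linarith
  have hlow : ∀ x, r ≤ x → δ ≤ ‖G x‖ ^ 2 := by
    intro x hx
    have h1 := hmono hr (hr.trans hx) hx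
    have h2 := hP x (hr.trans hx)
    simp only at h1
    linarith
  have hmono2 : MonotoneOn (fun x => rotMomentum G G' x - x * (δ / 2)) (Ici r) := by
    refine monotoneOn_Ici_of_hasDerivAt (fun x hx =>
      (h.hasDerivAt_momentum (hr.trans hx)).sub
        ((hasDerivAt_id x).mul_const (δ / 2))) (fun x hx => ?_)
    have h1 := h.half_normSq_le (hr.trans hx)
    have h2 := hlow x hx
    nlinarith [sq_nonneg ‖G' x‖]
  set y := r + (1 - rotMomentum G G' r) * (2 / δ) with hy
  have hry : r ≤ y := by
    have : 0 ≤ (1 - rotMomentum G G' r) * (2 / δ) :=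
      mul_nonneg (by linarith [hP r hr]) (by positivity)
    linarith
  have h1 := hmono2 (mem_Ici.2 le_rfl) hry hry
  have h2 : y * (δ / 2) = r * (δ / 2) + (1 - rotMomentum G G' r) := by
    rw [hy]; field_simp
  have h3 := hP y (hr.trans hry)
  simp only at h1
  linarith

lemma neg_momentum_le (h : RaySolution β R G G' q) {r : ℝ} (hr : R ≤ r) :
    -rotMomentum G G' r ≤ -rotMomentum G G' R *
      Real.exp (R ^ (β / 2 + 1) / (2 * (β / 2 + 1))) *
      Real.exp (-(r ^ (β / 2 + 1) / (2 * (β / 2 + 1)))) := by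
  have hβ := h.exponent_nonneg
  have hd : ∀ x, R ≤ x → HasDerivAt
      (fun x => Real.exp (x ^ (β / 2 + 1) / (2 * (β / 2 + 1))))
      (Real.exp (x ^ (β / 2 + 1) / (2 * (β / 2 + 1))) * (x ^ (β / 2) / 2)) x := by
    intro x hx
    have hx0 : 0 < x := by linarith [h.one_le]
    have := ((Real.hasDerivAt_rpow_const (x := x) (p := β / 2 + 1)
      (Or.inl hx0.ne')).div_const (2 * (β / 2 + 1))).exp
    refine this.congr_deriv ?_
    rw [add_sub_cancel_right]
    field_simp
  have hmono : MonotoneOn (fun x => rotMomentum G G' x *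
      Real.exp (x ^ (β / 2 + 1) / (2 * (β / 2 + 1)))) (Ici R) := by
    refine monotoneOn_Ici_of_hasDerivAt (fun x hx =>
      (h.hasDerivAt_momentum hx).mul (hd x hx)) (fun x hx => ?_)
    have hx0 : 0 ≤ x := by linarith [h.one_le]
    have h1 := h.deriv_ge hx
    have h2 := (abs_le.1 (abs_rotMomentum_le G G' x)).1
    have h3 : x ^ β = (x ^ (β / 2)) ^ 2 := by
      rw [← Real.rpow_natCast, ← Real.rpow_mul hx0]; congr 1; push_cast; ring
    rw [h3] at h1
    have h4 : 0 ≤ x ^ (β / 2) := Real.rpow_nonneg hx0 _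
    set E := Real.exp (x ^ (β / 2 + 1) / (2 * (β / 2 + 1)))
    have hE : 0 < E := Real.exp_pos _
    set D := ‖G' x‖ ^ 2 + ((1 - Complex.I) * q x).re * ‖G x‖ ^ 2
    have h5 : 0 ≤ D + rotMomentum G G' x * (x ^ (β / 2) / 2) := by
      have h6 : -(2 * (‖G' x‖ * ‖G x‖)) * (x ^ (β / 2) / 2) ≤
        rotMomentum G G' x * (x ^ (β / 2) / 2) := by gcongr
      nlinarith [sq_nonneg (‖G' x‖ - x ^ (β / 2) * ‖G x‖)]
    have : 0 ≤ E * (D + rotMomentum G G' x * (x ^ (β / 2) / 2)) := by positivity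
    linarith
  have h1 := hmono (mem_Ici.2 le_rfl) hr hr
  simp only at h1
  rw [Real.exp_neg, ← div_eq_mul_inv, le_div_iff₀ (Real.exp_pos _)]
  linarith

/-- A bounded solution decays superexponentially. -/
lemma exists_decay (h : RaySolution β R G G' q) {C : ℝ} (hC : ∀ r, R ≤ r → ‖G r‖ ≤ C) :
    ∃ M, ∀ r, R ≤ r → ‖G r‖ ≤ M * Real.exp (-(r ^ (β / 2 + 1) / (4 * (β / 2 + 1)))) := by
  have hP : ∀ r, R ≤ r → rotMomentum G G' r ≤ 0 := fun r hr => h.momentum_nonpos hC hr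
  have hβ := h.exponent_nonneg
  set K := 2 * (-rotMomentum G G' R * Real.exp (R ^ (β / 2 + 1) / (2 * (β / 2 + 1)))) with hK
  have hK0 : 0 ≤ K := by
    have := hP R le_rfl
    have : 0 ≤ -rotMomentum G G' R := by linarith
    positivity
  refine ⟨√K, fun r hr => ?_⟩
  have h1 := h.norm_sq_le hP hr
  have h2 := h.neg_momentum_le hr
  refine le_of_sq_le_sq ?_ (by positivity)
  rw [mul_pow, Real.sq_sqrt hK0, ← Real.exp_nat_mul]
  have h3 : ((2 : ℕ) : ℝ) * -(r ^ (β / 2 + 1) / (4 * (β / 2 + 1))) =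
      -(r ^ (β / 2 + 1) / (2 * (β / 2 + 1))) := by
    push_cast; field_simp; ring
  rw [h3, hK]
  linarith

/-- The energy density of a bounded solution is integrable. -/
lemma integrableOn_momentum_deriv (h : RaySolution β R G G' q) {C : ℝ}
    (hC : ∀ r, R ≤ r → ‖G r‖ ≤ C) :
    IntegrableOn (fun r => ‖G' r‖ ^ 2 + ((1 - Complex.I) * q r).re * ‖G r‖ ^ 2) (Ioi R) := by
  have hP : ∀ r, R ≤ r → rotMomentum G G' r ≤ 0 := fun r hr => h.momentum_nonpos hC hr
  obtain ⟨l, hl⟩ : ∃ l, Filter.Tendsto (fun x => rotMomentum G G' (max R x)) Filter.atTop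
      (nhds l) := by
    have hm : Monotone (fun x => rotMomentum G G' (max R x)) := fun x y hxy =>
      h.monotoneOn_momentum (mem_Ici.2 (le_max_left _ _)) (mem_Ici.2 (le_max_left _ _))
        (max_le_max le_rfl hxy)
    exact ⟨_, tendsto_atTop_ciSup hm ⟨0, by rintro _ ⟨x, rfl⟩; exact hP _ (le_max_left _ _)⟩⟩
  have hl' : Filter.Tendsto (rotMomentum G G') Filter.atTop (nhds l) := by
    refine hl.congr' ?_
    filter_upwards [Filter.eventually_ge_atTop R] with x hx
    rw [max_eq_right hx]
  exact integrableOn_Ioi_deriv_of_nonneg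
    (h.hasDerivAt_momentum le_rfl).continuousAt.continuousWithinAt
    (fun x hx => h.hasDerivAt_momentum (le_of_lt hx))
    (fun x hx => le_trans (by positivity) (h.half_normSq_le (le_of_lt hx))) hl'

end RaySolution

/-- The Neumann solution along the ray of argument `-θ`. -/
noncomputable def rayFun (γ : ℝ) (η : ℂ) (θ r : ℝ) : ℂ :=
  neumannSol γ η (Real.log r - θ * Complex.I)

/-- The radial derivative of `rayFun`. -/
noncomputable def rayDeriv (γ : ℝ) (η : ℂ) (θ r : ℝ) : ℂ :=
  neumannSolDeriv γ η (Real.log r - θ * Complex.I) / r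

/-- The potential of the equation satisfied by `rayFun`, with exponent `β = γ - 2`. -/
noncomputable def rayPotential (β : ℝ) (η : ℂ) (θ r : ℝ) : ℂ :=
  Complex.I * Complex.exp (-((β + 2) * θ : ℝ) * Complex.I) * (r ^ β : ℝ) -
    η * Complex.exp (-(2 * θ : ℝ) * Complex.I)

lemma hasDerivAt_log_sub (θ : ℝ) {r : ℝ} (hr : 0 < r) :
    HasDerivAt (fun r : ℝ => ((Real.log r : ℝ) : ℂ) - θ * Complex.I) ((r : ℂ)⁻¹) r := by
  have := ((Real.hasDerivAt_log hr.ne').ofReal_comp).sub_const (θ * Complex.I)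
  simpa using this

lemma hasDerivAt_rayFun {γ : ℝ} (hγ : 2 ≤ γ) (η : ℂ) (θ : ℝ) {r : ℝ} (hr : 0 < r) :
    HasDerivAt (rayFun γ η θ) (rayDeriv γ η θ r) r :=
  (hasDerivAt_neumannSol hγ η _).comp_of_eq r (hasDerivAt_log_sub θ hr) rfl

lemma hasDerivAt_rayDeriv {β : ℝ} (hβ : 0 ≤ β) (η : ℂ) (θ : ℝ) {r : ℝ} (hr : 0 < r) :
    HasDerivAt (rayDeriv (β + 2) η θ) (rayPotential β η θ r * rayFun (β + 2) η θ r) r := by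
  have h1 := (hasDerivAt_neumannSolDeriv (by linarith : 2 ≤ β + 2) η
    (Real.log r - θ * Complex.I)).comp_of_eq r (hasDerivAt_log_sub θ hr) rfl
  have h2 := h1.div (hasDerivAt_id r).ofReal_comp (by simpa using hr.ne')
  refine h2.congr_deriv ?_
  have hrc : (r : ℂ) ≠ 0 := by exact_mod_cast hr.ne'
  have e2 : Complex.exp (2 * (Real.log r - θ * Complex.I)) =
      r ^ 2 * Complex.exp (-(2 * θ : ℝ) * Complex.I) := by
    have : (r : ℂ) = Complex.exp (Real.log r) := by
      rw [← Complex.ofReal_exp, Real.exp_log hr]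
    rw [this, ← Complex.exp_nat_mul, ← Complex.exp_add]
    congr 1
    push_cast
    ring
  have eg : Complex.exp ((β + 2 : ℝ) * (Real.log r - θ * Complex.I)) =
      r ^ 2 * ((r ^ β : ℝ) * Complex.exp (-((β + 2) * θ : ℝ) * Complex.I)) := by
    have h3 : (r : ℂ) ^ 2 * (r ^ β : ℝ) = Complex.exp ((β + 2 : ℝ) * Real.log r) := by
      rw [Real.rpow_def_of_pos hr]
      have : (r : ℂ) = Complex.exp (Real.log r) := by
        rw [← Complex.ofReal_exp, Real.exp_log hr]
      rw [this, ← Complex.exp_nat_mul, Complex.ofReal_exp, ← Complex.exp_add]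
      congr 1
      push_cast
      ring
    rw [← mul_assoc, h3, ← Complex.exp_add]
    congr 1
    push_cast
    ring
  simp only [Function.comp, id, rayPotential, rayFun, Complex.ofReal_one]
  rw [e2, eg]
  field_simp
  ring

lemma rpow_sub_le_re_rayPotential {β : ℝ} (η : ℂ) {θ r : ℝ} (hr : 0 ≤ r)
    (h0 : 0 ≤ (β + 2) * θ) (h1 : (β + 2) * θ ≤ Real.pi / 2) :
    r ^ β - 2 * ‖η‖ ≤ ((1 - Complex.I) * rayPotential β η θ r).re := by
  have hsin := Real.sin_nonneg_of_nonneg_of_le_pi h0 (by linarith [Real.pi_pos])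
  have hcos := Real.cos_nonneg_of_neg_pi_div_two_le_of_le (by linarith [Real.pi_pos]) h1
  have hsc := Real.sin_sq_add_cos_sq ((β + 2) * θ)
  have hr' : 0 ≤ r ^ β := Real.rpow_nonneg hr β
  have hη : ((1 - Complex.I) * (η * Complex.exp (-(2 * θ : ℝ) * Complex.I))).re ≤ 2 * ‖η‖ := by
    refine (Complex.re_le_norm _).trans ?_
    have h : ‖(1 - Complex.I : ℂ)‖ ≤ 2 := by
      refine (norm_sub_le _ _).trans ?_
      simp
      norm_num
    rw [← Complex.ofReal_neg, norm_mul, norm_mul, Complex.norm_exp_ofReal_mul_I, mul_one]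
    gcongr
  have hmain : ((1 - Complex.I) * (Complex.I *
      Complex.exp (-((β + 2) * θ : ℝ) * Complex.I) * (r ^ β : ℝ))).re =
      r ^ β * (Real.sin ((β + 2) * θ) + Real.cos ((β + 2) * θ)) := by
    rw [← Complex.ofReal_neg, Complex.exp_mul_I, ← Complex.ofReal_cos, ← Complex.ofReal_sin,
      Real.cos_neg, Real.sin_neg]
    simp only [Complex.mul_re, Complex.mul_im, Complex.sub_re, Complex.sub_im, Complex.one_re,
      Complex.one_im, Complex.I_re, Complex.I_im, Complex.add_re, Complex.add_im,
      Complex.ofReal_re, Complex.ofReal_im]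
    ring
  rw [rayPotential, mul_sub, Complex.sub_re, hmain]
  have : 1 ≤ Real.sin ((β + 2) * θ) + Real.cos ((β + 2) * θ) := by
    nlinarith [mul_nonneg hsin hcos]
  nlinarith

lemma exists_raySolution {β : ℝ} (hβ : 0 < β) (η : ℂ) :
    ∃ R, ∀ θ, 0 ≤ (β + 2) * θ → (β + 2) * θ ≤ Real.pi / 2 →
      RaySolution β R (rayFun (β + 2) η θ) (rayDeriv (β + 2) η θ) (rayPotential β η θ) := by
  obtain ⟨R, hR1, hR⟩ := (((Filter.tendsto_atTop.1 (tendsto_rpow_atTop hβ) (4 * ‖η‖)).and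
    (Filter.eventually_ge_atTop 1)).exists_forall_of_atTop).imp
      (fun R h => (⟨(h R le_rfl).2, fun r hr => (h r hr).1⟩ :
        1 ≤ R ∧ ∀ r, R ≤ r → 4 * ‖η‖ ≤ r ^ β))
  refine ⟨R, fun θ h0 h1 => ⟨hR1, hβ.le, fun r hr => hasDerivAt_rayFun (by linarith) η θ
    (by linarith), fun r hr => hasDerivAt_rayDeriv hβ.le η θ (by linarith), fun r hr => ?_⟩⟩
  have := rpow_sub_le_re_rayPotential (β := β) η (by linarith : 0 ≤ r) h0 h1
  linarith [hR r hr]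

/-- Superexponential decay of the Neumann solution along the ray of argument `-θ`. -/
def RayDecay (ρ a : ℝ) (f : ℂ → ℂ) (θ : ℝ) : Prop :=
  ∃ M, ∀ t : ℝ, ‖f (t - θ * Complex.I)‖ ≤ M * Real.exp (-(a * Real.exp (ρ * t)))

lemma rayDecay_of_bounded {β : ℝ} (hβ : 0 < β) (η : ℂ) {θ : ℝ} (h0 : 0 ≤ (β + 2) * θ)
    (h1 : (β + 2) * θ ≤ Real.pi / 2)
    (hb : ∃ C, ∀ t : ℝ, ‖neumannSol (β + 2) η (t - θ * Complex.I)‖ ≤ C) :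
    RayDecay (β / 2 + 1) (1 / (4 * (β / 2 + 1))) (neumannSol (β + 2) η) θ := by
  obtain ⟨C, hC⟩ := hb
  obtain ⟨R, hR⟩ := exists_raySolution hβ η
  have hsol := hR θ h0 h1
  obtain ⟨M, hM⟩ := hsol.exists_decay (C := C) (fun r _ => hC (Real.log r))
  set a := 1 / (4 * (β / 2 + 1)) with ha
  set ρ := β / 2 + 1 with hρ
  have ha0 : 0 < a := by positivity
  have hC0 : 0 ≤ C := (norm_nonneg _).trans (hC 0)
  refine ⟨max M (C * Real.exp (a * Real.exp (ρ * Real.log R))), fun t => ?_⟩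
  rcases le_total (Real.log R) t with ht | ht
  · have hRt : R ≤ Real.exp t :=
      (Real.log_le_iff_le_exp (by linarith [hsol.one_le])).1 ht
    have h2 := hM _ hRt
    rw [rayFun, Real.log_exp, ← Real.exp_mul, mul_comm t] at h2
    refine h2.trans ?_
    have e : Real.exp (ρ * t) / (4 * ρ) = a * Real.exp (ρ * t) := by rw [ha]; ring
    rw [e]
    gcongr
    exact le_max_left _ _
  · calc ‖neumannSol (β + 2) η (t - θ * Complex.I)‖ ≤ C := hC t
      _ = C * Real.exp (a * Real.exp (ρ * Real.log R)) *
          Real.exp (-(a * Real.exp (ρ * Real.log R))) := by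
          rw [mul_assoc, ← Real.exp_add]; simp
      _ ≤ _ := by
          gcongr
          exact le_max_right _ _

/-- Propagation of decay to nearby rays, by the Phragmen-Lindelöf principle. -/
lemma bounded_of_rayDecay {f : ℂ → ℂ} (hf : Differentiable ℂ f) {ρ a b : ℝ} (hρ : 0 < ρ)
    (ha : 0 < a) (hb : 0 ≤ b)
    (hgrowth : ∀ s, ‖f s‖ ≤ Real.exp (b * (1 + Real.exp (ρ * s.re))))
    {θ τ : ℝ} (hdec : RayDecay ρ a f θ) (hτ0 : 0 ≤ τ) (hτ1 : τ ≤ Real.pi / (2 * ρ))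
    (hτ : 0 ≤ a * Real.cos (ρ * τ) - b * Real.sin (ρ * τ)) :
    ∃ C, ∀ t : ℝ, ‖f (t - (θ + τ : ℝ) * Complex.I)‖ ≤ C := by
  obtain ⟨M, hM⟩ := hdec
  set δ := Real.pi / (2 * ρ) with hδ
  have hδ0 : 0 < δ := by have := Real.pi_pos; positivity
  set h : ℂ → ℂ := fun s => f s *
    Complex.exp ((a - b * Complex.I) * Complex.exp (ρ * (s + θ * Complex.I))) with hh
  have hnorm : ∀ s : ℂ, ‖h s‖ = ‖f s‖ * Real.exp (Real.exp (ρ * s.re) *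
      (a * Real.cos (ρ * (-s.im - θ)) - b * Real.sin (ρ * (-s.im - θ)))) := by
    intro s
    rw [hh]
    simp only [norm_mul, Complex.norm_exp]
    congr 2
    have e : ρ * (-s.im - θ) = -(ρ * (s.im + θ)) := by ring
    rw [e, Real.cos_neg, Real.sin_neg, Complex.mul_re, Complex.exp_re, Complex.exp_im]
    simp
    ring
  set C := max M (Real.exp b) with hCdef
  have hC0 : 0 < C := lt_max_of_lt_right (Real.exp_pos _)
  have key : ∀ s : ℂ, -(θ + δ) ≤ s.im → s.im ≤ -θ → ‖h s‖ ≤ C := by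
    intro s hs1 hs2
    refine PhragmenLindelof.horizontal_strip (f := h) (a := -(θ + δ)) (b := -θ) ?_ ?_ ?_ ?_ hs1 hs2
    · refine Differentiable.diffContOnCl ?_
      rw [hh]
      fun_prop
    · refine ⟨ρ, ?_, 2 * b + (a + b), ?_⟩
      · have : Real.pi / (-θ - -(θ + δ)) = 2 * ρ := by
          rw [show -θ - -(θ + δ) = δ by ring, hδ]
          have := Real.pi_pos
          field_simp
        rw [this]
        linarith
      · refine Asymptotics.IsBigO.of_bound 1 (Filter.Eventually.of_forall fun z => ?_)
        rw [one_mul, hnorm, Real.norm_of_nonneg (Real.exp_pos _).le]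
        refine (mul_le_mul_of_nonneg_right (hgrowth z) (Real.exp_pos _).le).trans ?_
        rw [← Real.exp_add]
        refine Real.exp_le_exp.2 ?_
        have h1 : Real.exp (ρ * z.re) ≤ Real.exp (ρ * |z.re|) := by
          gcongr; exact le_abs_self _
        have h2 : 1 ≤ Real.exp (ρ * |z.re|) := Real.one_le_exp (by positivity)
        have h3 : a * Real.cos (ρ * (-z.im - θ)) - b * Real.sin (ρ * (-z.im - θ)) ≤ a + b := by
          nlinarith [Real.cos_le_one (ρ * (-z.im - θ)), Real.neg_one_le_sin (ρ * (-z.im - θ))]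
        have h4 := mul_le_mul_of_nonneg_left h3 (Real.exp_pos (ρ * z.re)).le
        have h5 := mul_le_mul_of_nonneg_right h1 (by linarith : 0 ≤ a + b)
        have h6 := mul_le_mul_of_nonneg_left h1 hb
        have h7 := mul_le_mul_of_nonneg_left h2 hb
        linarith
    · intro z hz
      have e1 : ρ * (-z.im - θ) = Real.pi / 2 := by
        rw [hz, hδ]; field_simp; ring
      rw [hnorm, e1, Real.cos_pi_div_two, Real.sin_pi_div_two]
      refine (mul_le_mul_of_nonneg_right (hgrowth z) (Real.exp_pos _).le).trans ?_
      rw [← Real.exp_add]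
      refine le_trans (Real.exp_le_exp.2 (le_of_eq ?_)) (le_max_right _ _)
      ring
    · intro z hz
      have e1 : ρ * (-z.im - θ) = 0 := by rw [hz]; ring
      have e2 : z = z.re - θ * Complex.I := by
        apply Complex.ext <;> simp [hz]
      rw [hnorm, e1, Real.cos_zero, Real.sin_zero]
      have h1 := hM z.re
      rw [← e2] at h1
      refine (mul_le_mul_of_nonneg_right h1 (Real.exp_pos _).le).trans ?_
      rw [mul_assoc, ← Real.exp_add]
      refine le_trans (le_of_eq ?_) (le_max_left M (Real.exp b))
      ring_nf
      simp
  refine ⟨C, fun t => ?_⟩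
  have h1 := key (t - (θ + τ : ℝ) * Complex.I) (by simp; linarith) (by simp; linarith)
  rw [hnorm] at h1
  have e1 : -((t : ℂ) - (θ + τ : ℝ) * Complex.I).im - θ = τ := by simp
  rw [e1] at h1
  refine le_trans (le_mul_of_one_le_right (norm_nonneg _) (Real.one_le_exp ?_)) h1
  positivity

lemma bounded_on_rays {β : ℝ} (hβ : 0 < β) (η : ℂ)
    (hb : ∃ C, ∀ t : ℝ, ‖neumannSol (β + 2) η (t - (0 : ℝ) * Complex.I)‖ ≤ C)
    {θ : ℝ} (h0 : 0 ≤ θ) (h1 : (β + 2) * θ ≤ Real.pi / 2) :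
    ∃ C, ∀ t : ℝ, ‖neumannSol (β + 2) η (t - θ * Complex.I)‖ ≤ C := by
  set ρ := β / 2 + 1 with hρ
  set a := 1 / (4 * ρ) with ha
  set b := 2 * √(1 + ‖η‖) with hbdef
  have hρ0 : 0 < ρ := by positivity
  have ha0 : 0 < a := by positivity
  have hpi := Real.pi_pos
  have hdiff : Differentiable ℂ (neumannSol (β + 2) η) := fun s =>
    (hasDerivAt_neumannSol (by linarith) η s).differentiableAt
  have hgrowth : ∀ s, ‖neumannSol (β + 2) η s‖ ≤ Real.exp (b * (1 + Real.exp (ρ * s.re))) := by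
    intro s
    have := norm_neumannSol_le (by linarith : 2 ≤ β + 2) η s
    rwa [show (β + 2) / 2 = ρ by rw [hρ]; ring] at this
  obtain ⟨ε, hε, hεp⟩ : ∃ ε > 0, ∀ τ, 0 ≤ τ → τ ≤ ε →
      0 ≤ a * Real.cos (ρ * τ) - b * Real.sin (ρ * τ) := by
    have hc : ContinuousAt (fun τ => a * Real.cos (ρ * τ) - b * Real.sin (ρ * τ)) 0 := by
      fun_prop
    have := hc.eventually (lt_mem_nhds (by simpa using ha0))
    obtain ⟨ε, hε, h⟩ := Metric.eventually_nhds_iff.1 this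
    refine ⟨ε / 2, by positivity, fun τ h2 h3 => (h ?_).le⟩
    rw [Real.dist_eq, sub_zero, abs_of_nonneg h2]
    linarith
  set τ₀ := min ε (Real.pi / (2 * ρ)) with hτ₀
  have hτ₀0 : 0 < τ₀ := lt_min hε (by positivity)
  have hstep : ∀ n : ℕ, ∀ θ, 0 ≤ θ → (β + 2) * θ ≤ Real.pi / 2 → θ ≤ n * τ₀ →
      ∃ C, ∀ t : ℝ, ‖neumannSol (β + 2) η (t - θ * Complex.I)‖ ≤ C := by
    intro n
    induction n with
    | zero =>
      intro θ h2 _ h4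
      obtain rfl : θ = 0 := le_antisymm (by simpa using h4) h2
      exact hb
    | succ n ih =>
      intro θ h2 h3 h4
      push_cast at h4
      set θ' := max 0 (θ - τ₀) with hθ'
      have hle : θ' ≤ θ := max_le h2 (by linarith)
      have hθ'1 : (β + 2) * θ' ≤ Real.pi / 2 := le_trans (by gcongr) h3
      have hθ'n : θ' ≤ n * τ₀ := max_le (by positivity) (by linarith)
      have hd := rayDecay_of_bounded hβ η (by positivity) hθ'1
        (ih θ' (le_max_left _ _) hθ'1 hθ'n)
      have hτle : θ - θ' ≤ τ₀ := by linarith [le_max_right 0 (θ - τ₀)]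
      have := bounded_of_rayDecay hdiff hρ0 ha0 (by positivity) hgrowth hd
        (sub_nonneg.2 hle) (hτle.trans (min_le_right _ _))
        (hεp _ (sub_nonneg.2 hle) (hτle.trans (min_le_left _ _)))
      rwa [add_sub_cancel] at this
  obtain ⟨n, hn⟩ := exists_nat_ge (θ / τ₀)
  exact hstep n θ h0 h1 ((div_le_iff₀ hτ₀0).1 hn)

lemma two_le_expo {γ : ℝ} (hγ : 2 ≤ γ) {p : ℕ × ℕ} (hp : p ≠ 0) : 2 ≤ expo γ p := by
  obtain ⟨j, k⟩ := p
  have h1 : 1 ≤ j + k := by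
    by_contra! h
    obtain ⟨rfl, rfl⟩ : j = 0 ∧ k = 0 := by omega
    exact hp rfl
  have h2 : (1 : ℝ) ≤ ((j + k : ℕ) : ℝ) := by exact_mod_cast h1
  linarith [two_mul_add_le_expo hγ j k]

lemma norm_neumannSol_sub_one_le {γ : ℝ} (hγ : 2 ≤ γ) (η : ℂ) {s : ℂ} (hs : s.re ≤ 0) :
    ‖neumannSol γ η s - 1‖ ≤ (∑' p, majorant γ η 1 p) * Real.exp (2 * s.re) := by
  have h1 := (hasSum_neumannSol hγ η s).sub (hasSum_ite_eq (0 : ℕ × ℕ) (1 : ℂ))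
  rw [← h1.tsum_eq]
  refine tsum_of_norm_bounded ((hasSum_majorant γ η 1).summable.hasSum.mul_right _) (fun p => ?_)
  have hm := norm_coeff_mul_exp_le hγ η 1 p
  have h0 := expo_nonneg hγ p
  have hM : ‖neumannCoeff γ η p.1 p.2‖ ≤ majorant γ η 1 p :=
    le_trans (le_mul_of_one_le_right (norm_nonneg _) (Real.one_le_exp (by linarith))) hm
  have hM0 : 0 ≤ majorant γ η 1 p := (norm_nonneg _).trans hM
  by_cases hp : p = 0
  · subst hp
    simp [neumannCoeff, expo]
    positivity
  · rw [if_neg hp, sub_zero, norm_mul, norm_exp_ofReal_mul]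
    have := two_le_expo hγ hp
    refine mul_le_mul hM (Real.exp_le_exp.2 ?_) (Real.exp_pos _).le hM0
    nlinarith

lemma norm_neumannSolDeriv_le {γ : ℝ} (hγ : 2 ≤ γ) (η : ℂ) {s : ℂ} (hs : s.re ≤ 0) :
    ‖neumannSolDeriv γ η s‖ ≤ (∑' p, majorant γ η 1 p) * Real.exp (2 * s.re) := by
  refine tsum_of_norm_bounded ((hasSum_majorant γ η 1).summable.hasSum.mul_right _) (fun p => ?_)
  have hM : ‖neumannCoeff γ η p.1 p.2 * expo γ p‖ ≤ majorant γ η 1 p := by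
    have := norm_expo_term_le hγ η (X := 0) (s := 0) (by simp) p
    simpa using this
  have hM0 : 0 ≤ majorant γ η 1 p := (norm_nonneg _).trans hM
  by_cases hp : p = 0
  · subst hp
    simp [expo]
    positivity
  · rw [norm_mul, norm_exp_ofReal_mul]
    have := two_le_expo hγ hp
    refine mul_le_mul hM (Real.exp_le_exp.2 ?_) (Real.exp_pos _).le hM0
    nlinarith

/-- `rayFun`, extended by its limit to the closed half-line. -/
noncomputable def rayExt (γ : ℝ) (η : ℂ) (θ r : ℝ) : ℂ :=
  if r ≤ 0 then 1 else rayFun γ η θ r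

/-- `rayDeriv`, extended by its limit to the closed half-line. -/
noncomputable def rayExtDeriv (γ : ℝ) (η : ℂ) (θ r : ℝ) : ℂ :=
  if r ≤ 0 then 0 else rayDeriv γ η θ r

lemma rayExt_eventuallyEq (γ : ℝ) (η : ℂ) (θ : ℝ) {r : ℝ} (hr : 0 < r) :
    rayExt γ η θ =ᶠ[nhds r] rayFun γ η θ := by
  filter_upwards [lt_mem_nhds hr] with x hx
  rw [rayExt, if_neg (not_le.2 hx)]

lemma rayExtDeriv_eventuallyEq (γ : ℝ) (η : ℂ) (θ : ℝ) {r : ℝ} (hr : 0 < r) :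
    rayExtDeriv γ η θ =ᶠ[nhds r] rayDeriv γ η θ := by
  filter_upwards [lt_mem_nhds hr] with x hx
  rw [rayExtDeriv, if_neg (not_le.2 hx)]

lemma hasDerivAt_rayExt {γ : ℝ} (hγ : 2 ≤ γ) (η : ℂ) (θ : ℝ) {r : ℝ} (hr : 0 < r) :
    HasDerivAt (rayExt γ η θ) (rayExtDeriv γ η θ r) r := by
  rw [(rayExtDeriv_eventuallyEq γ η θ hr).eq_of_nhds]
  exact (hasDerivAt_rayFun hγ η θ hr).congr_of_eventuallyEq (rayExt_eventuallyEq γ η θ hr)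

lemma hasDerivAt_rayExtDeriv {β : ℝ} (hβ : 0 ≤ β) (η : ℂ) (θ : ℝ) {r : ℝ} (hr : 0 < r) :
    HasDerivAt (rayExtDeriv (β + 2) η θ) (rayPotential β η θ r * rayExt (β + 2) η θ r) r := by
  rw [(rayExt_eventuallyEq _ η θ hr).eq_of_nhds]
  exact (hasDerivAt_rayDeriv hβ η θ hr).congr_of_eventuallyEq (rayExtDeriv_eventuallyEq _ η θ hr)

lemma exp_two_mul_re_log {θ r : ℝ} (hr : 0 < r) :
    Real.exp (2 * ((Real.log r : ℂ) - θ * Complex.I).re) = r ^ 2 := by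
  have : ((Real.log r : ℂ) - θ * Complex.I).re = Real.log r := by simp
  rw [this, mul_comm, Real.exp_mul, Real.exp_log hr]
  norm_cast

lemma continuousWithinAt_rayExt_zero {γ : ℝ} (hγ : 2 ≤ γ) (η : ℂ) (θ : ℝ) :
    ContinuousWithinAt (rayExt γ η θ) (Ioi 0) 0 := by
  rw [ContinuousWithinAt, tendsto_iff_norm_sub_tendsto_zero]
  have hlim : Filter.Tendsto (fun r : ℝ => (∑' p, majorant γ η 1 p) * r ^ 2)
      (nhdsWithin 0 (Ioi 0)) (nhds 0) := by
    refine tendsto_nhdsWithin_of_tendsto_nhds ?_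
    have : Continuous (fun r : ℝ => (∑' p, majorant γ η 1 p) * r ^ 2) := by fun_prop
    simpa using this.tendsto 0
  refine squeeze_zero' (Filter.Eventually.of_forall fun _ => norm_nonneg _) ?_ hlim
  filter_upwards [self_mem_nhdsWithin, Ioo_mem_nhdsGT one_pos] with r hr hr1
  have hr : 0 < r := hr
  have h := norm_neumannSol_sub_one_le hγ η (s := (Real.log r : ℂ) - θ * Complex.I)
    (by simpa using Real.log_nonpos hr.le hr1.2.le)
  rw [exp_two_mul_re_log hr] at h
  simpa [rayExt, not_le.2 hr, rayFun] using h

lemma continuousWithinAt_rayExtDeriv_zero {γ : ℝ} (hγ : 2 ≤ γ) (η : ℂ) (θ : ℝ) :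
    ContinuousWithinAt (rayExtDeriv γ η θ) (Ioi 0) 0 := by
  rw [ContinuousWithinAt, tendsto_iff_norm_sub_tendsto_zero]
  have hlim : Filter.Tendsto (fun r : ℝ => (∑' p, majorant γ η 1 p) * r)
      (nhdsWithin 0 (Ioi 0)) (nhds 0) := by
    refine tendsto_nhdsWithin_of_tendsto_nhds ?_
    have : Continuous (fun r : ℝ => (∑' p, majorant γ η 1 p) * r) := by fun_prop
    simpa using this.tendsto 0
  refine squeeze_zero' (Filter.Eventually.of_forall fun _ => norm_nonneg _) ?_ hlim
  filter_upwards [self_mem_nhdsWithin, Ioo_mem_nhdsGT one_pos] with r hr hr1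
  have hr : 0 < r := hr
  have h := norm_neumannSolDeriv_le hγ η (s := (Real.log r : ℂ) - θ * Complex.I)
    (by simpa using Real.log_nonpos hr.le hr1.2.le)
  rw [exp_two_mul_re_log hr] at h
  simp only [rayExtDeriv, if_neg (not_le.2 hr), le_refl, if_true, sub_zero, rayDeriv]
  rw [norm_div, Complex.norm_real, Real.norm_of_nonneg hr.le, div_le_iff₀ hr]
  linarith

lemma hasDerivWithinAt_Ici_zero_of_continuousWithinAt {u v : ℝ → ℂ}
    (hu : ContinuousWithinAt u (Ioi 0) 0) (hv : ContinuousWithinAt v (Ioi 0) 0)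
    (huv : ∀ r, 0 < r → HasDerivAt u (v r) r) {r : ℝ} (hr : r ∈ Ici (0 : ℝ)) :
    HasDerivWithinAt u (v r) (Ici 0) r := by
  rcases eq_or_lt_of_le (mem_Ici.1 hr) with rfl | hr
  · refine hasDerivWithinAt_Ici_of_tendsto_deriv (s := Ioi 0)
      (fun r hr => (huv r hr).differentiableAt.differentiableWithinAt) hu self_mem_nhdsWithin ?_
    refine hv.tendsto.congr' ?_
    filter_upwards [self_mem_nhdsWithin] with r hr
    exact (huv r hr).deriv.symm
  · exact (huv r hr).hasDerivWithinAt

lemma hasDerivWithinAt_rayExt {γ : ℝ} (hγ : 2 ≤ γ) (η : ℂ) (θ : ℝ) {r : ℝ} (hr : r ∈ Ici (0 : ℝ)) :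
    HasDerivWithinAt (rayExt γ η θ) (rayExtDeriv γ η θ r) (Ici 0) r :=
  hasDerivWithinAt_Ici_zero_of_continuousWithinAt (continuousWithinAt_rayExt_zero hγ η θ)
    (continuousWithinAt_rayExtDeriv_zero hγ η θ) (fun _ => hasDerivAt_rayExt hγ η θ) hr

lemma continuous_rayPotential {β : ℝ} (hβ : 0 ≤ β) (η : ℂ) (θ : ℝ) :
    Continuous (rayPotential β η θ) := by
  have := Real.continuous_rpow_const hβ
  unfold rayPotential
  fun_prop

lemma hasDerivWithinAt_rayExtDeriv {β : ℝ} (hβ : 0 ≤ β) (η : ℂ) (θ : ℝ) {r : ℝ}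
    (hr : r ∈ Ici (0 : ℝ)) :
    HasDerivWithinAt (rayExtDeriv (β + 2) η θ)
      (rayPotential β η θ r * rayExt (β + 2) η θ r) (Ici 0) r :=
  hasDerivWithinAt_Ici_zero_of_continuousWithinAt
    (v := fun r => rayPotential β η θ r * rayExt (β + 2) η θ r)
    (continuousWithinAt_rayExtDeriv_zero (by linarith) η θ)
    ((continuous_rayPotential hβ η θ).continuousWithinAt.mul
      (continuousWithinAt_rayExt_zero (by linarith) η θ))
    (fun _ => hasDerivAt_rayExtDeriv hβ η θ) hr

/-- Uniqueness for the Cauchy problem of `u'' = q u` on the half-line. -/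
lemma eq_zero_of_hasDerivWithinAt {u v q : ℝ → ℂ} (hq : Continuous q)
    (hu : ∀ x ∈ Ici (0 : ℝ), HasDerivWithinAt u (v x) (Ici 0) x)
    (hv : ∀ x ∈ Ici (0 : ℝ), HasDerivWithinAt v (q x * u x) (Ici 0) x)
    (hu0 : u 0 = 0) (hv0 : v 0 = 0) {x : ℝ} (hx : 0 ≤ x) : u x = 0 := by
  obtain ⟨K, hK⟩ := (isCompact_Icc (a := (0 : ℝ)) (b := x)).exists_bound_of_continuousOn
    hq.continuousOn
  have hL : ∀ t ∈ Ico 0 x, LipschitzOnWith (max 1 K.toNNReal)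
      (fun p : ℂ × ℂ => (p.2, q t * p.1)) univ := by
    intro t ht
    refine LipschitzOnWith.of_dist_le_mul fun p _ p' _ => ?_
    have h1 := hK t (Ico_subset_Icc_self ht)
    have h2 : K ≤ ((max 1 K.toNNReal : NNReal) : ℝ) :=
      (Real.le_coe_toNNReal K).trans (by exact_mod_cast le_max_right _ _)
    have h3 : (1 : ℝ) ≤ ((max 1 K.toNNReal : NNReal) : ℝ) := by exact_mod_cast le_max_left _ _
    rw [Prod.dist_eq]
    refine max_le ?_ ?_
    · calc dist p.2 p'.2 ≤ dist p p' := by rw [Prod.dist_eq]; exact le_max_right _ _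
        _ ≤ _ := le_mul_of_one_le_left dist_nonneg h3
    · have h4 : dist (q t * p.1) (q t * p'.1) = ‖q t‖ * dist p.1 p'.1 := by
        rw [dist_eq_norm, dist_eq_norm, ← mul_sub, norm_mul]
      simp only
      rw [h4]
      refine mul_le_mul (h1.trans h2) ?_ dist_nonneg (by positivity)
      rw [Prod.dist_eq]
      exact le_max_left _ _
  have hcont : ContinuousOn (fun t => (u t, v t)) (Icc 0 x) :=
    ContinuousOn.prodMk
      (fun t ht => ((hu t ht.1).continuousWithinAt).mono Icc_subset_Ici_self)
      (fun t ht => ((hv t ht.1).continuousWithinAt).mono Icc_subset_Ici_self)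
  have h := ODE_solution_unique_of_mem_Icc_right (f := fun t => (u t, v t))
    (g := fun _ => ((0 : ℂ), (0 : ℂ))) (s := fun _ => univ) hL hcont
    (fun t ht => ((hu t ht.1).mono (Ici_subset_Ici.2 ht.1)).prodMk
      ((hv t ht.1).mono (Ici_subset_Ici.2 ht.1))) (fun _ _ => mem_univ _)
    continuousOn_const
    (fun t _ => (hasDerivWithinAt_const t (Ici t) ((0 : ℂ), (0 : ℂ))).congr_deriv
      (by rw [mul_zero]; rfl))
    (fun _ _ => mem_univ _) (by simp [hu0, hv0])
  exact congrArg Prod.fst (h ⟨hx, le_rfl⟩)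

lemma integrableOn_mul_of_sq {u v : ℝ → ℂ} (hu : ContinuousOn u (Ici 0))
    (hv : ContinuousOn v (Ici 0)) (hu2 : IntegrableOn (fun x => ‖u x‖ ^ 2) (Ioi 0))
    (hv2 : IntegrableOn (fun x => ‖v x‖ ^ 2) (Ioi 0)) :
    IntegrableOn (fun x => u x * v x) (Ioi 0) := by
  refine Integrable.mono' (hu2.add hv2)
    (((hu.mul hv).mono Ioi_subset_Ici_self).aestronglyMeasurable measurableSet_Ioi)
    (Filter.Eventually.of_forall fun x => ?_)
  rw [norm_mul]
  simp only [Pi.add_apply]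
  nlinarith [sq_nonneg (‖u x‖ - ‖v x‖), sq_nonneg ‖u x‖, sq_nonneg ‖v x‖]

lemma exists_bound_of_sq_integrable {u v : ℝ → ℂ}
    (huv : ∀ x ∈ Ici (0 : ℝ), HasDerivWithinAt u (v x) (Ici 0) x) (hv : ContinuousOn v (Ici 0))
    (hu2 : IntegrableOn (fun x => ‖u x‖ ^ 2) (Ioi 0))
    (hv2 : IntegrableOn (fun x => ‖v x‖ ^ 2) (Ioi 0)) :
    ∃ C, ∀ x, 0 ≤ x → ‖u x‖ ≤ C := by
  have hu : ContinuousOn u (Ici 0) := fun x hx => (huv x hx).continuousWithinAt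
  have hd : ∀ x ∈ Ioi (0 : ℝ), HasDerivAt (fun x => u x * u x) (v x * u x + u x * v x) x :=
    fun x hx => by
      have := (huv x (Ioi_subset_Ici_self hx)).hasDerivAt (Ici_mem_nhds hx)
      exact this.mul this
  have hlim := tendsto_zero_of_hasDerivAt_of_integrableOn_Ioi hd
    ((integrableOn_mul_of_sq hv hu hv2 hu2).add (integrableOn_mul_of_sq hu hv hu2 hv2))
    (integrableOn_mul_of_sq hu hu hu2 hu2)
  obtain ⟨R, hR⟩ := Filter.eventually_atTop.1
    ((hlim.norm).eventually (gt_mem_nhds (by simp : ‖(0 : ℂ)‖ < 1)))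
  obtain ⟨C, hC⟩ := (isCompact_Icc (a := (0 : ℝ)) (b := R)).exists_bound_of_continuousOn
    (hu.mono Icc_subset_Ici_self)
  refine ⟨max C 1, fun x hx => ?_⟩
  rcases le_total x R with h | h
  · exact (hC x ⟨hx, h⟩).trans (le_max_left _ _)
  · refine le_trans ?_ (le_max_right _ _)
    have := hR x h
    rw [norm_mul] at this
    nlinarith [norm_nonneg (u x)]

lemma energy_identity {β : ℝ} {μ : ℂ} {u v : ℝ → ℂ}
    (huv : ∀ x ∈ Ici (0 : ℝ), HasDerivWithinAt u (v x) (Ici 0) x)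
    (hv : ∀ x ∈ Ici (0 : ℝ), HasDerivWithinAt v (((x ^ β : ℝ) - μ) * u x) (Ici 0) x)
    (hv0 : v 0 = 0)
    (hu2 : IntegrableOn (fun x => ‖u x‖ ^ 2) (Ioi 0))
    (hv2 : IntegrableOn (fun x => ‖v x‖ ^ 2) (Ioi 0))
    (hw2 : IntegrableOn (fun x => x ^ β * ‖u x‖ ^ 2) (Ioi 0)) :
    (∫ x in Ioi (0 : ℝ), ‖v x‖ ^ 2) + ∫ x in Ioi (0 : ℝ), x ^ β * ‖u x‖ ^ 2 =
      ‖μ‖ * ∫ x in Ioi (0 : ℝ), ‖u x‖ ^ 2 := by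
  have huc : ContinuousOn u (Ici 0) := fun x hx => (huv x hx).continuousWithinAt
  have hvc : ContinuousOn v (Ici 0) := fun x hx => (hv x hx).continuousWithinAt
  have hcc : ContinuousOn (fun x => (starRingEnd ℂ) (u x)) (Ici 0) :=
    Complex.continuous_conj.comp_continuousOn huc
  have hd : ∀ x ∈ Ioi (0 : ℝ), HasDerivAt (fun x => v x * (starRingEnd ℂ) (u x))
      (((‖v x‖ ^ 2 + x ^ β * ‖u x‖ ^ 2 : ℝ) : ℂ) - μ * (‖u x‖ ^ 2 : ℝ)) x := by
    intro x hx
    have h1 := (huv x (Ioi_subset_Ici_self hx)).hasDerivAt (Ici_mem_nhds hx)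
    have h2 := (hv x (Ioi_subset_Ici_self hx)).hasDerivAt (Ici_mem_nhds hx)
    have h3 : HasDerivAt (fun x => (starRingEnd ℂ) (u x)) ((starRingEnd ℂ) (v x)) x := by
      simpa using h1.star
    refine (h2.mul h3).congr_deriv ?_
    have e1 := Complex.mul_conj' (v x)
    have e2 := Complex.mul_conj' (u x)
    push_cast
    rw [← e1, ← e2]
    ring
  have hI1 : IntegrableOn (fun x => ((‖v x‖ ^ 2 + x ^ β * ‖u x‖ ^ 2 : ℝ) : ℂ)) (Ioi 0) :=
    (hv2.add hw2).ofReal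
  have hI2 : IntegrableOn (fun x => μ * ((‖u x‖ ^ 2 : ℝ) : ℂ)) (Ioi 0) := hu2.ofReal.const_mul μ
  have hI3 : IntegrableOn (fun x => v x * (starRingEnd ℂ) (u x)) (Ioi 0) :=
    integrableOn_mul_of_sq hvc hcc hv2 (by simpa using hu2)
  have hlim := tendsto_zero_of_hasDerivAt_of_integrableOn_Ioi hd (hI1.sub hI2) hI3
  have h0 : ContinuousWithinAt (fun x => v x * (starRingEnd ℂ) (u x)) (Ici 0) 0 :=
    (hvc.mul hcc) 0 (mem_Ici.2 le_rfl)
  have hint := integral_Ioi_of_hasDerivAt_of_tendsto h0 hd (hI1.sub hI2) hlim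
  rw [integral_sub hI1 hI2, hv0, zero_mul, sub_zero, integral_const_mul, sub_eq_zero,
    integral_complex_ofReal, integral_complex_ofReal, integral_add hv2 hw2] at hint
  have hn := congrArg norm hint
  rw [norm_mul, Complex.norm_real, Complex.norm_real, Real.norm_of_nonneg,
    Real.norm_of_nonneg] at hn
  · exact hn
  · positivity
  · refine add_nonneg (integral_nonneg fun x => by positivity)
      (setIntegral_nonneg measurableSet_Ioi fun x hx => ?_)
    have := Real.rpow_nonneg (le_of_lt hx : (0 : ℝ) ≤ x) β
    positivity

lemma integral_norm_sq_pos {u : ℝ → ℂ} (hu : ContinuousOn u (Ici 0)) (hu0 : u 0 ≠ 0)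
    (hu2 : IntegrableOn (fun x => ‖u x‖ ^ 2) (Ioi 0)) :
    0 < ∫ x in Ioi (0 : ℝ), ‖u x‖ ^ 2 := by
  rw [setIntegral_pos_iff_support_of_nonneg_ae
    (Filter.Eventually.of_forall fun x => by positivity) hu2]
  have h := ((hu 0 (mem_Ici.2 le_rfl)).mono Ioi_subset_Ici_self).eventually_ne hu0
  obtain ⟨ε, hε, hsub⟩ := mem_nhdsGT_iff_exists_Ioo_subset.1 h
  refine lt_of_lt_of_le ?_ (measure_mono (s := Ioo 0 ε) fun x hx => ⟨?_, hx.1⟩)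
  · rw [Real.volume_Ioo]
    simpa using hε
  · have : u x ≠ 0 := hsub hx
    simpa using this

lemma integrableOn_Ioi_zero_of_continuousOn {f : ℝ → ℝ} {R : ℝ} (hR : 0 ≤ R)
    (hf : ContinuousOn f (Ici 0)) (hfR : IntegrableOn f (Ioi R)) : IntegrableOn f (Ioi 0) := by
  rw [← Ioc_union_Ioi_eq_Ioi hR]
  exact (((hf.mono Icc_subset_Ici_self).integrableOn_Icc).mono_set Ioc_subset_Icc_self).union hfR

/-- On the ray where the potential becomes real, a bounded Neumann solution violates the
spectral inequality. -/
lemma not_bounded_of_spectral {β : ℝ} (hβ : 0 < β) {c : ℝ} (hc : 0 < c)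
    (hspec : ∀ u u' : ℝ → ℂ,
        (∀ x ∈ Ici (0:ℝ), HasDerivWithinAt u (u' x) (Ici 0) x) →
        ContinuousOn u' (Ici 0) →
        IntegrableOn (fun x => ‖u x‖ ^ 2) (Ioi 0) →
        IntegrableOn (fun x => ‖u' x‖ ^ 2) (Ioi 0) →
        ENNReal.ofReal c * (∫⁻ x in Ioi (0:ℝ), ENNReal.ofReal (‖u x‖ ^ 2)) ≤
          (∫⁻ x in Ioi (0:ℝ), ENNReal.ofReal (‖u' x‖ ^ 2)) +
            ∫⁻ x in Ioi (0:ℝ), ENNReal.ofReal (x ^ β * ‖u x‖ ^ 2))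
    {η : ℂ} (hη : ‖η‖ < c)
    (hb : ∃ C, ∀ t : ℝ, ‖neumannSol (β + 2) η (t - (0 : ℝ) * Complex.I)‖ ≤ C) : False := by
  have hpi := Real.pi_pos
  set α := Real.pi / (2 * (β + 2)) with hα
  have hα0 : 0 ≤ α := by positivity
  have hα1 : (β + 2) * α = Real.pi / 2 := by rw [hα]; field_simp
  have hγ : 2 ≤ β + 2 := by linarith
  obtain ⟨C, hC⟩ := bounded_on_rays hβ η hb hα0 hα1.le
  obtain ⟨R, hR⟩ := exists_raySolution hβ η
  have hsol := hR α (by positivity) hα1.le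
  have hP := hsol.integrableOn_momentum_deriv (C := C) (fun r _ => hC (Real.log r))
  have hR0 : 0 < R := by linarith [hsol.one_le]
  set u := rayExt (β + 2) η α with hu
  set v := rayExtDeriv (β + 2) η α with hv
  have huv : ∀ x ∈ Ici (0 : ℝ), HasDerivWithinAt u (v x) (Ici 0) x :=
    fun x hx => hasDerivWithinAt_rayExt hγ η α hx
  set μ := η * Complex.exp (-(2 * α : ℝ) * Complex.I) with hμ
  have hμn : ‖μ‖ = ‖η‖ := by
    rw [hμ, norm_mul, ← Complex.ofReal_neg, Complex.norm_exp_ofReal_mul_I, mul_one]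
  have hpot : ∀ x, rayPotential β η α x = (x ^ β : ℝ) - μ := by
    intro x
    rw [rayPotential, hα1, ← Complex.ofReal_neg, Complex.exp_mul_I, ← Complex.ofReal_cos,
      ← Complex.ofReal_sin, Real.cos_neg, Real.sin_neg, Real.cos_pi_div_two, Real.sin_pi_div_two]
    push_cast [hμ]
    linear_combination (-((x ^ β : ℝ) : ℂ)) * Complex.I_mul_I
  have hvd : ∀ x ∈ Ici (0 : ℝ), HasDerivWithinAt v (((x ^ β : ℝ) - μ) * u x) (Ici 0) x := by
    intro x hx
    rw [← hpot]
    exact hasDerivWithinAt_rayExtDeriv hβ.le η α hx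
  have huc : ContinuousOn u (Ici 0) := fun x hx => (huv x hx).continuousWithinAt
  have hvc : ContinuousOn v (Ici 0) := fun x hx => (hvd x hx).continuousWithinAt
  have hwc : ContinuousOn (fun x : ℝ => x ^ β * ‖u x‖ ^ 2) (Ici 0) :=
    (Real.continuous_rpow_const hβ.le).continuousOn.mul (huc.norm.pow 2)
  have hdom : ∀ x ∈ Ioi R, ‖v x‖ ^ 2 + x ^ β * ‖u x‖ ^ 2 ≤
      2 * (‖rayDeriv (β + 2) η α x‖ ^ 2 +
        ((1 - Complex.I) * rayPotential β η α x).re * ‖rayFun (β + 2) η α x‖ ^ 2) := by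
    intro x hx
    have hx0 : 0 < x := hR0.trans hx
    have := hsol.deriv_ge (Ioi_subset_Ici_self hx)
    rw [hu, hv, (rayExt_eventuallyEq _ η α hx0).eq_of_nhds,
      (rayExtDeriv_eventuallyEq _ η α hx0).eq_of_nhds]
    linarith
  have hint : ∀ f : ℝ → ℝ, ContinuousOn f (Ici 0) → (∀ x ∈ Ioi R, 0 ≤ f x) →
      (∀ x ∈ Ioi R, f x ≤ ‖v x‖ ^ 2 + x ^ β * ‖u x‖ ^ 2) → IntegrableOn f (Ioi 0) := by
    intro f hf hf0 hfle
    refine integrableOn_Ioi_zero_of_continuousOn hR0.le hf ?_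
    refine Integrable.mono' (hP.const_mul 2) ((hf.mono fun x hx =>
      (hR0.trans hx).le).aestronglyMeasurable measurableSet_Ioi) ?_
    refine (ae_restrict_iff' measurableSet_Ioi).2 (Filter.Eventually.of_forall fun x hx => ?_)
    rw [Real.norm_of_nonneg (hf0 x hx)]
    exact (hfle x hx).trans (hdom x hx)
  have hpow : ∀ x ∈ Ioi R, 1 ≤ x ^ β := fun x hx => hsol.one_le_rpow (Ioi_subset_Ici_self hx)
  have hu2 : IntegrableOn (fun x => ‖u x‖ ^ 2) (Ioi 0) :=
    hint _ (huc.norm.pow 2) (fun x _ => by positivity) fun x hx => by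
      nlinarith [hpow x hx, sq_nonneg ‖u x‖, sq_nonneg ‖v x‖]
  have hv2 : IntegrableOn (fun x => ‖v x‖ ^ 2) (Ioi 0) :=
    hint _ (hvc.norm.pow 2) (fun x _ => by positivity) fun x hx => by
      nlinarith [hpow x hx, sq_nonneg ‖u x‖, sq_nonneg ‖v x‖]
  have hw2 : IntegrableOn (fun x => x ^ β * ‖u x‖ ^ 2) (Ioi 0) :=
    hint _ hwc (fun x hx => mul_nonneg (zero_le_one.trans (hpow x hx)) (sq_nonneg _))
      fun x hx => by nlinarith [sq_nonneg ‖v x‖]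
  have hid := energy_identity huv hvd (by simp [hv, rayExtDeriv]) hu2 hv2 hw2
  have hw0 : ∀ x ∈ Ioi (0 : ℝ), 0 ≤ x ^ β * ‖u x‖ ^ 2 := fun x hx =>
    mul_nonneg (Real.rpow_nonneg (Ioi_subset_Ici_self hx) β) (sq_nonneg _)
  have hs := hspec u v huv hvc hu2 hv2
  rw [← ofReal_integral_eq_lintegral_ofReal hu2
      (Filter.Eventually.of_forall fun x => by positivity),
    ← ofReal_integral_eq_lintegral_ofReal hv2
      (Filter.Eventually.of_forall fun x => by positivity),
    ← ofReal_integral_eq_lintegral_ofReal hw2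
      ((ae_restrict_iff' measurableSet_Ioi).2 (Filter.Eventually.of_forall hw0)),
    ← ENNReal.ofReal_mul hc.le,
    ← ENNReal.ofReal_add (integral_nonneg fun x => by positivity)
      (setIntegral_nonneg measurableSet_Ioi hw0), hid, hμn,
    ENNReal.ofReal_le_ofReal_iff (by positivity)] at hs
  have hpos := integral_norm_sq_pos huc (by simp [hu, rayExt]) hu2
  nlinarith

lemma eq_zero_of_integrableOn_const {z : ℂ} (h : IntegrableOn (fun _ : ℝ => z) (Ioi 0)) :
    z = 0 := by
  simpa [integrableOn_const_iff] using h

/-- Uniqueness for the constant-coefficient equation. -/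
lemma eq_zero_of_const_coeff {q : ℂ} {u v : ℝ → ℂ}
    (huv : ∀ x ∈ Ici (0 : ℝ), HasDerivWithinAt u (v x) (Ici 0) x)
    (hv : ∀ x ∈ Ici (0 : ℝ), HasDerivWithinAt v (q * u x) (Ici 0) x)
    (hu2 : IntegrableOn (fun x => ‖u x‖ ^ 2) (Ioi 0))
    (hv2 : IntegrableOn (fun x => ‖v x‖ ^ 2) (Ioi 0))
    (hv0 : v 0 = 0) {x : ℝ} (hx : 0 ≤ x) : u x = 0 := by
  have hconst : ∀ w : ℝ → ℂ, (∀ x ∈ Ici (0 : ℝ), HasDerivWithinAt w 0 (Ici 0) x) →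
      IntegrableOn w (Ioi 0) → w 0 = 0 := by
    intro w hw hwi
    refine eq_zero_of_integrableOn_const (hwi.congr_fun (fun x hx => ?_) measurableSet_Ioi)
    exact (convex_Ici (0 : ℝ)).is_const_of_fderivWithin_eq_zero (𝕜 := ℝ)
      (fun x hx => (hw x hx).differentiableWithinAt) (fun x hx => by
        have := (hw x hx).hasFDerivWithinAt.fderivWithin (uniqueDiffOn_Ici 0 x hx)
        simpa using this) (Ioi_subset_Ici_self hx) (mem_Ici.2 le_rfl)
  have huc : ContinuousOn u (Ici 0) := fun x hx => (huv x hx).continuousWithinAt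
  have hvc : ContinuousOn v (Ici 0) := fun x hx => (hv x hx).continuousWithinAt
  have h1 : q * (u 0 * u 0) = 0 := by
    have := hconst (fun x => v x * v x - q * (u x * u x))
      (fun x hx => (((hv x hx).mul (hv x hx)).sub
        (((huv x hx).mul (huv x hx)).const_mul q)).congr_deriv (by ring))
      ((integrableOn_mul_of_sq hvc hvc hv2 hv2).sub
        ((integrableOn_mul_of_sq huc huc hu2 hu2).const_mul q))
    simpa [hv0] using this
  have hu0 : u 0 = 0 := by
    rcases mul_eq_zero.1 h1 with hq | h
    · have hvz : ∀ x, 0 ≤ x → v x = 0 := fun x hx =>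
        eq_zero_of_hasDerivWithinAt (q := fun _ => 0) (v := fun _ => 0) continuous_const
          (fun x hx => by simpa [hq] using hv x hx)
          (fun x _ => by simpa using hasDerivWithinAt_const x (Ici 0) (0 : ℂ)) hv0 rfl hx
      have := hconst (fun x => u x * u x)
        (fun x hx => ((huv x hx).mul (huv x hx)).congr_deriv (by simp [hvz x hx]))
        (integrableOn_mul_of_sq huc huc hu2 hu2)
      simpa using this
    · simpa using h
  exact eq_zero_of_hasDerivWithinAt (q := fun _ => q) continuous_const huv hv hu0 hv0 hx

/-- Uniqueness (Neumann normalization): a twice continuously differentiable solution of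
`-F'' + i x^β F - η F = 0` on `[0,∞)` with `F, F', F''` square-integrable and `F'(0) = 0`
is identically zero, provided `|η| < c` where `c > 0` satisfies the spectral inequality. -/
theorem stmt_2 (β : ℝ) (hβ : 0 ≤ β) (c : ℝ) (hc : 0 < c)
    (hspec : ∀ u u' : ℝ → ℂ,
        (∀ x ∈ Ici (0:ℝ), HasDerivWithinAt u (u' x) (Ici 0) x) →
        ContinuousOn u' (Ici 0) →
        IntegrableOn (fun x => ‖u x‖ ^ 2) (Ioi 0) →
        IntegrableOn (fun x => ‖u' x‖ ^ 2) (Ioi 0) →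
        ENNReal.ofReal c * (∫⁻ x in Ioi (0:ℝ), ENNReal.ofReal (‖u x‖ ^ 2)) ≤
          (∫⁻ x in Ioi (0:ℝ), ENNReal.ofReal (‖u' x‖ ^ 2)) +
            ∫⁻ x in Ioi (0:ℝ), ENNReal.ofReal (x ^ β * ‖u x‖ ^ 2))
    (η : ℂ) (hη : ‖η‖ < c)
    (F F' F'' : ℝ → ℂ)
    (hF1 : ∀ x ∈ Ici (0:ℝ), HasDerivWithinAt F (F' x) (Ici 0) x)
    (hF2 : ∀ x ∈ Ici (0:ℝ), HasDerivWithinAt F' (F'' x) (Ici 0) x)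
    (hF2c : ContinuousOn F'' (Ici 0))
    (hFL2 : IntegrableOn (fun x => ‖F x‖ ^ 2) (Ioi 0))
    (hF'L2 : IntegrableOn (fun x => ‖F' x‖ ^ 2) (Ioi 0))
    (hF''L2 : IntegrableOn (fun x => ‖F'' x‖ ^ 2) (Ioi 0))
    (hN : F' 0 = 0)
    (hode : ∀ x : ℝ, 0 ≤ x →
      -F'' x + Complex.I * ((x ^ β : ℝ) : ℂ) * F x - η * F x = 0) :
    ∀ x : ℝ, 0 ≤ x → F x = 0 := by
  have hode' : ∀ x ∈ Ici (0 : ℝ), F'' x = rayPotential β η 0 x * F x := by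
    intro x hx
    have h := hode x hx
    simp only [rayPotential, mul_zero, Complex.ofReal_zero, neg_zero, zero_mul, Complex.exp_zero,
      mul_one]
    linear_combination -h
  have hFd : ∀ x ∈ Ici (0 : ℝ), HasDerivWithinAt F' (rayPotential β η 0 x * F x) (Ici 0) x :=
    fun x hx => (hF2 x hx).congr_deriv (hode' x hx)
  intro x hx
  rcases eq_or_lt_of_le hβ with rfl | hβ0
  · exact eq_zero_of_const_coeff (q := Complex.I - η) hF1
      (fun x hx => (hFd x hx).congr_deriv (by simp [rayPotential])) hFL2 hF'L2 hN hx
  · have hγ : 2 ≤ β + 2 := by linarith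
    have hF : ∀ x, 0 ≤ x → F x - F 0 * rayExt (β + 2) η 0 x = 0 := fun x hx =>
      eq_zero_of_hasDerivWithinAt (u := fun x => F x - F 0 * rayExt (β + 2) η 0 x)
        (v := fun x => F' x - F 0 * rayExtDeriv (β + 2) η 0 x)
        (continuous_rayPotential hβ η 0)
        (fun x hx => (hF1 x hx).sub ((hasDerivWithinAt_rayExt hγ η 0 hx).const_mul _))
        (fun x hx => ((hFd x hx).sub
          ((hasDerivWithinAt_rayExtDeriv hβ η 0 hx).const_mul _)).congr_deriv (by ring))
        (by simp [rayExt]) (by simp [rayExtDeriv, hN]) hx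
    by_cases h0 : F 0 = 0
    · simpa [h0] using hF x hx
    · exfalso
      obtain ⟨C, hC⟩ := exists_bound_of_sq_integrable hF1
        (fun x hx => (hF2 x hx).continuousWithinAt) hFL2 hF'L2
      refine not_bounded_of_spectral hβ0 hc hspec hη ⟨C / ‖F 0‖, fun t => ?_⟩
      have h1 := hC _ (Real.exp_pos t).le
      rw [sub_eq_zero.1 (hF _ (Real.exp_pos t).le), rayExt, if_neg (not_le.2 (Real.exp_pos t)),
        rayFun, Real.log_exp, norm_mul] at h1
      rw [le_div_iff₀ (norm_pos_iff.2 h0)]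
      linarith
end
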